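/- For every p > 0, the random variables (N/log N) · d_K(μ_N, ν) converge to 1/π in L_p as N → ∞; that is, E |(N/log N) · d_K(μ_N, ν) − 1/π|^p → 0 as N → ∞. -/

import Mathlib

open MeasureTheory Real Filter

noncomputable section

/-- The Borel σ-algebra on the unitary group `U(N)`. -/
instance (N : ℕ) : MeasurableSpace (Matrix.unitaryGroup (Fin N) ℂ) := borel _

instance (N : ℕ) : BorelSpace (Matrix.unitaryGroup (Fin N) ℂ) := ⟨rfl⟩

/-- The eigenvalue angles (in `[0, 2π)`, with multiplicity) of a unitary matrix `U`:
the arguments of the roots of the characteristic polynomial, shifted to lie in `[0, 2π)`. -/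
def eigenAngles (N : ℕ) (U : Matrix.unitaryGroup (Fin N) ℂ) : Multiset ℝ :=
  ((U : Matrix (Fin N) (Fin N) ℂ).charpoly.roots).map
    (fun z => if 0 ≤ Complex.arg z then Complex.arg z else Complex.arg z + 2 * π)

open Classical in
/-- `𝒩_A`: the number of eigenvalue angles of `U` lying in the set `A`. -/
def countAngles (N : ℕ) (U : Matrix.unitaryGroup (Fin N) ℂ) (A : Set ℝ) : ℕ :=
  Multiset.card ((eigenAngles N U).filter (· ∈ A))

/-- `𝒩_θ`: the number of eigenvalue angles of `U` in `[0, θ]`. -/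
def countFun (N : ℕ) (U : Matrix.unitaryGroup (Fin N) ℂ) (θ : ℝ) : ℕ :=
  countAngles N U (Set.Icc 0 θ)

/-- The Kolmogorov distance between the empirical spectral measure of `U` and the
uniform measure on the circle: `sup_{0 ≤ θ < 2π} |𝒩_θ/N - θ/(2π)|`. -/
def dK (N : ℕ) (U : Matrix.unitaryGroup (Fin N) ℂ) : ℝ :=
  ⨆ θ : Set.Ico (0:ℝ) (2 * π), |(countFun N U θ : ℝ) / N - (θ : ℝ) / (2 * π)|

/-- `max_{1 ≤ k ≤ N} |𝒩_{2πk/N} - k|`. -/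
def maxDev (N : ℕ) (U : Matrix.unitaryGroup (Fin N) ℂ) : ℝ :=
  ⨆ k : (Finset.Icc 1 N : Finset ℕ), |(countFun N U (2 * π * (k : ℕ) / N) : ℝ) - ((k : ℕ) : ℝ)|

end

/-! ### Part B: Haar measure on the unitary groups -/

/-- The unitary group `U(n)`. -/
abbrev UG (n : ℕ) : Type := Matrix.unitaryGroup (Fin n) ℂ

instance ug_second_countable (n : ℕ) : SecondCountableTopology (UG n) := by
  have : SecondCountableTopology (Matrix (Fin n) (Fin n) ℂ) :=
    inferInstanceAs (SecondCountableTopology (Fin n → Fin n → ℂ))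
  exact TopologicalSpace.Subtype.secondCountableTopology _

lemma lintegral_right_inv {n : ℕ} (μ : Measure (UG n)) [IsProbabilityMeasure μ]
    [μ.IsMulLeftInvariant] (f : UG n → ENNReal) (hf : Measurable f) (g : UG n) :
    ∫⁻ x, f (x * g) ∂μ = ∫⁻ x, f x ∂μ := by
  have key : ∀ h : UG n → ENNReal, Measurable h →
      ∫⁻ x, h x⁻¹ ∂μ = ∫⁻ x, h x ∂μ := by
    intro h hh
    have h1 : ∫⁻ y, ∫⁻ x, h (y⁻¹ * x) ∂μ ∂μ = ∫⁻ x, h x ∂μ := by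
      simp [lintegral_mul_left_eq_self]
    have h2 : ∫⁻ x, ∫⁻ y, h (y⁻¹ * x) ∂μ ∂μ = ∫⁻ x, h x⁻¹ ∂μ := by
      have : ∀ x : UG n, ∫⁻ y, h (y⁻¹ * x) ∂μ = ∫⁻ y, h y⁻¹ ∂μ := by
        intro x
        have := lintegral_mul_left_eq_self (μ := μ) (fun y => h y⁻¹) x⁻¹
        rw [← this]
        congr 1; ext y; simp
      simp [this]
    rw [← h1, ← h2, lintegral_lintegral_swap]
    exact (hh.comp (by fun_prop)).aemeasurable
  have h3 := key (fun x => f (x * g)) (by fun_prop)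
  have h4 := key f hf
  rw [← h3, ← h4]
  have := lintegral_mul_left_eq_self (μ := μ) (fun y => f y⁻¹) g⁻¹
  rw [← this]
  congr 1; ext y; simp

/-- The unitary group acts transitively on the unit sphere. -/
lemma exists_unitary_col {n : ℕ} (y : Fin (n + 1) → ℂ) (hy : ∑ i, ‖y i‖ ^ 2 = 1) :
    ∃ G : UG (n + 1), ∀ i, G.1 i 0 = y i := by
  classical
  let v : Fin (n + 1) → EuclideanSpace ℂ (Fin (n + 1)) := fun _ => WithLp.toLp 2 y
  have hv : Orthonormal ℂ (Set.domRestrict ({0} : Set (Fin (n + 1))) v) := by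
    constructor
    · rintro ⟨i, hi⟩
      have : ‖v i‖ ^ 2 = 1 := by
        rw [EuclideanSpace.norm_sq_eq]; exact hy
      have h0 : 0 ≤ ‖v i‖ := norm_nonneg _
      show ‖v i‖ = 1
      nlinarith
    · rintro ⟨i, hi⟩ ⟨j, hj⟩ hij
      rw [Set.mem_singleton_iff] at hi hj
      exact absurd (Subtype.ext (hi.trans hj.symm)) hij
  obtain ⟨b, hb⟩ := Orthonormal.exists_orthonormalBasis_extension_of_card_eq
    (by simp) hv
  refine ⟨⟨Matrix.of fun i j => b j i, ?_⟩, ?_⟩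
  · rw [Matrix.mem_unitaryGroup_iff']
    ext j k
    have := (orthonormal_iff_ite.mp b.orthonormal) j k
    rw [PiLp.inner_apply] at this
    rw [Matrix.mul_apply, Matrix.one_apply, ← this]
    refine Finset.sum_congr rfl fun i _ => ?_
    simp [Matrix.star_apply, mul_comm]
  · intro i
    show b 0 i = y i
    rw [hb 0 rfl]

lemma unitary_col_norm {n : ℕ} (u : UG n) (j : Fin n) : ∑ i, ‖u.1 i j‖ ^ 2 = 1 := by
  have h := Matrix.mem_unitaryGroup_iff'.mp u.2
  have h1 := congrFun (congrFun h j) j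
  rw [Matrix.mul_apply, Matrix.one_apply_eq] at h1
  have h2 : ∀ i, (star u.1) j i * u.1 i j
      = ((‖u.1 i j‖ ^ 2 : ℝ) : ℂ) := by
    intro i
    rw [Matrix.star_apply]
    have := Complex.conj_mul' (u.1 i j)
    push_cast
    exact this
  simp_rw [h2] at h1
  exact_mod_cast h1

/-- `1 ⊕ V` as a matrix. -/
noncomputable def embM {n : ℕ} (V : Matrix (Fin n) (Fin n) ℂ) : Matrix (Fin (n + 1)) (Fin (n + 1)) ℂ :=
  Matrix.of fun i j => Fin.cases (motive := fun _ => ℂ)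
    (Fin.cases (motive := fun _ => ℂ) 1 (fun _ => 0) j)
    (fun i' => Fin.cases (motive := fun _ => ℂ) 0 (fun j' => V i' j') j) i

@[simp] lemma embM_zz {n : ℕ} (V : Matrix (Fin n) (Fin n) ℂ) : embM V 0 0 = 1 := rfl
@[simp] lemma embM_zs {n : ℕ} (V : Matrix (Fin n) (Fin n) ℂ) (j) : embM V 0 (Fin.succ j) = 0 := rfl
@[simp] lemma embM_sz {n : ℕ} (V : Matrix (Fin n) (Fin n) ℂ) (i) : embM V (Fin.succ i) 0 = 0 := rfl
@[simp] lemma embM_ss {n : ℕ} (V : Matrix (Fin n) (Fin n) ℂ) (i j) :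
    embM V (Fin.succ i) (Fin.succ j) = V i j := rfl

lemma embM_mul {n : ℕ} (V W : Matrix (Fin n) (Fin n) ℂ) : embM V * embM W = embM (V * W) := by
  ext i j
  rw [Matrix.mul_apply, Fin.sum_univ_succ]
  refine Fin.cases ?_ (fun i => ?_) i <;> refine Fin.cases ?_ (fun j => ?_) j <;>
    simp [Matrix.mul_apply]

lemma embM_one {n : ℕ} : embM (1 : Matrix (Fin n) (Fin n) ℂ) = 1 := by
  ext i j
  refine Fin.cases ?_ (fun i => ?_) i <;> refine Fin.cases ?_ (fun j => ?_) j <;>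
    simp [Matrix.one_apply, Fin.succ_ne_zero, Ne.symm (Fin.succ_ne_zero _)]

lemma embM_star {n : ℕ} (V : Matrix (Fin n) (Fin n) ℂ) : star (embM V) = embM (star V) := by
  ext i j
  refine Fin.cases ?_ (fun i => ?_) i <;> refine Fin.cases ?_ (fun j => ?_) j <;>
    simp [Matrix.star_apply]

/-- `1 ⊕ V` in the unitary group. -/
noncomputable def emb {n : ℕ} (V : UG n) : UG (n + 1) :=
  ⟨embM V.1, by
    rw [Matrix.mem_unitaryGroup_iff, embM_star, embM_mul, Matrix.mem_unitaryGroup_iff.mp V.2,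
      embM_one]⟩

lemma emb_mul {n : ℕ} (V W : UG n) : emb V * emb W = emb (V * W) :=
  Subtype.ext (embM_mul _ _)

lemma emb_inv {n : ℕ} (V : UG n) : (emb V)⁻¹ = emb V⁻¹ :=
  Subtype.ext (embM_star _)

lemma emb_continuous {n : ℕ} : Continuous (emb (n := n)) := by
  refine Continuous.subtype_mk ?_ _
  refine continuous_matrix fun i j => ?_
  refine Fin.cases ?_ (fun i => ?_) i <;> refine Fin.cases ?_ (fun j => ?_) j <;> simp
  · exact continuous_const
  · exact continuous_const
  · exact continuous_const
  · exact continuous_subtype_val.matrix_elem i j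

lemma exists_emb {n : ℕ} (X : UG (n + 1)) (hX : ∀ i, X.1 i 0 = if i = 0 then 1 else 0) :
    ∃ Y : UG n, X = emb Y := by
  have h := Matrix.mem_unitaryGroup_iff'.mp X.2
  have hrow : ∀ j : Fin n, X.1 0 j.succ = 0 := by
    intro j
    have h1 := congrFun (congrFun h 0) j.succ
    rw [Matrix.mul_apply, Fin.sum_univ_succ] at h1
    simpa [Matrix.star_apply, hX, Fin.succ_ne_zero, Matrix.one_apply,
      Ne.symm (Fin.succ_ne_zero _)] using h1
  have hX' : X.1 = embM (Matrix.of fun i j => X.1 i.succ j.succ) := by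
    ext i j
    refine Fin.cases ?_ (fun i => ?_) i <;> refine Fin.cases ?_ (fun j => ?_) j <;>
      simp [hX, hrow]
  refine ⟨⟨Matrix.of fun i j => X.1 i.succ j.succ, ?_⟩, Subtype.ext hX'⟩
  rw [Matrix.mem_unitaryGroup_iff']
  rw [hX', embM_star, embM_mul, ← embM_one] at h
  ext i j
  have := congrFun (congrFun h i.succ) j.succ
  simpa using this

/-- The complementary modulus. -/
noncomputable def rho (a : ℂ) : ℝ := Real.sqrt (1 - ‖a‖ ^ 2)

/-- The matrix `[[a, ρ], [ρ, -ā]] ⊕ I`. -/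
noncomputable def thM (n : ℕ) (a : ℂ) : Matrix (Fin (n + 2)) (Fin (n + 2)) ℂ :=
  Matrix.of fun i j => Fin.cases (motive := fun _ => ℂ)
    (Fin.cases (motive := fun _ => ℂ) a
      (fun j' => Fin.cases (motive := fun _ => ℂ) (rho a : ℂ) (fun _ => 0) j') j)
    (fun i' => Fin.cases (motive := fun _ => ℂ)
      (Fin.cases (motive := fun _ => ℂ) (rho a : ℂ)
        (fun j' => Fin.cases (motive := fun _ => ℂ) (-(starRingEnd ℂ a)) (fun _ => 0) j') j)
      (fun i'' => Fin.cases (motive := fun _ => ℂ) 0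
        (fun j' => Fin.cases (motive := fun _ => ℂ) 0 (fun j'' => if i'' = j'' then 1 else 0) j') j)
      i') i

section
variable (n : ℕ) (a : ℂ)
@[simp] lemma thM_00 : thM n a 0 0 = a := rfl
@[simp] lemma thM_01 : thM n a 0 (Fin.succ 0) = rho a := rfl
@[simp] lemma thM_02 (j : Fin n) : thM n a 0 (Fin.succ (Fin.succ j)) = 0 := rfl
@[simp] lemma thM_10 : thM n a (Fin.succ 0) 0 = rho a := rfl
@[simp] lemma thM_11 : thM n a (Fin.succ 0) (Fin.succ 0) = -(starRingEnd ℂ a) := rfl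
@[simp] lemma thM_12 (j : Fin n) : thM n a (Fin.succ 0) (Fin.succ (Fin.succ j)) = 0 := rfl
@[simp] lemma thM_20 (i : Fin n) : thM n a (Fin.succ (Fin.succ i)) 0 = 0 := rfl
@[simp] lemma thM_21 (i : Fin n) : thM n a (Fin.succ (Fin.succ i)) (Fin.succ 0) = 0 := rfl
@[simp] lemma thM_22 (i j : Fin n) : thM n a (Fin.succ (Fin.succ i)) (Fin.succ (Fin.succ j))
    = if i = j then 1 else 0 := rfl
end

lemma rho_sq {a : ℂ} (ha : ‖a‖ ≤ 1) : (rho a : ℂ) * rho a = 1 - a * (starRingEnd ℂ a) := by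
  rw [Complex.mul_conj']
  rw [← Complex.ofReal_mul, rho, Real.mul_self_sqrt]
  · push_cast; rfl
  · have := norm_nonneg a; nlinarith

lemma thM_unitary (n : ℕ) {a : ℂ} (ha : ‖a‖ ≤ 1) : thM n a ∈ Matrix.unitaryGroup (Fin (n + 2)) ℂ := by
  rw [Matrix.mem_unitaryGroup_iff]
  have hr := rho_sq ha
  ext i j
  rw [Matrix.mul_apply, Fin.sum_univ_succ, Fin.sum_univ_succ]
  refine Fin.cases ?_ (fun i => Fin.cases ?_ (fun i => ?_) i) i <;>
  refine Fin.cases ?_ (fun j => Fin.cases ?_ (fun j => ?_) j) j <;>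
    simp only [Matrix.star_apply, thM_00, thM_01, thM_02, thM_10, thM_11, thM_12, thM_20, thM_21,
      thM_22, Matrix.one_apply, Fin.succ_inj, Fin.succ_ne_zero, Ne.symm (Fin.succ_ne_zero _),
      star_zero, RCLike.star_def, Complex.conj_ofReal, map_neg, Complex.conj_conj, mul_zero,
      Finset.sum_const_zero, if_true, if_false, zero_mul, add_zero, zero_add]
  · rw [hr]; ring
  · ring
  · ring
  · rw [hr]; ring
  · simp [Finset.sum_ite_eq]

/-- The reflection attached to `u`, depending only on the entry `u 0 0`. -/
noncomputable def th {n : ℕ} (u : UG (n + 2)) : UG (n + 2) :=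
  ⟨thM n (u.1 0 0), thM_unitary n (entry_norm_bound_of_unitary u.2 0 0)⟩

lemma entry_continuous {n : ℕ} (i j : Fin n) : Continuous (fun u : UG n => u.1 i j) :=
  continuous_subtype_val.matrix_elem i j

lemma th_continuous {n : ℕ} : Continuous (th (n := n)) := by
  refine Continuous.subtype_mk ?_ _
  have h0 := entry_continuous (n := n + 2) 0 0
  have h1 : Continuous (fun u : UG (n + 2) => ((rho (u.1 0 0) : ℝ) : ℂ)) := by
    unfold rho
    exact Complex.continuous_ofReal.comp
      (Real.continuous_sqrt.comp (continuous_const.sub (h0.norm.pow 2)))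
  have h2 : Continuous (fun u : UG (n + 2) => -(starRingEnd ℂ (u.1 0 0))) :=
    (Complex.continuous_conj.comp h0).neg
  refine continuous_matrix fun i j => ?_
  refine Fin.cases ?_ (fun i => Fin.cases ?_ (fun i => ?_) i) i <;>
  refine Fin.cases ?_ (fun j => Fin.cases ?_ (fun j => ?_) j) j <;>
    simp only [thM_00, thM_01, thM_02, thM_10, thM_11, thM_12, thM_20, thM_21, thM_22] <;>
    first | exact h0 | exact h1 | exact h2 | exact continuous_const

lemma exists_decomp {n : ℕ} (u : UG (n + 2)) :
    ∃ G Y : UG (n + 1), u = emb G * th u * emb Y := by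
  have ha : ‖u.1 0 0‖ ≤ 1 := entry_norm_bound_of_unitary u.2 0 0
  obtain ⟨G, hG⟩ : ∃ G : UG (n + 1), ∀ i, G.1 i 0 * rho (u.1 0 0) = u.1 (Fin.succ i) 0 := by
    have hs := unitary_col_norm u 0
    rw [Fin.sum_univ_succ] at hs
    have hrr : rho (u.1 0 0) ^ 2 = ∑ i : Fin (n + 1), ‖u.1 (Fin.succ i) 0‖ ^ 2 := by
      rw [rho, Real.sq_sqrt]
      · linarith
      · have := norm_nonneg (u.1 0 0); nlinarith
    by_cases h0 : rho (u.1 0 0) = 0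
    · refine ⟨1, fun i => ?_⟩
      rw [h0] at hrr ⊢
      have := (Finset.sum_eq_zero_iff_of_nonneg (fun i _ => by positivity)).mp
        (by rw [← hrr]; norm_num : ∑ i : Fin (n + 1), ‖u.1 (Fin.succ i) 0‖ ^ 2 = 0) i
        (Finset.mem_univ _)
      have h2 : u.1 (Fin.succ i) 0 = 0 := by simpa using this
      rw [h2]; simp
    · obtain ⟨G, hG⟩ := exists_unitary_col (fun i => u.1 (Fin.succ i) 0 / (rho (u.1 0 0) : ℂ)) (by
        simp only [norm_div, div_pow]
        rw [← Finset.sum_div, ← hrr, Complex.norm_real, Real.norm_eq_abs, sq_abs]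
        exact div_self (by positivity))
      refine ⟨G, fun i => ?_⟩
      rw [hG]
      exact div_mul_cancel₀ _ (by exact_mod_cast h0)
  have hcol : ∀ i, (emb G * th u).1 i 0 = u.1 i 0 := by
    intro i
    show (embM G.1 * thM n (u.1 0 0)) i 0 = _
    rw [Matrix.mul_apply, Fin.sum_univ_succ, Fin.sum_univ_succ]
    refine Fin.cases ?_ (fun i => ?_) i
    · simp only [embM_zz, embM_zs, thM_00]
      simp
    · simp only [embM_sz, embM_ss, thM_10, thM_20, thM_00]
      simp [hG]
  obtain ⟨Y, hY⟩ := exists_emb ((emb G * th u)⁻¹ * u) (by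
    intro i
    show (star (emb G * th u).1 * u.1) i 0 = _
    have h := congrFun (congrFun (Matrix.mem_unitaryGroup_iff'.mp (emb G * th u).2) i) 0
    rw [Matrix.mul_apply] at h ⊢
    simp only [hcol] at h
    rw [h, Matrix.one_apply])
  refine ⟨G, Y, ?_⟩
  rw [← hY]; group

/-- One step of the Hessenberg reduction. -/
lemma law_step {n : ℕ} (μ : Measure (UG (n + 2))) (ν : Measure (UG (n + 1)))
    [IsProbabilityMeasure μ] [IsProbabilityMeasure ν] [μ.IsMulLeftInvariant]
    [ν.IsMulLeftInvariant] (φ : UG (n + 2) → ENNReal) (hφ : Measurable φ)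
    (hinv : ∀ (W : UG (n + 1)) U, φ (emb W * U * (emb W)⁻¹) = φ U) :
    ∫⁻ u, φ u ∂μ = ∫⁻ u, ∫⁻ V, φ (th u * emb V) ∂ν ∂μ := by
  have hm : Measurable (emb (n := n + 1)) := emb_continuous.measurable
  have h1 : ∫⁻ u, φ u ∂μ = ∫⁻ u, ∫⁻ V, φ (u * emb V) ∂ν ∂μ := by
    rw [lintegral_lintegral_swap]
    · simp [lintegral_right_inv μ φ hφ]
    · exact (hφ.comp (by fun_prop)).aemeasurable
  rw [h1]
  congr 1
  ext u
  obtain ⟨G, Y, hu⟩ := exists_decomp u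
  have h2 : ∀ V, φ (u * emb V) = φ (th u * emb (Y * (V * G))) := by
    intro V
    rw [← hinv G (th u * emb (Y * (V * G)))]
    congr 1
    conv_lhs => rw [hu]
    rw [← emb_mul, ← emb_mul]
    group
  simp_rw [h2]
  have hmm : Measurable fun V => φ (th u * emb V) := by fun_prop
  rw [lintegral_right_inv ν (fun V => φ (th u * emb (Y * V)))
    (by fun_prop) G]
  exact lintegral_mul_left_eq_self (μ := ν) (fun V => φ (th u * emb V)) Y

/-! ### Part C: the product space of independent Haar unitaries and the law of the spectrum -/

/-- Sequences of unitary matrices of increasing size. -/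
abbrev Om : Type := (n : ℕ) → UG (n + 1)

section
variable (μ : (n : ℕ) → Measure (UG (n + 1))) [∀ n, IsProbabilityMeasure (μ n)]

lemma measurable_upd (n : ℕ) :
    Measurable (fun p : Om × UG (n + 1) => (Function.update p.1 n p.2 : Om)) := by
  refine measurable_pi_lambda _ fun k => ?_
  by_cases h : k = n
  · subst h
    simpa using measurable_snd
  · simp only [Function.update_of_ne h]
    exact (measurable_pi_apply k).comp measurable_fst

lemma resample_mp (n : ℕ) :
    MeasurePreserving (fun p : Om × UG (n + 1) => (Function.update p.1 n p.2 : Om))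
      ((Measure.infinitePi μ).prod (μ n)) (Measure.infinitePi μ) := by
  refine ⟨measurable_upd n, ?_⟩
  apply Measure.eq_infinitePi
  intro s t ht
  have hms : MeasurableSet ((s : Set ℕ).pi t) :=
    MeasurableSet.pi (Finset.countable_toSet s) (fun i _ => ht i)
  rw [Measure.map_apply (measurable_upd n) hms]
  by_cases hn : n ∈ s
  · have : (fun p : Om × UG (n + 1) => (Function.update p.1 n p.2 : Om)) ⁻¹' ((s : Set ℕ).pi t)
        = (((s.erase n : Finset ℕ) : Set ℕ).pi t) ×ˢ (t n) := by
      ext p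
      simp only [Set.mem_preimage, Set.mem_pi, Set.mem_prod, Finset.coe_erase, Set.mem_sdiff,
        Finset.mem_coe, Set.mem_singleton_iff]
      constructor
      · intro h
        refine ⟨fun i hi => ?_, ?_⟩
        · have := h i hi.1
          rwa [Function.update_of_ne hi.2] at this
        · simpa using h n hn
      · rintro ⟨h1, h2⟩ i hi
        by_cases hin : i = n
        · subst hin; simpa using h2
        · rw [Function.update_of_ne hin]; exact h1 i ⟨hi, hin⟩
    rw [this, Measure.prod_prod, Measure.infinitePi_pi _ (fun i _ => ht i),
      Finset.prod_erase_mul _ _ hn]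
  · have : (fun p : Om × UG (n + 1) => (Function.update p.1 n p.2 : Om)) ⁻¹' ((s : Set ℕ).pi t)
        = ((s : Set ℕ).pi t) ×ˢ Set.univ := by
      ext p
      simp only [Set.mem_preimage, Set.mem_pi, Set.mem_prod, Finset.mem_coe, Set.mem_univ, and_true]
      refine forall₂_congr fun i hi => ?_
      rw [Function.update_of_ne (by rintro rfl; exact hn hi)]
    rw [this, Measure.prod_prod, Measure.infinitePi_pi _ (fun i _ => ht i)]
    simp

lemma resample_lint (n : ℕ) (F : Om → ENNReal) (hF : Measurable F) :
    ∫⁻ ω, F ω ∂(Measure.infinitePi μ)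
      = ∫⁻ ω, ∫⁻ u, F (Function.update ω n u) ∂(μ n) ∂(Measure.infinitePi μ) := by
  rw [← (resample_mp μ n).lintegral_comp hF]
  exact lintegral_prod _ (hF.comp (measurable_upd n)).aemeasurable

lemma resample_int {E : Type*} [NormedAddCommGroup E] [NormedSpace ℝ E] (n : ℕ) (F : Om → E)
    (hF : Integrable F (Measure.infinitePi μ)) :
    ∫ ω, F ω ∂(Measure.infinitePi μ)
      = ∫ ω, ∫ u, F (Function.update ω n u) ∂(μ n) ∂(Measure.infinitePi μ) := by
  have hmp := resample_mp μ n
  have h1 : ∫ ω, F ω ∂(Measure.infinitePi μ) = ∫ p : Om × UG (n + 1), F (Function.update p.1 n p.2)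
      ∂((Measure.infinitePi μ).prod (μ n)) := by
    conv_lhs => rw [← hmp.map_eq]
    rw [integral_map hmp.measurable.aemeasurable]
    rw [hmp.map_eq]; exact hF.aestronglyMeasurable
  rw [h1, integral_prod]
  exact hmp.integrable_comp_of_integrable hF

end

/-- The random unitary matrix of size `n + 1` built from reflections. -/
noncomputable def TT : (n : ℕ) → Om → UG (n + 1)
  | 0, ω => ω 0
  | n + 1, ω => th (ω (n + 1)) * emb (TT n ω)

lemma TT_measurable (n : ℕ) : Measurable (TT n) := by
  induction n with
  | zero => exact measurable_pi_apply 0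
  | succ n ih =>
    have h1 : Measurable fun ω : Om => th (ω (n + 1)) :=
      th_continuous.measurable.comp (measurable_pi_apply (n + 1))
    have h2 : Measurable fun ω : Om => emb (TT n ω) := emb_continuous.measurable.comp ih
    exact h1.mul h2

lemma TT_update (n k : ℕ) (h : n < k) (ω : Om) (u : UG (k + 1)) :
    TT n (Function.update ω k u) = TT n ω := by
  induction n with
  | zero => simp only [TT]; rw [Function.update_of_ne (by omega)]
  | succ n ih =>
    simp only [TT]
    rw [ih (by omega), Function.update_of_ne (by omega)]

lemma th_comm {n : ℕ} (u : UG (n + 2)) (W : UG n) :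
    th u * emb (emb W) = emb (emb W) * th u := by
  apply Subtype.ext
  show thM n (u.1 0 0) * embM (embM W.1) = embM (embM W.1) * thM n (u.1 0 0)
  ext i j
  rw [Matrix.mul_apply, Matrix.mul_apply, Fin.sum_univ_succ, Fin.sum_univ_succ, Fin.sum_univ_succ,
    Fin.sum_univ_succ]
  refine Fin.cases ?_ (fun i => Fin.cases ?_ (fun i => ?_) i) i <;>
  refine Fin.cases ?_ (fun j => Fin.cases ?_ (fun j => ?_) j) j <;>
    simp only [thM_00, thM_01, thM_02, thM_10, thM_11, thM_12, thM_20, thM_21,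
      thM_22, embM_zz, embM_zs, embM_sz, embM_ss] <;> simp

lemma law_TT (μ : (n : ℕ) → Measure (UG (n + 1))) [∀ n, IsProbabilityMeasure (μ n)]
    [∀ n, (μ n).IsMulLeftInvariant] (n : ℕ) (φ : UG (n + 1) → ENNReal) (hφ : Measurable φ)
    (hinv : ∀ (W : UG n) U, φ (emb W * U * (emb W)⁻¹) = φ U) :
    ∫⁻ u, φ u ∂(μ n) = ∫⁻ ω, φ (TT n ω) ∂(Measure.infinitePi μ) := by
  induction n with
  | zero =>
    exact ((measurePreserving_eval_infinitePi μ 0).lintegral_comp hφ).symm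
  | succ n ih =>
    rw [law_step (μ (n + 1)) (μ n) φ hφ hinv]
    have h1 : ∀ u, ∫⁻ V, φ (th u * emb V) ∂(μ n)
        = ∫⁻ ω, φ (th u * emb (TT n ω)) ∂(Measure.infinitePi μ) := by
      intro u
      refine ih (fun V => φ (th u * emb V)) ?_ ?_
      · have := (emb_continuous (n := n + 1)).measurable
        fun_prop
      · intro W V
        rw [← hinv (emb W) (th u * emb V), ← emb_mul, ← emb_mul, ← emb_inv]
        congr 1
        rw [← mul_assoc, ← mul_assoc, th_comm]
        group
    simp_rw [h1]
    rw [lintegral_lintegral_swap]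
    · rw [resample_lint μ (n + 1) (fun ω => φ (TT (n + 1) ω)) (hφ.comp (TT_measurable _))]
      simp only [TT]
      refine lintegral_congr fun ω => lintegral_congr fun u => ?_
      rw [TT_update n (n + 1) (by omega), Function.update_self]
    · refine (hφ.comp ?_).aemeasurable
      have h1 : Measurable fun p : UG (n + 2) × Om => th p.1 :=
        th_continuous.measurable.comp measurable_fst
      have h2 : Measurable fun p : UG (n + 2) × Om => emb (TT n p.2) :=
        emb_continuous.measurable.comp ((TT_measurable n).comp measurable_snd)
      exact h1.mul h2

/-! Moments of the first entry -/

section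
variable {n : ℕ} (μ : Measure (UG (n + 1))) [IsProbabilityMeasure μ] [μ.IsMulLeftInvariant]

lemma rot_int {E : Type*} [NormedAddCommGroup E] [NormedSpace ℝ E] (f : ℂ → E)
    (y : Fin (n + 1) → ℂ) (hy : ∑ i, ‖y i‖ ^ 2 = 1) :
    ∫ u, f (∑ i, starRingEnd ℂ (y i) * u.1 i 0) ∂μ = ∫ u, f (u.1 0 0) ∂μ := by
  obtain ⟨G, hG⟩ := exists_unitary_col y hy
  rw [← integral_mul_left_eq_self (μ := μ) (fun u => f (u.1 0 0)) G⁻¹]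
  congr 1
  ext u
  congr 1
  show _ = (star G.1 * u.1) 0 0
  rw [Matrix.mul_apply]
  refine Finset.sum_congr rfl fun i _ => ?_
  rw [Matrix.star_apply, hG]; rfl

lemma rot_meas (s : Set ℂ) (hs : MeasurableSet s)
    (y : Fin (n + 1) → ℂ) (hy : ∑ i, ‖y i‖ ^ 2 = 1) :
    μ {u | (∑ i, starRingEnd ℂ (y i) * u.1 i 0) ∈ s} = μ {u | u.1 0 0 ∈ s} := by
  obtain ⟨G, hG⟩ := exists_unitary_col y hy
  rw [← measure_preimage_mul μ G⁻¹ {u | u.1 0 0 ∈ s}]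
  congr 1
  ext u
  show _ ↔ (star G.1 * u.1) 0 0 ∈ s
  rw [Matrix.mul_apply]
  have : ∑ i, starRingEnd ℂ (y i) * u.1 i 0 = ∑ i, (star G.1) 0 i * u.1 i 0 := by
    refine Finset.sum_congr rfl fun i _ => ?_
    rw [Matrix.star_apply, hG]; rfl
  rw [← this]; rfl

lemma single_int {E : Type*} [NormedAddCommGroup E] [NormedSpace ℝ E] (f : ℂ → E)
    (c : ℂ) (hc : ‖c‖ = 1) (j : Fin (n + 1)) :
    ∫ u, f (c * u.1 j 0) ∂μ = ∫ u, f (u.1 0 0) ∂μ := by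
  rw [← rot_int μ f (fun i => if i = j then starRingEnd ℂ c else 0)]
  · congr 1; ext u; congr 1
    rw [Finset.sum_eq_single j] <;> simp +contextual
  · rw [Finset.sum_eq_single j] <;> simp +contextual [hc]

lemma mom1 : ∫ u, u.1 0 0 ∂μ = 0 := by
  have := single_int μ (fun z => z) (-1) (by simp) 0
  simp only [neg_mul, one_mul, integral_neg] at this
  exact self_eq_neg.mp this.symm

lemma mom1' : ∫ u, (u.1 0 0) ^ 2 ∂μ = 0 := by
  have := single_int μ (fun z => z ^ 2) Complex.I (by simp) 0
  simp only [mul_pow, Complex.I_sq, neg_mul, one_mul, integral_neg] at this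
  exact self_eq_neg.mp this.symm

lemma bdd_integrable {E : Type*} [NormedAddCommGroup E] {f : UG (n + 1) → E}
    [SecondCountableTopology E] [MeasurableSpace E] [BorelSpace E]
    (hf : Continuous f) (C : ℝ) (hC : ∀ u, ‖f u‖ ≤ C) : Integrable f μ :=
  Integrable.of_bound hf.measurable.aestronglyMeasurable C (Eventually.of_forall hC)

lemma mom2 : ∫ u, ‖u.1 0 0‖ ^ 2 ∂μ = 1 / (n + 1) := by
  have h1 : ∀ j : Fin (n + 1), ∫ u, ‖u.1 j 0‖ ^ 2 ∂μ = ∫ u, ‖u.1 0 0‖ ^ 2 ∂μ := by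
    intro j
    have := single_int μ (fun z => ‖z‖ ^ 2) 1 (by simp) j
    simpa using this
  have h2 : ∫ u, ∑ j, ‖u.1 j 0‖ ^ 2 ∂μ = 1 := by
    simp [unitary_col_norm]
  rw [integral_finsetSum] at h2
  · simp only [h1, Finset.sum_const, Finset.card_univ, Fintype.card_fin, nsmul_eq_mul] at h2
    push_cast at h2
    field_simp
    linarith
  · intro j _
    refine bdd_integrable μ ((entry_continuous j 0).norm.pow 2) 1 fun u => ?_
    rw [norm_pow, norm_norm]
    exact pow_le_one₀ (norm_nonneg _) (entry_norm_bound_of_unitary u.2 j 0)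

lemma four_id (x y : ℂ) : ‖x + y‖ ^ 4 + ‖x - y‖ ^ 4 + ‖x + Complex.I * y‖ ^ 4
    + ‖x - Complex.I * y‖ ^ 4 = 4 * (‖x‖ ^ 4 + ‖y‖ ^ 4 + 4 * (‖x‖ ^ 2 * ‖y‖ ^ 2)) := by
  have h : ∀ z : ℂ, ‖z‖ ^ 4 = (z.re * z.re + z.im * z.im) ^ 2 := by
    intro z
    rw [← Complex.normSq_apply, Complex.normSq_eq_norm_sq]; ring
  have h' : ∀ z : ℂ, ‖z‖ ^ 2 = (z.re * z.re + z.im * z.im) := by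
    intro z
    rw [← Complex.normSq_apply, Complex.normSq_eq_norm_sq]
  simp only [h, h']
  simp
  ring

lemma mom4 : ∫ u, ‖u.1 0 0‖ ^ 4 ∂μ ≤ 2 / ((n : ℝ) + 1) ^ 2 := by
  set m4 := ∫ u, ‖u.1 0 0‖ ^ 4 ∂μ with hm4
  have hi4 : ∀ j : Fin (n + 1), Integrable (fun u : UG (n + 1) => ‖u.1 j 0‖ ^ 4) μ := fun j => by
    refine bdd_integrable μ ((entry_continuous j 0).norm.pow 4) 1 fun u => ?_
    rw [norm_pow, norm_norm]
    exact pow_le_one₀ (norm_nonneg _) (entry_norm_bound_of_unitary u.2 j 0)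
  have hi22 : ∀ i j : Fin (n + 1),
      Integrable (fun u : UG (n + 1) => ‖u.1 i 0‖ ^ 2 * ‖u.1 j 0‖ ^ 2) μ := fun i j => by
    refine bdd_integrable μ (((entry_continuous i 0).norm.pow 2).mul
      ((entry_continuous j 0).norm.pow 2)) 1 fun u => ?_
    rw [norm_mul, norm_pow, norm_norm, norm_pow, norm_norm]
    exact mul_le_one₀ (pow_le_one₀ (norm_nonneg _) (entry_norm_bound_of_unitary u.2 i 0))
      (by positivity) (pow_le_one₀ (norm_nonneg _) (entry_norm_bound_of_unitary u.2 j 0))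
  have h1 : ∀ j : Fin (n + 1), ∫ u, ‖u.1 j 0‖ ^ 4 ∂μ = m4 := by
    intro j
    have := single_int μ (fun z => ‖z‖ ^ 4) 1 (by simp) j
    simpa using this
  have hpair : ∀ i j : Fin (n + 1), i ≠ j → ∀ c : ℂ, ‖c‖ = 1 →
      ∫ u, ‖u.1 i 0 + c * u.1 j 0‖ ^ 4 ∂μ = 4 * m4 := by
    intro i j hij c hc
    have hsq : ((√2 : ℝ) : ℂ) * ((√2 : ℝ) : ℂ) = 2 := by
      rw [← Complex.ofReal_mul, Real.mul_self_sqrt (by norm_num)]; norm_num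
    have hs0 : (√2 : ℝ) ≠ 0 := by positivity
    have := rot_int μ (fun z => ‖z‖ ^ 4)
      (fun k => if k = i then ((1 / √2 : ℝ) : ℂ) else if k = j then
        ((1 / √2 : ℝ) : ℂ) * starRingEnd ℂ c else 0) (by
        rw [← Finset.add_sum_erase _ _ (Finset.mem_univ i),
          ← Finset.add_sum_erase _ _ (Finset.mem_erase.mpr ⟨hij.symm, Finset.mem_univ j⟩),
          Finset.sum_eq_zero]
        · simp only [if_true, hij.symm, if_false, norm_mul, Complex.norm_real, RCLike.norm_conj, hc,
            Real.norm_eq_abs, mul_one, sq_abs, div_pow, one_pow, add_zero]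
          rw [Real.sq_sqrt (by norm_num)]; norm_num
        · intro k hk
          simp only [Finset.mem_erase] at hk
          simp [hk.1, hk.2.1])
    rw [← hm4] at this
    rw [← this, ← integral_const_mul]
    congr 1; ext u
    rw [← Finset.add_sum_erase _ _ (Finset.mem_univ i),
          ← Finset.add_sum_erase _ _ (Finset.mem_erase.mpr ⟨hij.symm, Finset.mem_univ j⟩),
          Finset.sum_eq_zero]
    · simp only [if_true, hij.symm, if_false, map_mul, Complex.conj_ofReal, Complex.conj_conj,
        add_zero]
      rw [mul_assoc, ← mul_add, norm_mul, Complex.norm_real, mul_pow, Real.norm_eq_abs,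
        show |1 / √2| ^ 4 = (|1 / √2| ^ 2) ^ 2 by ring, sq_abs, div_pow, Real.sq_sqrt (by norm_num)]
      ring
    · intro k hk
      simp only [Finset.mem_erase] at hk
      simp [hk.1, hk.2.1]
  have h22 : ∀ i j : Fin (n + 1), i ≠ j → ∫ u, ‖u.1 i 0‖ ^ 2 * ‖u.1 j 0‖ ^ 2 ∂μ = m4 / 2 := by
    intro i j hij
    have hinteg : ∀ c : ℂ, ‖c‖ = 1 →
        Integrable (fun u : UG (n + 1) => ‖u.1 i 0 + c * u.1 j 0‖ ^ 4) μ := fun c hc => by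
      refine bdd_integrable μ (((entry_continuous i 0).add
        (continuous_const.mul (entry_continuous j 0))).norm.pow 4) (2 ^ 4) fun u => ?_
      rw [norm_pow, norm_norm]
      refine pow_le_pow_left₀ (norm_nonneg _) ?_ 4
      refine (norm_add_le _ _).trans ?_
      rw [norm_mul, hc]
      have := entry_norm_bound_of_unitary u.2 i 0
      have := entry_norm_bound_of_unitary u.2 j 0
      linarith
    have e1 := hpair i j hij 1 (by simp)
    have e2 := hpair i j hij (-1) (by simp)
    have e3 := hpair i j hij Complex.I (by simp)
    have e4 := hpair i j hij (-Complex.I) (by simp)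
    have i1 := hinteg 1 (by simp)
    have i2 := hinteg (-1) (by simp)
    have i3 := hinteg Complex.I (by simp)
    have i4 := hinteg (-Complex.I) (by simp)
    have hsum : ∫ u, (‖u.1 i 0 + 1 * u.1 j 0‖ ^ 4 + ‖u.1 i 0 + -1 * u.1 j 0‖ ^ 4
        + ‖u.1 i 0 + Complex.I * u.1 j 0‖ ^ 4 + ‖u.1 i 0 + -Complex.I * u.1 j 0‖ ^ 4) ∂μ
        = 16 * m4 := by
      have i12 : Integrable (fun u : UG (n + 1) => ‖u.1 i 0 + 1 * u.1 j 0‖ ^ 4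
        + ‖u.1 i 0 + -1 * u.1 j 0‖ ^ 4) μ := i1.add i2
      have i123 : Integrable (fun u : UG (n + 1) => ‖u.1 i 0 + 1 * u.1 j 0‖ ^ 4
        + ‖u.1 i 0 + -1 * u.1 j 0‖ ^ 4 + ‖u.1 i 0 + Complex.I * u.1 j 0‖ ^ 4) μ := i12.add i3
      have q1 := integral_add i123 i4
      have q2 := integral_add i12 i3
      have q3 := integral_add i1 i2
      rw [e4] at q1
      rw [e3] at q2
      rw [e1, e2] at q3
      rw [q2, q3] at q1
      refine q1.trans ?_
      ring
    have hsum2 : ∫ u, (‖u.1 i 0 + 1 * u.1 j 0‖ ^ 4 + ‖u.1 i 0 + -1 * u.1 j 0‖ ^ 4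
        + ‖u.1 i 0 + Complex.I * u.1 j 0‖ ^ 4 + ‖u.1 i 0 + -Complex.I * u.1 j 0‖ ^ 4) ∂μ
        = 4 * (m4 + m4 + 4 * ∫ u, ‖u.1 i 0‖ ^ 2 * ‖u.1 j 0‖ ^ 2 ∂μ) := by
      have : ∀ u : UG (n + 1), (‖u.1 i 0 + 1 * u.1 j 0‖ ^ 4 + ‖u.1 i 0 + -1 * u.1 j 0‖ ^ 4
        + ‖u.1 i 0 + Complex.I * u.1 j 0‖ ^ 4 + ‖u.1 i 0 + -Complex.I * u.1 j 0‖ ^ 4)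
        = 4 * (‖u.1 i 0‖ ^ 4 + ‖u.1 j 0‖ ^ 4 + 4 * (‖u.1 i 0‖ ^ 2 * ‖u.1 j 0‖ ^ 2)) := by
        intro u
        rw [← four_id]
        simp only [one_mul, neg_mul, ← sub_eq_add_neg]
      simp_rw [this]
      have i12 : Integrable (fun u : UG (n + 1) => ‖u.1 i 0‖ ^ 4 + ‖u.1 j 0‖ ^ 4) μ :=
        (hi4 i).add (hi4 j)
      have q1 := integral_add i12 ((hi22 i j).const_mul 4)
      have q2 := integral_add (hi4 i) (hi4 j)
      rw [h1, h1] at q2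
      rw [q2, integral_const_mul] at q1
      rw [integral_const_mul, q1]
    linarith
  have hone : ∫ u, (∑ i, ∑ j, ‖u.1 i 0‖ ^ 2 * ‖u.1 j 0‖ ^ 2) ∂μ = 1 := by
    simp_rw [← Finset.sum_mul_sum, unitary_col_norm]
    simp
  rw [integral_finsetSum _ (fun i _ => integrable_finsetSum _ (fun j _ => hi22 i j))] at hone
  simp_rw [integral_finsetSum _ (fun j _ => hi22 _ j)] at hone
  have hrow : ∀ i : Fin (n + 1), ∑ j, ∫ u, ‖u.1 i 0‖ ^ 2 * ‖u.1 j 0‖ ^ 2 ∂μ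
      = m4 + n * (m4 / 2) := by
    intro i
    rw [← Finset.add_sum_erase _ _ (Finset.mem_univ i)]
    rw [Finset.sum_congr rfl (fun j hj => h22 i j (Finset.ne_of_mem_erase hj).symm)]
    simp only [Finset.sum_const, Finset.card_erase_of_mem (Finset.mem_univ i), Finset.card_univ,
      Fintype.card_fin, nsmul_eq_mul, Nat.add_sub_cancel]
    congr 1
    rw [← h1 i]; congr 1; ext u; ring
  simp_rw [hrow] at hone
  simp only [Finset.sum_const, Finset.card_univ, Fintype.card_fin, nsmul_eq_mul] at hone
  push_cast at hone
  have hm0 : 0 ≤ m4 := integral_nonneg fun u => by positivity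
  rw [le_div_iff₀ (by positivity)]
  nlinarith [mul_nonneg hm0 (Nat.cast_nonneg (α := ℝ) n)]

end

lemma null_unit {n : ℕ} (μ : Measure (UG (n + 2))) [IsProbabilityMeasure μ]
    [μ.IsMulLeftInvariant] : ∀ᵐ u ∂μ, ‖u.1 0 0‖ < 1 := by
  let y : ℕ → Fin (n + 2) → ℂ := fun k i =>
    if i = 0 then ((1 / √(1 + (k : ℝ) ^ 2) : ℝ) : ℂ) else if i = 1 then
      ((k / √(1 + (k : ℝ) ^ 2) : ℝ) : ℂ) else 0
  have hpos : ∀ k : ℕ, 0 < 1 + (k : ℝ) ^ 2 := fun k => by positivity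
  have hy0 : ∀ k, y k 0 = ((1 / √(1 + (k : ℝ) ^ 2) : ℝ) : ℂ) := fun k => rfl
  have hy1 : ∀ k, y k (Fin.succ 0) = ((k / √(1 + (k : ℝ) ^ 2) : ℝ) : ℂ) := fun k => rfl
  have hy2 : ∀ k (i : Fin n), y k (Fin.succ (Fin.succ i)) = 0 := by
    intro k i
    have h1 : Fin.succ (Fin.succ i) ≠ 0 := Fin.succ_ne_zero _
    have h2 : Fin.succ (Fin.succ i) ≠ 1 := by
      rw [← Fin.succ_zero_eq_one]
      exact fun h => Fin.succ_ne_zero _ (Fin.succ_injective _ h)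
    simp only [y, if_neg h1, if_neg h2]
  have hy : ∀ k, ∑ i, ‖y k i‖ ^ 2 = 1 := by
    intro k
    rw [Fin.sum_univ_succ, Fin.sum_univ_succ, Finset.sum_eq_zero]
    · simp only [hy0, hy1, Complex.norm_real,
        Real.norm_eq_abs, sq_abs, div_pow, Real.sq_sqrt (hpos k).le]
      have := (hpos k).ne'
      field_simp
      ring
    · intro i _
      rw [hy2]; simp
  have hval : ∀ k (u : UG (n + 2)), ∑ i, starRingEnd ℂ (y k i) * u.1 i 0
      = ((1 / √(1 + (k : ℝ) ^ 2) : ℝ) : ℂ) * (u.1 0 0 + k * u.1 1 0) := by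
    intro k u
    rw [Fin.sum_univ_succ, Fin.sum_univ_succ, Finset.sum_eq_zero]
    · have e : Fin.succ (0 : Fin (n + 1)) = 1 := rfl
      rw [hy0, hy1, Complex.conj_ofReal, Complex.conj_ofReal, e]
      push_cast
      ring
    · intro i _
      rw [hy2]; simp
  let A : ℕ → Set (UG (n + 2)) := fun k =>
    {u | (∑ i, starRingEnd ℂ (y k i) * u.1 i 0) ∈ {z : ℂ | ‖z‖ = 1}}
  have hsm : MeasurableSet {z : ℂ | ‖z‖ = 1} :=
    (isClosed_eq continuous_norm continuous_const).measurableSet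
  have hA : ∀ k, μ (A k) = μ {u | ‖u.1 0 0‖ = 1} := fun k => rot_meas μ _ hsm (y k) (hy k)
  have hkey : ∀ k u, u ∈ A k → u.1 1 0 = k * u.1 0 0 := by
    intro k u hu
    have h1 : ‖∑ i, starRingEnd ℂ (y k i) * u.1 i 0‖ = 1 := hu
    rw [hval, norm_mul, Complex.norm_real, Real.norm_eq_abs, abs_of_pos (by positivity),
      div_mul_eq_mul_div, one_mul, div_eq_one_iff_eq (by positivity)] at h1
    have h2 : ‖u.1 0 0 + k * u.1 1 0‖ ^ 2 = 1 + (k : ℝ) ^ 2 := by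
      rw [h1, Real.sq_sqrt (hpos k).le]
    have h3 := unitary_col_norm u 0
    rw [Fin.sum_univ_succ, Fin.sum_univ_succ] at h3
    have h4 : 0 ≤ ∑ i : Fin n, ‖u.1 (Fin.succ (Fin.succ i)) 0‖ ^ 2 :=
      Finset.sum_nonneg fun i _ => by positivity
    have h5 : ‖u.1 0 0‖ ^ 2 + ‖u.1 1 0‖ ^ 2 ≤ 1 := by
      have : Fin.succ (0 : Fin (n + 1)) = 1 := rfl
      rw [this] at h3; linarith
    have hn : ∀ z : ℂ, ‖z‖ ^ 2 = (z.re * z.re + z.im * z.im) := by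
      intro z
      rw [← Complex.normSq_apply, Complex.normSq_eq_norm_sq]
    have h6 : ‖u.1 0 0 + k * u.1 1 0‖ ^ 2 + ‖u.1 1 0 - k * u.1 0 0‖ ^ 2
        = (1 + (k : ℝ) ^ 2) * (‖u.1 0 0‖ ^ 2 + ‖u.1 1 0‖ ^ 2) := by
      simp only [hn]
      simp
      ring
    have h7 : ‖u.1 1 0 - k * u.1 0 0‖ ^ 2 ≤ 0 := by
      have := mul_le_mul_of_nonneg_left h5 (hpos k).le
      linarith
    have h8 : ‖u.1 1 0 - k * u.1 0 0‖ = 0 := by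
      have := norm_nonneg (u.1 1 0 - k * u.1 0 0)
      nlinarith
    exact sub_eq_zero.mp (norm_eq_zero.mp h8)
  have hdisj : Pairwise (Function.onFun Disjoint A) := by
    intro k l hkl
    rw [Function.onFun, Set.disjoint_left]
    intro u hk hl
    have e1 := hkey k u hk
    have e2 := hkey l u hl
    have e3 : ((k : ℂ) - l) * u.1 0 0 = 0 := by rw [sub_mul, ← e1, ← e2, sub_self]
    have e4 : u.1 0 0 = 0 := by
      rcases mul_eq_zero.mp e3 with h | h
      · exact absurd (by exact_mod_cast sub_eq_zero.mp h) hkl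
      · exact h
    have h1 : ‖∑ i, starRingEnd ℂ (y k i) * u.1 i 0‖ = 1 := hk
    rw [hval, e1, e4] at h1
    simp at h1
  have hAm : ∀ k, MeasurableSet (A k) := by
    intro k
    refine hsm.preimage ?_
    refine Finset.measurable_sum _ fun i _ => ?_
    exact (continuous_const.mul (entry_continuous i 0)).measurable
  have h0 : μ {u | ‖u.1 0 0‖ = 1} = 0 := by
    by_contra hne
    have h1 := measure_iUnion hdisj hAm (μ := μ)
    simp_rw [hA] at h1
    rw [ENNReal.tsum_const_eq_top_of_ne_zero hne] at h1
    exact measure_ne_top μ _ h1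
  have h1 : ∀ᵐ u ∂μ, ¬ (‖u.1 0 0‖ = 1) := by
    rw [ae_iff]; simpa using h0
  filter_upwards [h1] with u hu
  exact lt_of_le_of_ne (entry_norm_bound_of_unitary u.2 0 0) hu

/-- The (0,0) entry of the n-th coordinate. -/
noncomputable def aa (n : ℕ) (ω : Om) : ℂ := (ω n).1 0 0

/-- The Prüfer phases. -/
noncomputable def phi : ℕ → Om → ℝ → ℝ
  | 0, ω, θ => θ - (aa 0 ω).arg
  | n + 1, ω, θ => θ + phi n ω θ
      - 2 * (1 + aa (n + 1) ω * Complex.exp (phi n ω θ * Complex.I)).arg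

/-- Good realizations. -/
def Good (ω : Om) : Prop := ∀ k, ‖aa (k + 1) ω‖ < 1

lemma aa_le (n : ℕ) (ω : Om) : ‖aa n ω‖ ≤ 1 := entry_norm_bound_of_unitary (ω n).2 0 0

lemma aa_zero (ω : Om) : ‖aa 0 ω‖ = 1 := by
  have := unitary_col_norm (ω 0) 0
  simp only [Nat.reduceAdd, Finset.univ_unique, Fin.default_eq_zero, Finset.sum_singleton] at this
  have h : ‖aa 0 ω‖ ^ 2 = 1 := this
  have := norm_nonneg (aa 0 ω)
  nlinarith

lemma slit {w : ℂ} (hw : ‖w‖ < 1) : 1 + w ∈ Complex.slitPlane := by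
  left
  have := Complex.abs_re_le_norm w
  have := neg_abs_le w.re
  simp
  linarith

lemma norm_aw (a : ℂ) (x : ℝ) : ‖a * Complex.exp (x * Complex.I)‖ = ‖a‖ := by
  rw [norm_mul, Complex.norm_exp_ofReal_mul_I, mul_one]

lemma conj_arg (z : ℂ) : z * Complex.exp (-(2 * z.arg) * Complex.I) = starRingEnd ℂ z := by
  conv_lhs => rw [← Complex.norm_mul_exp_arg_mul_I z]
  conv_rhs => rw [← Complex.norm_mul_exp_arg_mul_I z]
  rw [map_mul, Complex.conj_ofReal, ← Complex.exp_conj, mul_assoc, map_mul, Complex.conj_I,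
    Complex.conj_ofReal, ← Complex.exp_add]
  congr 2
  rw [Complex.norm_mul_exp_arg_mul_I]
  ring

lemma eigvec (ω : Om) (hω : Good ω) (θ : ℝ) (n : ℕ) :
    ∃ (x : Fin (n + 1) → ℂ) (Q : ℂ), Q ≠ 0 ∧
      Complex.exp (θ * Complex.I) * x 0 = Q * Complex.exp (phi n ω θ * Complex.I) ∧
      (TT n ω).1.mulVec x 0 = Q ∧
      ∀ i : Fin n, (TT n ω).1.mulVec x i.succ = Complex.exp (θ * Complex.I) * x i.succ := by
  induction n with
  | zero =>
    refine ⟨fun _ => 1, aa 0 ω, ?_, ?_, ?_, fun i => i.elim0⟩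
    · rw [← norm_ne_zero_iff, aa_zero]; exact one_ne_zero
    · have h := Complex.norm_mul_exp_arg_mul_I (aa 0 ω)
      rw [aa_zero] at h
      conv_rhs => rw [← h]
      rw [phi, mul_one, Complex.ofReal_one, one_mul, ← Complex.exp_add]
      congr 1; push_cast; ring
    · simp [Matrix.mulVec, dotProduct, TT, aa]
  | succ n ih =>
    obtain ⟨x, Q, hQ, h1, h2, h3⟩ := ih
    set a := aa (n + 1) ω with ha
    set P := Q * Complex.exp (phi n ω θ * Complex.I) with hP
    set w := a * Complex.exp (phi n ω θ * Complex.I) with hw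
    have hwn : ‖w‖ < 1 := by rw [hw, norm_aw]; exact hω n
    have hwne : 1 + w ≠ 0 := Complex.slitPlane_ne_zero (slit hwn)
    have hr := rho_sq (aa_le (n + 1) ω)
    rw [← ha] at hr
    let xt : Fin (n + 2) → ℂ := Fin.cons (P + starRingEnd ℂ a * Q) (fun i => rho a * x i)
    have hV : (TT (n + 1) ω).1.mulVec xt = (thM n a).mulVec ((embM (TT n ω).1).mulVec xt) := by
      rw [Matrix.mulVec_mulVec]; rfl
    have he0 : (embM (TT n ω).1).mulVec xt 0 = P + starRingEnd ℂ a * Q := by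
      simp [Matrix.mulVec, dotProduct, Fin.sum_univ_succ, xt]
    have hes : ∀ i, (embM (TT n ω).1).mulVec xt (Fin.succ i) = rho a * (TT n ω).1.mulVec x i := by
      intro i
      simp only [Matrix.mulVec, dotProduct]
      rw [Fin.sum_univ_succ, embM_sz, zero_mul, zero_add, Finset.mul_sum]
      refine Finset.sum_congr rfl fun j _ => ?_
      rw [embM_ss]
      simp only [xt, Fin.cons_succ]
      ring
    have ht : ∀ (v : Fin (n + 2) → ℂ) i, (thM n a).mulVec v i = thM n a i 0 * v 0 +
        (thM n a i (Fin.succ 0) * v (Fin.succ 0) + ∑ j : Fin n, thM n a i j.succ.succ * v j.succ.succ) := by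
      intro v i
      simp only [Matrix.mulVec, dotProduct]
      rw [Fin.sum_univ_succ, Fin.sum_univ_succ]
    refine ⟨xt, Q * (1 + w), mul_ne_zero hQ hwne, ?_, ?_, ?_⟩
    · have e : Complex.exp (phi (n + 1) ω θ * Complex.I) = Complex.exp (θ * Complex.I) *
          Complex.exp (phi n ω θ * Complex.I) * Complex.exp (-(2 * (1 + w).arg) * Complex.I) := by
        rw [← Complex.exp_add, ← Complex.exp_add, phi]
        congr 1; push_cast; ring
      have e2 := conj_arg (1 + w)
      have e3 : Complex.exp (phi n ω θ * Complex.I) * starRingEnd ℂ (1 + w)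
          = Complex.exp (phi n ω θ * Complex.I) + starRingEnd ℂ a := by
        rw [hw, map_add, map_one, map_mul, ← Complex.exp_conj, map_mul, Complex.conj_I,
          Complex.conj_ofReal, mul_add, mul_one, mul_left_comm, ← Complex.exp_add]
        simp
      simp only [xt, Fin.cons_zero]
      rw [e, hP]
      calc _ = Q * Complex.exp (θ * Complex.I) *
          (Complex.exp (phi n ω θ * Complex.I) + starRingEnd ℂ a) := by ring
        _ = Q * Complex.exp (θ * Complex.I) * (Complex.exp (phi n ω θ * Complex.I) *
          ((1 + w) * Complex.exp (-(2 * (1 + w).arg) * Complex.I))) := by rw [← e3, ← e2]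
        _ = _ := by ring
    · rw [hV, ht, he0, hes, h2]
      simp only [thM_00, thM_01, thM_02, zero_mul, Finset.sum_const_zero, add_zero]
      have : a * (P + starRingEnd ℂ a * Q) + rho a * (rho a * Q)
        = a * P + Q * (a * starRingEnd ℂ a + rho a * rho a) := by ring
      rw [this, hr, hP, hw]; ring
    · intro i
      rw [hV, ht, he0, hes, h2]
      refine Fin.cases ?_ (fun i => ?_) i
      · simp only [thM_10, thM_11, thM_12, zero_mul, Finset.sum_const_zero, add_zero, xt,
          Fin.cons_succ]
        linear_combination (-(rho a : ℂ)) * h1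
      · simp only [thM_20, thM_21, thM_22, zero_mul, zero_add, xt,
          Fin.cons_succ, hes, h3]
        simp
        ring

lemma phi_char (ω : Om) (hω : Good ω) (θ : ℝ) (n : ℕ) (k : ℤ) (h : phi n ω θ = 2 * π * k) :
    Complex.exp (θ * Complex.I) ∈ (TT n ω).1.charpoly.roots := by
  obtain ⟨x, Q, hQ, h1, h2, h3⟩ := eigvec ω hω θ n
  have he : Complex.exp (phi n ω θ * Complex.I) = 1 := by
    rw [Complex.exp_eq_one_iff]
    exact ⟨k, by rw [h]; push_cast; ring⟩
  rw [he, mul_one] at h1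
  have hx : x ≠ 0 := by
    rintro rfl
    apply hQ; rw [← h1]; simp
  have hV : (TT n ω).1.mulVec x = Complex.exp (θ * Complex.I) • x := by
    ext i
    refine Fin.cases ?_ (fun i => ?_) i
    · rw [h2, Pi.smul_apply, smul_eq_mul, h1]
    · rw [h3]; rfl
  rw [Polynomial.mem_roots (Matrix.charpoly_monic _).ne_zero, Polynomial.IsRoot,
    Matrix.eval_charpoly]
  rw [← Matrix.exists_mulVec_eq_zero_iff]
  refine ⟨x, hx, ?_⟩
  rw [Matrix.sub_mulVec, hV]
  simp [Matrix.scalar_apply, Matrix.smul_mulVec, ← Matrix.smul_one_eq_diagonal]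

lemma phi_deriv (ω : Om) (hω : Good ω) (n : ℕ) (θ : ℝ) :
    ∃ d, 1 ≤ d ∧ HasDerivAt (phi n ω) d θ := by
  induction n with
  | zero => exact ⟨1, le_rfl, (hasDerivAt_id θ).sub_const (aa 0 ω).arg⟩
  | succ n ih =>
    obtain ⟨d, hd, hD⟩ := ih
    set w := aa (n + 1) ω * Complex.exp (phi n ω θ * Complex.I) with hw
    have hwn : ‖w‖ < 1 := by rw [hw, norm_aw]; exact hω n
    have hwne : 1 + w ≠ 0 := Complex.slitPlane_ne_zero (slit hwn)
    have hD1 : HasDerivAt (fun θ : ℝ => 1 + aa (n + 1) ω * Complex.exp (phi n ω θ * Complex.I))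
        (aa (n + 1) ω * (Complex.exp (phi n ω θ * Complex.I) * (d * Complex.I))) θ :=
      (((hD.ofReal_comp.mul_const Complex.I).cexp).const_mul _).const_add _
    have hD2 := hD1.clog_real (slit hwn)
    have hD3 : HasDerivAt (fun θ : ℝ => (Complex.log (1 + aa (n + 1) ω *
        Complex.exp (phi n ω θ * Complex.I))).im) _ θ :=
      Complex.imCLM.hasFDerivAt.comp_hasDerivAt θ hD2
    simp only [Complex.log_im] at hD3
    have hD4 := ((hasDerivAt_id θ).add hD).sub (hD3.const_mul 2)
    refine ⟨_, ?_, hD4⟩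
    have e : (aa (n + 1) ω * (Complex.exp (phi n ω θ * Complex.I) * (d * Complex.I))) /
        (1 + aa (n + 1) ω * Complex.exp (phi n ω θ * Complex.I)) = d * (Complex.I * (w / (1 + w))) := by
      rw [hw]; ring
    rw [e]
    have e2 : Complex.imCLM ((d : ℂ) * (Complex.I * (w / (1 + w)))) = d * (w / (1 + w)).re := by
      simp
    rw [e2]
    have key : 2 * (w / (1 + w)).re ≤ 1 := by
      have e3 : w / (1 + w) = 1 - 1 / (1 + w) := by field_simp; ring
      have hns : 0 < Complex.normSq (1 + w) := Complex.normSq_pos.mpr hwne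
      have hww : Complex.normSq w < 1 := by
        rw [Complex.normSq_eq_norm_sq]
        have := norm_nonneg w
        nlinarith
      have hc : Complex.normSq (1 + w) = 1 + 2 * w.re + Complex.normSq w := by
        simp [Complex.normSq_apply]; ring
      rw [Complex.div_re, ← add_div, ← mul_div_assoc, div_le_one hns, hc]
      simp [Complex.normSq_apply] at *
      linarith
    nlinarith

lemma phi_strictMono (ω : Om) (hω : Good ω) (n : ℕ) : StrictMono (phi n ω) := by
  refine strictMono_of_deriv_pos fun θ => ?_
  obtain ⟨d, hd, hD⟩ := phi_deriv ω hω n θ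
  rw [hD.deriv]; linarith

lemma phi_cont (ω : Om) (hω : Good ω) (n : ℕ) : Continuous (phi n ω) := by
  rw [continuous_iff_continuousAt]
  intro θ
  obtain ⟨d, hd, hD⟩ := phi_deriv ω hω n θ
  exact hD.continuousAt

lemma phi_period (ω : Om) (n : ℕ) (θ : ℝ) :
    phi n ω (θ + 2 * π) = phi n ω θ + 2 * π * (n + 1) := by
  induction n with
  | zero => simp [phi]; ring
  | succ n ih =>
    have : Complex.exp (((phi n ω θ + 2 * π * (n + 1) : ℝ) : ℂ) * Complex.I)
        = Complex.exp (phi n ω θ * Complex.I) := by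
      have h := Complex.exp_periodic.int_mul (n + 1) (phi n ω θ * Complex.I)
      rw [← h]; congr 1; push_cast; ring
    rw [phi, ih, this, phi]; push_cast; ring

noncomputable def angOf (z : ℂ) : ℝ := if 0 ≤ Complex.arg z then Complex.arg z else Complex.arg z + 2 * π

lemma angOf_exp {θ : ℝ} (h0 : 0 ≤ θ) (h1 : θ < 2 * π) : angOf (Complex.exp (θ * Complex.I)) = θ := by
  have hpi := Real.pi_pos
  unfold angOf
  rcases le_or_gt θ π with h | h
  · rw [Complex.arg_exp_mul_I, toIocMod_eq_self (Real.two_pi_pos) |>.mpr ⟨by linarith, by linarith⟩]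
    rw [if_pos h0]
  · have e : Complex.arg (Complex.exp (θ * Complex.I)) = θ - 2 * π := by
      have : Complex.exp (θ * Complex.I) = Complex.exp ((θ - 2 * π : ℝ) * Complex.I) := by
        rw [← Complex.exp_periodic ((θ - 2 * π : ℝ) * Complex.I)]
        congr 1; push_cast; ring
      rw [this, Complex.arg_exp_mul_I, toIocMod_eq_self (Real.two_pi_pos) |>.mpr ⟨by linarith, by linarith⟩]
    rw [e, if_neg (by linarith)]; ring

lemma count_phi (ω : Om) (hω : Good ω) (n : ℕ) {θ : ℝ} (h0 : 0 ≤ θ) (h1 : θ < 2 * π) :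
    |(countFun (n + 1) (TT n ω) θ : ℝ) - (phi n ω θ - phi n ω 0) / (2 * π)| ≤ 1 := by
  have hpi := Real.two_pi_pos
  have hmono := phi_strictMono ω hω n
  set c : ℤ := ⌈phi n ω 0 / (2 * π)⌉ with hc
  have hc1 : phi n ω 0 ≤ 2 * π * c := by
    have := Int.le_ceil (phi n ω 0 / (2 * π))
    rw [div_le_iff₀ hpi] at this; linarith
  have hc2 : 2 * π * c < phi n ω 0 + 2 * π := by
    have := Int.ceil_lt_add_one (phi n ω 0 / (2 * π))
    rw [← sub_lt_iff_lt_add, lt_div_iff₀ hpi] at this; linarith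
  have hper := phi_period ω n 0
  rw [zero_add] at hper
  have hex : ∀ j : Fin (n + 1), ∃ t, 0 ≤ t ∧ t < 2 * π ∧ phi n ω t = 2 * π * ((c + j : ℤ) : ℝ) := by
    intro j
    have hj : (j : ℝ) + 1 ≤ n + 1 := by exact_mod_cast j.2
    have hv : phi n ω 0 ≤ 2 * π * ((c + j : ℤ) : ℝ) ∧ 2 * π * ((c + j : ℤ) : ℝ) < phi n ω (2 * π) := by
      rw [hper]; push_cast
      have : (0:ℝ) ≤ j := by positivity
      constructor <;> nlinarith
    obtain ⟨t, ⟨ht0, ht1⟩, ht⟩ := intermediate_value_Icc hpi.le (phi_cont ω hω n).continuousOn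
      ⟨hv.1, hv.2.le⟩
    refine ⟨t, ht0, lt_of_le_of_ne ht1 ?_, ht⟩
    rintro rfl
    exact hv.2.ne ht.symm
  choose g hg0 hg1 hg using hex
  have hginj : Function.Injective g := by
    intro i j hij
    have := hg i
    rw [hij, hg j] at this
    have h2 := mul_left_cancel₀ hpi.ne' this
    have h3 : (c + j : ℤ) = (c + i : ℤ) := by exact_mod_cast h2
    apply Fin.ext; omega
  let z : Fin (n + 1) → ℂ := fun j => Complex.exp (g j * Complex.I)
  have hz : ∀ j, angOf (z j) = g j := fun j => angOf_exp (hg0 j) (hg1 j)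
  have hzinj : Function.Injective z := by
    intro i j hij
    apply hginj
    rw [← hz, ← hz, hij]
  have hroots : (Finset.univ.image z).val = (TT n ω).1.charpoly.roots := by
    apply Multiset.eq_of_le_of_card_le
    · rw [Finset.val_le_iff_val_subset]
      intro y hy
      rw [Finset.mem_val, Finset.mem_image] at hy
      obtain ⟨j, _, rfl⟩ := hy
      exact phi_char ω hω _ n _ (hg j)
    · refine (Polynomial.card_roots' _).trans ?_
      rw [Matrix.charpoly_natDegree_eq_dim, Finset.card_val, Finset.card_image_of_injective _ hzinj]
      simp
  have hang : eigenAngles (n + 1) (TT n ω) = (Finset.univ.val).map g := by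
    have e0 : eigenAngles (n + 1) (TT n ω) = (TT n ω).1.charpoly.roots.map angOf := rfl
    rw [e0, ← hroots, Finset.image_val_of_injOn hzinj.injOn, Multiset.map_map]
    refine Multiset.map_congr rfl fun j _ => hz j
  have hcount : countFun (n + 1) (TT n ω) θ = (Finset.univ.filter (fun j => g j ≤ θ)).card := by
    unfold countFun countAngles
    rw [hang, Multiset.filter_map, Multiset.card_map, Finset.card_def, Finset.filter_val]
    congr 1
    convert Multiset.filter_congr (s := (Finset.univ : Finset (Fin (n + 1))).val)
      (p := fun j => g j ∈ Set.Icc 0 θ) (q := fun j => g j ≤ θ) (fun j _ => by simp [hg0 j]) using 1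
    congr!
  have hiff : ∀ j, g j ≤ θ ↔ (j : ℕ) < (⌊phi n ω θ / (2 * π)⌋ - c + 1).toNat := by
    intro j
    rw [← hmono.le_iff_le, hg, mul_comm, ← le_div_iff₀ hpi, ← Int.le_floor]
    omega
  set L : ℤ := ⌊phi n ω θ / (2 * π)⌋ with hL
  have hL1 : (L : ℝ) ≤ phi n ω θ / (2 * π) := Int.floor_le _
  have hL2 : phi n ω θ / (2 * π) < L + 1 := Int.lt_floor_add_one _
  have hle0 : phi n ω 0 ≤ phi n ω θ := hmono.monotone h0
  have hlt0 : phi n ω θ < phi n ω (2 * π) := hmono h1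
  have hLc : 0 ≤ L - c + 1 := by
    have : (c : ℝ) < L + 2 := by
      have a1 : phi n ω 0 / (2 * π) ≤ phi n ω θ / (2 * π) := by gcongr
      have a2 := Int.ceil_lt_add_one (phi n ω 0 / (2 * π))
      rw [← hc] at a2
      linarith
    have : c < L + 2 := by exact_mod_cast this
    omega
  have hLN : L - c + 1 ≤ n + 1 := by
    have : (L : ℝ) < c + (n + 1) := by
      refine lt_of_le_of_lt hL1 ?_
      rw [div_lt_iff₀ hpi]
      nlinarith
    have : L < c + (n + 1) := by exact_mod_cast this
    omega
  have hcard : (Finset.univ.filter (fun j => g j ≤ θ)).card = (L - c + 1).toNat := by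
    simp_rw [hiff]
    rw [Fin.card_filter_val_lt]
    omega
  rw [hcount, hcard]
  have e5 : (((L - c + 1).toNat : ℕ) : ℝ) = L - c + 1 := by
    have : (((L - c + 1).toNat : ℤ)) = L - c + 1 := Int.toNat_of_nonneg hLc
    exact_mod_cast congrArg (Int.cast (R := ℝ)) this
  rw [e5, sub_div, abs_le]
  have a1 := Int.le_ceil (phi n ω 0 / (2 * π))
  have a2 := Int.ceil_lt_add_one (phi n ω 0 / (2 * π))
  rw [← hc] at a1 a2
  constructor <;> linarith

lemma eigenAngles_conj {N : ℕ} (W U : UG N) : eigenAngles N (W * U * W⁻¹) = eigenAngles N U := by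
  unfold eigenAngles
  have : (W * U * W⁻¹ : UG N).1.charpoly = U.1.charpoly := by
    have h1 : (W * U * W⁻¹ : UG N).1 = (W * U : UG N).1 * (W⁻¹ : UG N).1 := rfl
    have h2 : (W⁻¹ : UG N).1 * (W * U : UG N).1 = (W⁻¹ * (W * U) : UG N).1 := rfl
    rw [h1, Matrix.charpoly_mul_comm, h2, inv_mul_cancel_left]
  rw [this]

lemma countFun_conj {N : ℕ} (W U : UG N) (θ : ℝ) :
    countFun N (W * U * W⁻¹) θ = countFun N U θ := by
  unfold countFun countAngles
  rw [eigenAngles_conj]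

open scoped ComplexOrder in
lemma root_norm {N : ℕ} (U : UG N) {z : ℂ} (hz : z ∈ U.1.charpoly.roots) : ‖z‖ = 1 := by
  rw [Polynomial.mem_roots (Matrix.charpoly_monic _).ne_zero, Polynomial.IsRoot,
    Matrix.eval_charpoly, ← Matrix.exists_mulVec_eq_zero_iff] at hz
  obtain ⟨x, hx, h⟩ := hz
  rw [Matrix.sub_mulVec] at h
  have h1 : U.1.mulVec x = z • x := by
    rw [sub_eq_zero] at h
    rw [← h]
    simp [Matrix.scalar_apply, Matrix.smul_mulVec, ← Matrix.smul_one_eq_diagonal]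
  have h2 : dotProduct (star (U.1.mulVec x)) (U.1.mulVec x) = dotProduct (star x) x := by
    rw [Matrix.star_mulVec, ← Matrix.dotProduct_mulVec, Matrix.mulVec_mulVec]
    have : U.1.conjTranspose * U.1 = 1 := Matrix.mem_unitaryGroup_iff'.mp U.2
    rw [this, Matrix.one_mulVec]
  rw [h1, star_smul, smul_dotProduct, dotProduct_smul, smul_eq_mul, smul_eq_mul, ← mul_assoc] at h2
  have h3 : dotProduct (star x) x ≠ 0 := by
    rwa [Ne, dotProduct_star_self_eq_zero]
  have h4 : star z * z = 1 := mul_right_cancel₀ h3 (by rw [h2, one_mul])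
  have h5 : ‖star z * z‖ = 1 := by rw [h4, norm_one]
  rw [norm_mul, norm_star] at h5
  have := norm_nonneg z
  nlinarith

lemma exp_angOf {z : ℂ} (hz : ‖z‖ = 1) : Complex.exp (angOf z * Complex.I) = z := by
  have h := Complex.norm_mul_exp_arg_mul_I z
  rw [hz, Complex.ofReal_one, one_mul] at h
  unfold angOf
  split_ifs
  · exact h
  · rw [← Complex.exp_periodic (z.arg * Complex.I)] at h
    refine Eq.trans ?_ h
    congr 1; push_cast; ring

lemma angOf_mem (z : ℂ) : 0 ≤ angOf z ∧ angOf z < 2 * π := by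
  have h1 := Complex.neg_pi_lt_arg z
  have h2 := Complex.arg_le_pi z
  have := Real.pi_pos
  unfold angOf
  split_ifs <;> constructor <;> linarith

lemma eigen_fin {N : ℕ} (U : UG N) : ∃ x : Fin N → ℝ,
    eigenAngles N U = (Finset.univ.val).map x := by
  have hcard : Multiset.card (eigenAngles N U) = N := by
    unfold eigenAngles
    rw [Multiset.card_map, ← (IsAlgClosed.splits U.1.charpoly).natDegree_eq_card_roots,
      Matrix.charpoly_natDegree_eq_dim, Fintype.card_fin]
  obtain ⟨l, hl⟩ := Quotient.exists_rep (eigenAngles N U)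
  rw [← hl] at hcard ⊢
  have hlen : l.length = N := hcard
  refine ⟨fun i => l.get (i.cast hlen.symm), ?_⟩
  rw [Fin.univ_val_map]
  congr 1
  subst hlen
  simp

/-- closed set parametrizing eigenangles. -/
def CC (N : ℕ) (θ : ℝ) (T : Finset (Fin N)) : Set (UG N × (Fin N → ℝ)) :=
  {q | (∀ i, q.2 i ∈ Set.Icc 0 (2 * π)) ∧ (∀ i ∈ T, q.2 i ≤ θ) ∧
    ∀ w : ℂ, (Matrix.scalar (Fin N) w - q.1.1).det = ∏ i, (w - Complex.exp (q.2 i * Complex.I))}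

lemma CC_closed (N : ℕ) (θ : ℝ) (T : Finset (Fin N)) : IsClosed (CC N θ T) := by
  have hc : ∀ i, Continuous fun q : UG N × (Fin N → ℝ) => q.2 i := fun i =>
    (continuous_apply i).comp continuous_snd
  have h1 : CC N θ T = (⋂ i, {q | q.2 i ∈ Set.Icc 0 (2 * π)}) ∩ ((⋂ i ∈ T, {q | q.2 i ≤ θ}) ∩
      ⋂ w : ℂ, {q | (Matrix.scalar (Fin N) w - q.1.1).det
        = ∏ i, (w - Complex.exp (q.2 i * Complex.I))}) := by
    ext q; simp [CC]
  rw [h1]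
  refine IsClosed.inter ?_ (IsClosed.inter ?_ ?_)
  · exact isClosed_iInter fun i => isClosed_Icc.preimage (hc i)
  · exact isClosed_iInter fun i => isClosed_iInter fun _ => isClosed_le (hc i) continuous_const
  · refine isClosed_iInter fun w => isClosed_eq ?_ ?_
    · exact (continuous_const.sub (continuous_subtype_val.comp continuous_fst)).matrix_det
    · refine continuous_finsetProd _ fun i _ => ?_
      exact continuous_const.sub (Complex.continuous_exp.comp
        ((Complex.continuous_ofReal.comp (hc i)).mul continuous_const))

lemma CC_image (N : ℕ) (θ : ℝ) (T : Finset (Fin N)) : IsClosed (Prod.fst '' (CC N θ T)) := by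
  let B : Set (Fin N → ℝ) := Set.univ.pi fun _ => Set.Icc 0 (2 * π)
  have hB : IsCompact B := isCompact_univ_pi fun _ => isCompact_Icc
  have : CompactSpace B := isCompact_iff_compactSpace.mp hB
  let f : UG N × B → UG N × (Fin N → ℝ) := fun q => (q.1, q.2.1)
  have hf : Continuous f := continuous_fst.prodMk (continuous_subtype_val.comp continuous_snd)
  have h1 : Prod.fst '' (CC N θ T) = Prod.fst '' (f ⁻¹' (CC N θ T)) := by
    ext u
    constructor
    · rintro ⟨⟨v, x⟩, h, rfl⟩
      exact ⟨(v, ⟨x, fun i _ => h.1 i⟩), h, rfl⟩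
    · rintro ⟨⟨v, x⟩, h, rfl⟩
      exact ⟨(v, x.1), h, rfl⟩
  rw [h1]
  exact isClosedMap_fst_of_compactSpace _ ((CC_closed N θ T).preimage hf)

lemma count_map {N : ℕ} (U : UG N) (θ : ℝ) (x : Fin N → ℝ)
    (h : eigenAngles N U = (Finset.univ.val).map x) :
    countFun N U θ = (Finset.univ.filter (fun i => x i ∈ Set.Icc 0 θ)).card := by
  unfold countFun countAngles
  rw [h, Multiset.filter_map, Multiset.card_map, Finset.card_def, Finset.filter_val]
  congr!

lemma eigen_mem {N : ℕ} (U : UG N) {y : ℝ} (hy : y ∈ eigenAngles N U) : 0 ≤ y ∧ y < 2 * π := by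
  have e0 : eigenAngles N U = U.1.charpoly.roots.map angOf := rfl
  rw [e0, Multiset.mem_map] at hy
  obtain ⟨z, _, rfl⟩ := hy
  exact angOf_mem z

lemma count_closed {N : ℕ} {θ : ℝ} (h1 : θ < 2 * π) (k : ℕ) :
    IsClosed {U : UG N | k ≤ countFun N U θ} := by
  have : {U : UG N | k ≤ countFun N U θ}
      = ⋃ T ∈ (Finset.univ.filter (fun T : Finset (Fin N) => k ≤ T.card)), Prod.fst '' (CC N θ T) := by
    ext U
    simp only [Set.mem_ofPred_eq, Finset.mem_filter, Finset.mem_univ, true_and, Set.mem_iUnion]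
    constructor
    · intro hk
      obtain ⟨x, hx⟩ := eigen_fin U
      have hxm : ∀ i, 0 ≤ x i ∧ x i < 2 * π := fun i => eigen_mem U (by
        rw [hx]; exact Multiset.mem_map_of_mem _ (Finset.mem_univ i))
      rw [count_map U θ x hx] at hk
      refine ⟨_, hk, ⟨(U, x), ⟨fun i => ⟨(hxm i).1, (hxm i).2.le⟩, fun i hi => ?_, fun w => ?_⟩, rfl⟩⟩
      · exact (Finset.mem_filter.mp hi).2.2
      · rw [← Matrix.eval_charpoly,
          (IsAlgClosed.splits U.1.charpoly).eval_eq_prod_roots_of_monic (Matrix.charpoly_monic _)]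
        have e0 : eigenAngles N U = U.1.charpoly.roots.map angOf := rfl
        have e1 : U.1.charpoly.roots = (eigenAngles N U).map
            (fun y : ℝ => Complex.exp (y * Complex.I)) := by
          rw [e0, Multiset.map_map]
          conv_lhs => rw [← Multiset.map_id U.1.charpoly.roots]
          exact Multiset.map_congr rfl fun z hz => (exp_angOf (root_norm U hz)).symm
        rw [e1, hx, Multiset.map_map, Multiset.map_map]
        rfl
    · rintro ⟨T, hT, ⟨⟨V, x⟩, ⟨hx, hxT, hw⟩, rfl⟩⟩
      simp only at hx hxT hw ⊢
      have hp : V.1.charpoly = ∏ i, (Polynomial.X - Polynomial.C (Complex.exp (x i * Complex.I))) := by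
        apply Polynomial.funext
        intro w
        rw [Matrix.eval_charpoly, hw w, Polynomial.eval_prod]
        simp
      have hr : V.1.charpoly.roots = Finset.univ.val.map (fun i => Complex.exp (x i * Complex.I)) := by
        rw [hp, ← Finset.prod_map_val]
        have := Polynomial.roots_multiset_prod_X_sub_C
          ((Finset.univ : Finset (Fin N)).val.map fun i => Complex.exp (x i * Complex.I))
        rw [Multiset.map_map] at this
        exact this
      have e0 : eigenAngles N V = Finset.univ.val.map (fun i => angOf (Complex.exp (x i * Complex.I))) := by
        have e0 : eigenAngles N V = V.1.charpoly.roots.map angOf := rfl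
        rw [e0, hr, Multiset.map_map]; rfl
      rw [count_map V θ _ e0]
      refine hT.trans (Finset.card_le_card fun i hi => ?_)
      simp only [Finset.mem_filter, Finset.mem_univ, true_and]
      rw [angOf_exp (hx i).1 ((hxT i hi).trans_lt h1)]
      exact ⟨(hx i).1, hxT i hi⟩
  rw [this]
  exact isClosed_biUnion_finset fun T _ => CC_image N θ T

lemma count_meas {N : ℕ} {θ : ℝ} (h1 : θ < 2 * π) : Measurable fun U : UG N => countFun N U θ := by
  apply measurable_of_Ici
  intro k
  exact (count_closed h1 k).measurableSet

lemma count_mono {N : ℕ} (U : UG N) {s t : ℝ} (h : s ≤ t) : countFun N U s ≤ countFun N U t := by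
  obtain ⟨x, hx⟩ := eigen_fin U
  rw [count_map U s x hx, count_map U t x hx]
  refine Finset.card_le_card fun i hi => ?_
  simp only [Finset.mem_filter, Finset.mem_univ, true_and] at hi ⊢
  exact ⟨hi.1, hi.2.trans h⟩

lemma count_le {N : ℕ} (U : UG N) (s : ℝ) : countFun N U s ≤ N := by
  obtain ⟨x, hx⟩ := eigen_fin U
  rw [count_map U s x hx]
  exact (Finset.card_le_univ _).trans (by simp)

/-- grid point. -/
noncomputable def gr (n k : ℕ) : ℝ := 2 * π * k / (n + 1)

/-- grid deviation. -/
noncomputable def DD (n : ℕ) (U : UG (n + 1)) : ℝ :=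
  Finset.univ.sup' Finset.univ_nonempty fun k : Fin (n + 1) => |(countFun (n + 1) U (gr n k) : ℝ) - k|

lemma gr_nonneg (n k : ℕ) : 0 ≤ gr n k := by unfold gr; positivity

lemma gr_lt {n k : ℕ} (h : k < n + 1) : gr n k < 2 * π := by
  unfold gr
  rw [div_lt_iff₀ (by positivity)]
  have : (k : ℝ) < n + 1 := by exact_mod_cast h
  exact mul_lt_mul_of_pos_left this Real.two_pi_pos

lemma DD_meas (n : ℕ) : Measurable (DD n) := by
  have : DD n = Finset.univ.sup' Finset.univ_nonempty fun (k : Fin (n + 1)) (U : UG (n + 1)) =>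
      |(countFun (n + 1) U (gr n k) : ℝ) - k| := by
    ext U
    rw [Finset.sup'_apply]
    rfl
  rw [this]
  refine Finset.measurable_sup' _ fun k _ => ?_
  have h1 : Measurable fun U : UG (n + 1) => (countFun (n + 1) U (gr n k) : ℝ) :=
    (measurable_from_top (f := (Nat.cast : ℕ → ℝ))).comp (count_meas (gr_lt k.2))
  have h2 : Measurable fun U : UG (n + 1) => (countFun (n + 1) U (gr n k) : ℝ) - k :=
    h1.sub_const _
  exact continuous_abs.measurable.comp h2

lemma DD_conj (n : ℕ) (W U : UG (n + 1)) : DD n (W * U * W⁻¹) = DD n U := by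
  unfold DD
  simp_rw [countFun_conj]

lemma DD_dK (n : ℕ) (U : UG (n + 1)) : |((n + 1 : ℕ) : ℝ) * dK (n + 1) U - DD n U| ≤ 1 := by
  have hpi := Real.two_pi_pos
  have hN : (0 : ℝ) < ((n + 1 : ℕ) : ℝ) := by positivity
  have hD : ∀ k : Fin (n + 1), |(countFun (n + 1) U (gr n k) : ℝ) - k| ≤ DD n U := fun k =>
    Finset.le_sup' (fun k : Fin (n + 1) => |(countFun (n + 1) U (gr n k) : ℝ) - k|) (Finset.mem_univ k)
  have hD0 : 0 ≤ DD n U := (abs_nonneg _).trans (hD 0)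
  have hup : ∀ θ : Set.Ico (0:ℝ) (2 * π),
      |(countFun (n + 1) U θ : ℝ) / (n + 1 : ℕ) - (θ : ℝ) / (2 * π)| ≤ (DD n U + 1) / (n + 1 : ℕ) := by
    rintro ⟨θ, h0, h1⟩
    simp only
    set N : ℝ := ((n + 1 : ℕ) : ℝ) with hNdef
    have hNn : N = n + 1 := by rw [hNdef]; push_cast; ring
    set y := N * θ / (2 * π) with hy
    have hy0 : 0 ≤ y := by positivity
    have hyN : y < N := by rw [hy, div_lt_iff₀ hpi]; nlinarith
    set k := ⌊y⌋₊ with hk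
    have hk1 : (k : ℝ) ≤ y := Nat.floor_le hy0
    have hk2 : y < k + 1 := Nat.lt_floor_add_one y
    have hkN : k < n + 1 := (Nat.floor_lt hy0).mpr hyN
    have hg1 : gr n k ≤ θ := by
      unfold gr
      rw [← hNn, div_le_iff₀ hN]
      rw [hy, le_div_iff₀ hpi] at hk1; linarith
    have hg2 : θ ≤ gr n (k + 1) := by
      unfold gr
      rw [← hNn, le_div_iff₀ hN]
      rw [hy, div_lt_iff₀ hpi] at hk2; push_cast; linarith
    have c1 : (countFun (n + 1) U (gr n k) : ℝ) ≤ countFun (n + 1) U θ := by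
      exact_mod_cast count_mono U hg1
    have c2 : (countFun (n + 1) U θ : ℝ) ≤ k + 1 + DD n U := by
      by_cases hlast : k + 1 < n + 1
      · have a1 : (countFun (n + 1) U θ : ℝ) ≤ countFun (n + 1) U (gr n (k + 1)) := by
          exact_mod_cast count_mono U hg2
        have a2 := (abs_le.mp (hD ⟨k + 1, hlast⟩)).2
        simp only at a2
        push_cast at a2
        linarith
      · have a1 : (countFun (n + 1) U θ : ℝ) ≤ ((n + 1 : ℕ) : ℝ) := by exact_mod_cast count_le U θ
        have a3 : ((n + 1 : ℕ) : ℝ) ≤ ((k + 1 : ℕ) : ℝ) := by exact_mod_cast not_lt.mp hlast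
        push_cast at a3 a1
        linarith
    have c3 := (abs_le.mp (hD ⟨k, hkN⟩)).1
    simp only at c3
    have e : (countFun (n + 1) U θ : ℝ) / N - θ / (2 * π) = ((countFun (n + 1) U θ : ℝ) - y) / N := by
      rw [hy]; field_simp
    rw [e, abs_div, abs_of_pos hN]
    gcongr
    rw [abs_le]
    constructor <;> linarith
  have hbdd : BddAbove (Set.range fun θ : Set.Ico (0:ℝ) (2 * π) =>
      |(countFun (n + 1) U θ : ℝ) / (n + 1 : ℕ) - (θ : ℝ) / (2 * π)|) := by
    refine ⟨(DD n U + 1) / (n + 1 : ℕ), ?_⟩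
    rintro _ ⟨θ, rfl⟩
    exact hup θ
  have : Nonempty (Set.Ico (0:ℝ) (2 * π)) := ⟨⟨0, le_rfl, hpi⟩⟩
  have h1 : dK (n + 1) U ≤ (DD n U + 1) / (n + 1 : ℕ) := ciSup_le hup
  rw [le_div_iff₀ hN] at h1
  have h2 : DD n U ≤ ((n + 1 : ℕ) : ℝ) * dK (n + 1) U := by
    refine Finset.sup'_le _ _ fun k _ => ?_
    have h3 := le_ciSup hbdd ⟨gr n k, gr_nonneg n k, gr_lt k.2⟩
    have e : (countFun (n + 1) U (gr n k) : ℝ) - k = ((n + 1 : ℕ) : ℝ) *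
      ((countFun (n + 1) U (gr n k) : ℝ) / (n + 1 : ℕ) - gr n k / (2 * π)) := by
      unfold gr; push_cast; field_simp
    rw [e, abs_mul, abs_of_pos hN]
    exact mul_le_mul_of_nonneg_left h3 hN.le
  rw [abs_le]
  constructor <;> linarith

/-- The fluctuation field. -/
noncomputable def SS (n : ℕ) (ω : Om) (θ : ℝ) : ℝ := phi n ω θ - (n + 1) * θ

/-- maximum over the grid. -/
noncomputable def MM (n : ℕ) (ω : Om) : ℝ :=
  Finset.univ.sup' Finset.univ_nonempty fun k : Fin (n + 1) => |SS n ω (gr n k) - SS n ω 0|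

lemma sup_abs {ι : Type*} (s : Finset ι) (hs : s.Nonempty) (f g : ι → ℝ) (c : ℝ)
    (h : ∀ i ∈ s, |f i - g i| ≤ c) : |s.sup' hs f - s.sup' hs g| ≤ c := by
  rw [abs_le]
  have h1 : s.sup' hs f ≤ s.sup' hs g + c := Finset.sup'_le _ _ fun i hi => by
    have := (abs_le.mp (h i hi)).2
    have := Finset.le_sup' g hi
    linarith
  have h2 : s.sup' hs g ≤ s.sup' hs f + c := Finset.sup'_le _ _ fun i hi => by
    have := (abs_le.mp (h i hi)).1
    have := Finset.le_sup' f hi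
    linarith
  constructor <;> linarith

lemma DD_MM (n : ℕ) (ω : Om) (hω : Good ω) : |DD n (TT n ω) - MM n ω / (2 * π)| ≤ 1 := by
  have hpi := Real.two_pi_pos
  have e : MM n ω / (2 * π) = Finset.univ.sup' Finset.univ_nonempty
      fun k : Fin (n + 1) => |SS n ω (gr n k) - SS n ω 0| / (2 * π) := by
    unfold MM
    apply le_antisymm
    · rw [div_le_iff₀ hpi]
      refine Finset.sup'_le _ _ fun k _ => ?_
      rw [← div_le_iff₀ hpi]
      exact Finset.le_sup' (fun k : Fin (n + 1) => |SS n ω (gr n k) - SS n ω 0| / (2 * π)) (Finset.mem_univ k)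
    · refine Finset.sup'_le _ _ fun k _ => ?_
      gcongr
      exact Finset.le_sup' (fun k : Fin (n + 1) => |SS n ω (gr n k) - SS n ω 0|) (Finset.mem_univ k)
  rw [e]
  refine sup_abs _ _ _ _ _ fun k _ => ?_
  have h := count_phi ω hω n (gr_nonneg n k) (gr_lt k.2)
  have e2 : |SS n ω (gr n k) - SS n ω 0| / (2 * π) = |(SS n ω (gr n k) - SS n ω 0) / (2 * π)| := by
    rw [abs_div, abs_of_pos hpi]
  rw [e2]
  refine (abs_abs_sub_abs_le_abs_sub _ _).trans ?_
  have e3 : ((countFun (n + 1) (TT n ω) (gr n k) : ℝ) - k - (SS n ω (gr n k) - SS n ω 0) / (2 * π))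
    = (countFun (n + 1) (TT n ω) (gr n k) : ℝ) - (phi n ω (gr n k) - phi n ω 0) / (2 * π) := by
    unfold SS gr; field_simp; ring
  rw [e3]; exact h

section
variable (μ : (n : ℕ) → Measure (UG (n + 1))) [∀ n, IsProbabilityMeasure (μ n)]
    [∀ n, (μ n).IsMulLeftInvariant]

lemma good_ae : ∀ᵐ ω ∂(Measure.infinitePi μ), Good ω := by
  unfold Good
  rw [ae_all_iff]
  intro k
  exact (measurePreserving_eval_infinitePi μ (k + 1)).quasiMeasurePreserving.ae (null_unit (μ (k + 1)))

end

/-- The increment function. -/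
noncomputable def Xf (w : ℂ) : ℝ := -2 * (1 + w).arg

lemma Xf_expand {w : ℂ} (hw : ‖w‖ ≤ 1) : |Xf w + 2 * w.im - (w ^ 2).im| ≤ 100 * ‖w‖ ^ 3 := by
  rcases le_or_gt ‖w‖ (1 / 2) with h | h
  · have h1 := Complex.norm_log_sub_logTaylor_le 2 (z := w) (by linarith)
    have e : Complex.logTaylor (2 + 1) w = w - w ^ 2 / 2 := by
      simp [Complex.logTaylor, Finset.sum_range_succ]
      ring
    rw [e] at h1
    have h2 := Complex.abs_im_le_norm (Complex.log (1 + w) - (w - w ^ 2 / 2))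
    have e2 : (Complex.log (1 + w) - (w - w ^ 2 / 2)).im = (1 + w).arg - w.im + (w ^ 2).im / 2 := by
      rw [Complex.sub_im, Complex.log_im, Complex.sub_im]
      have : (w ^ 2 / 2).im = (w ^ 2).im / 2 := by
        rw [show (w ^ 2 / 2 : ℂ) = w ^ 2 / ((2 : ℝ) : ℂ) by norm_num, Complex.div_ofReal_im]
      rw [this]; ring
    have h3 : ‖w‖ ^ (2 + 1) * (1 - ‖w‖)⁻¹ / ((2 : ℕ) + 1) ≤ ‖w‖ ^ 3 := by
      have h5 : (1 - ‖w‖)⁻¹ ≤ 2 := by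
        rw [inv_le_comm₀ (by linarith) (by norm_num)]; linarith
      have : 0 ≤ ‖w‖ ^ 3 := by positivity
      push_cast
      rw [div_le_iff₀ (by norm_num)]
      nlinarith
    have e3 : Xf w + 2 * w.im - (w ^ 2).im
        = -2 * (Complex.log (1 + w) - (w - w ^ 2 / 2)).im := by
      rw [e2, Xf]; ring
    have : 0 ≤ ‖w‖ ^ 3 := by positivity
    have h9 := h2.trans (h1.trans h3)
    rw [e3, abs_mul, abs_neg, abs_two]
    linarith
  · have a1 := Complex.abs_arg_le_pi (1 + w)
    have a2 := Complex.abs_im_le_norm w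
    have a3 := Complex.abs_im_le_norm (w ^ 2)
    rw [norm_pow] at a3
    have a4 : ‖w‖ ^ 2 ≤ 1 := by nlinarith [norm_nonneg w]
    have a5 := Real.pi_lt_four
    have a6 : 1 / 8 ≤ ‖w‖ ^ 3 := by
      have := pow_le_pow_left₀ (by norm_num : (0:ℝ) ≤ 1 / 2) h.le 3
      norm_num at this ⊢
      exact this
    have := abs_le.mp a1
    have := abs_le.mp a2
    have := abs_le.mp a3
    rw [abs_le, Xf]
    constructor <;> linarith

lemma im_eq (z : ℂ) : (z.im : ℂ) = (z - starRingEnd ℂ z) / (2 * Complex.I) := by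
  rw [Complex.sub_conj]
  have := Complex.I_ne_zero
  push_cast
  field_simp

/-- constant of the pointwise expansion -/
noncomputable def C0 : ℝ := 600 + 700 ^ 3 * Real.exp 700 + 700 * 720

lemma C0_pos : 0 < C0 := by unfold C0; positivity

lemma point_expand (s s' u u' a : ℂ) (hs : ‖s‖ ≤ 3) (hs' : ‖s'‖ ≤ 3) (hu : ‖u‖ = 1) (hu' : ‖u'‖ = 1)
    (ha : ‖a‖ ≤ 1) :
    ‖Complex.exp (s * Xf (a * u) + s' * Xf (a * u'))
      - (1 + Complex.I * (s * u + s' * u') * a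
          - Complex.I * (s * starRingEnd ℂ u + s' * starRingEnd ℂ u') * starRingEnd ℂ a
          + ((s * u ^ 2 + s' * u' ^ 2) / (2 * Complex.I) - (s * u + s' * u') ^ 2 / 2) * a ^ 2
          + (-(s * starRingEnd ℂ u ^ 2 + s' * starRingEnd ℂ u' ^ 2) / (2 * Complex.I)
              - (s * starRingEnd ℂ u + s' * starRingEnd ℂ u') ^ 2 / 2) * (starRingEnd ℂ a) ^ 2
          + (s * u + s' * u') * (s * starRingEnd ℂ u + s' * starRingEnd ℂ u')
              * (a * starRingEnd ℂ a))‖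
      ≤ C0 * ‖a‖ ^ 3 := by
  set c := starRingEnd ℂ with hc
  have hcn : ∀ z, ‖c z‖ = ‖z‖ := fun z => by rw [hc]; exact RCLike.norm_conj z
  set Y : ℂ := s * Xf (a * u) + s' * Xf (a * u') with hY
  set Y1 : ℂ := Complex.I * (s * u + s' * u') * a - Complex.I * (s * c u + s' * c u') * c a with hY1
  set Y2 : ℂ := (s * u ^ 2 + s' * u' ^ 2) / (2 * Complex.I) * a ^ 2
    + (-(s * c u ^ 2 + s' * c u' ^ 2) / (2 * Complex.I)) * (c a) ^ 2 with hY2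
  set r : ℂ → ℝ := fun w => Xf w + 2 * w.im - (w ^ 2).im with hr
  have n0 := norm_nonneg a
  have hwu : ∀ v : ℂ, ‖v‖ = 1 → ‖((r (a * v) : ℝ) : ℂ)‖ ≤ 100 * ‖a‖ ^ 3 := by
    intro v hv
    have h1 : ‖a * v‖ = ‖a‖ := by rw [norm_mul, hv, mul_one]
    rw [Complex.norm_real, Real.norm_eq_abs, ← h1]
    exact Xf_expand (by rw [h1]; exact ha)
  have hI := Complex.I_ne_zero
  have hI2 := Complex.I_sq
  have hdec : Y = Y1 + Y2 + (s * r (a * u) + s' * r (a * u')) := by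
    have hx : ∀ v : ℂ, (Xf (a * v) : ℂ) = r (a * v) - 2 * ((a * v - c a * c v) / (2 * Complex.I))
        + (a ^ 2 * v ^ 2 - c a ^ 2 * c v ^ 2) / (2 * Complex.I) := by
      intro v
      have e1 := im_eq (a * v)
      have e2 := im_eq ((a * v) ^ 2)
      rw [map_mul] at e1
      rw [map_pow, map_mul] at e2
      have e3 : (Xf (a * v) : ℂ) = r (a * v) - 2 * ((a * v).im : ℂ) + (((a * v) ^ 2).im : ℂ) := by
        rw [hr]; push_cast; ring
      rw [e3, e1, e2]
      ring
    rw [hY, hY1, hY2, hx u, hx u']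
    have hinv : (2 * Complex.I)⁻¹ = -Complex.I / 2 := by
      rw [mul_inv, Complex.inv_I]; ring
    simp only [div_eq_mul_inv (b := 2 * Complex.I), hinv]
    ring
  have hR : ‖s * r (a * u) + s' * r (a * u')‖ ≤ 600 * ‖a‖ ^ 3 := by
    refine (norm_add_le _ _).trans ?_
    rw [norm_mul, norm_mul]
    have h1 := hwu u hu
    have h2 := hwu u' hu'
    have h3 : ‖s‖ * ‖((r (a * u) : ℝ) : ℂ)‖ ≤ 3 * (100 * ‖a‖ ^ 3) := by gcongr
    have h4 : ‖s'‖ * ‖((r (a * u') : ℝ) : ℂ)‖ ≤ 3 * (100 * ‖a‖ ^ 3) := by gcongr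
    linarith
  have hcc : ‖s * u + s' * u'‖ ≤ 6 := by
    refine (norm_add_le _ _).trans ?_
    rw [norm_mul, norm_mul, hu, hu']; linarith
  have hdd : ‖s * c u + s' * c u'‖ ≤ 6 := by
    refine (norm_add_le _ _).trans ?_
    rw [norm_mul, norm_mul, hcn, hcn, hu, hu']; linarith
  have hc2 : ‖s * u ^ 2 + s' * u' ^ 2‖ ≤ 6 := by
    refine (norm_add_le _ _).trans ?_
    rw [norm_mul, norm_mul, norm_pow, norm_pow, hu, hu']; linarith
  have hd2 : ‖s * c u ^ 2 + s' * c u' ^ 2‖ ≤ 6 := by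
    refine (norm_add_le _ _).trans ?_
    rw [norm_mul, norm_mul, norm_pow, norm_pow, hcn, hcn, hu, hu']; linarith
  have hn1 : ‖Y1‖ ≤ 12 * ‖a‖ := by
    refine (norm_sub_le _ _).trans ?_
    rw [norm_mul, norm_mul, norm_mul, norm_mul, Complex.norm_I, hcn]
    nlinarith
  have hn2 : ‖Y2‖ ≤ 6 * ‖a‖ ^ 2 := by
    refine (norm_add_le _ _).trans ?_
    rw [norm_mul, norm_mul, norm_div, norm_div, norm_neg, norm_mul, norm_pow, norm_pow, Complex.norm_I, hcn]
    have : ‖(2:ℂ)‖ = 2 := by norm_num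
    rw [this]
    have h0 : 0 ≤ ‖a‖ ^ 2 := by positivity
    have g1 := mul_le_mul_of_nonneg_right hc2 h0
    have g2 := mul_le_mul_of_nonneg_right hd2 h0
    have g3 : ‖s * u ^ 2 + s' * u' ^ 2‖ / (2 * 1) * ‖a‖ ^ 2
      = ‖s * u ^ 2 + s' * u' ^ 2‖ * ‖a‖ ^ 2 / 2 := by ring
    have g4 : ‖s * c u ^ 2 + s' * c u' ^ 2‖ / (2 * 1) * ‖a‖ ^ 2
      = ‖s * c u ^ 2 + s' * c u' ^ 2‖ * ‖a‖ ^ 2 / 2 := by ring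
    rw [g3, g4]
    linarith
  have p2 : ‖a‖ ^ 2 ≤ ‖a‖ := by nlinarith
  have p3 : ‖a‖ ^ 3 ≤ ‖a‖ ^ 2 := by nlinarith [sq_nonneg ‖a‖]
  have hYn : ‖Y‖ ≤ 700 * ‖a‖ := by
    rw [hdec]
    refine (norm_add_le _ _).trans ?_
    have := norm_add_le Y1 Y2
    linarith
  have hYd : ‖Y - Y1‖ ≤ 700 * ‖a‖ ^ 2 := by
    have e : Y - Y1 = Y2 + (s * r (a * u) + s' * r (a * u')) := by rw [hdec]; ring
    rw [e]
    refine (norm_add_le _ _).trans ?_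
    have := sq_nonneg ‖a‖
    linarith
  have hT := Complex.norm_exp_sub_sum_le_norm_mul_exp Y 3
  have eT : ∑ m ∈ Finset.range 3, Y ^ m / (m.factorial : ℂ) = 1 + Y + Y ^ 2 / 2 := by
    simp [Finset.sum_range_succ]
  rw [eT] at hT
  have hT2 : ‖Y‖ ^ 3 * Real.exp ‖Y‖ ≤ 700 ^ 3 * Real.exp 700 * ‖a‖ ^ 3 := by
    have h1 : ‖Y‖ ^ 3 ≤ (700 * ‖a‖) ^ 3 := by gcongr
    have h2 : Real.exp ‖Y‖ ≤ Real.exp 700 := by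
      apply Real.exp_le_exp.mpr; linarith
    calc ‖Y‖ ^ 3 * Real.exp ‖Y‖ ≤ (700 * ‖a‖) ^ 3 * Real.exp 700 := by gcongr
      _ = _ := by ring
  have key : Complex.exp Y - (1 + Complex.I * (s * u + s' * u') * a
          - Complex.I * (s * c u + s' * c u') * c a
          + ((s * u ^ 2 + s' * u' ^ 2) / (2 * Complex.I) - (s * u + s' * u') ^ 2 / 2) * a ^ 2
          + (-(s * c u ^ 2 + s' * c u' ^ 2) / (2 * Complex.I)
              - (s * c u + s' * c u') ^ 2 / 2) * (c a) ^ 2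
          + (s * u + s' * u') * (s * c u + s' * c u') * (a * c a))
      = (Complex.exp Y - (1 + Y + Y ^ 2 / 2)) + (s * r (a * u) + s' * r (a * u'))
        + (Y - Y1) * (Y + Y1) / 2 := by
    have e2 : Y1 ^ 2 = -((s * u + s' * u') * a - (s * c u + s' * c u') * c a) ^ 2 := by
      rw [hY1]; linear_combination ((s * u + s' * u') * a - (s * c u + s' * c u') * c a) ^ 2 * hI2
    have e3 : (Y - Y1) * (Y + Y1) / 2 = Y ^ 2 / 2 - Y1 ^ 2 / 2 := by ring
    rw [e3, e2]
    have e4 : s * r (a * u) + s' * r (a * u') = Y - Y1 - Y2 := by rw [hdec]; ring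
    rw [e4, hY1, hY2]
    ring
  rw [key]
  refine (norm_add_le _ _).trans ?_
  have h5 : ‖(Y - Y1) * (Y + Y1) / 2‖ ≤ 700 * 720 * ‖a‖ ^ 3 := by
    rw [norm_div, norm_mul]
    have : ‖(2:ℂ)‖ = 2 := by norm_num
    rw [this]
    have h6 : ‖Y + Y1‖ ≤ 720 * ‖a‖ := (norm_add_le _ _).trans (by linarith)
    have h7 : ‖Y - Y1‖ * ‖Y + Y1‖ ≤ (700 * ‖a‖ ^ 2) * (720 * ‖a‖) := by gcongr
    have : 0 ≤ ‖a‖ ^ 3 := by positivity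
    rw [div_le_iff₀ (by norm_num)]
    nlinarith
  have h8 := norm_add_le (Complex.exp Y - (1 + Y + Y ^ 2 / 2)) (s * r (a * u) + s' * r (a * u'))
  unfold C0
  have : (600 + 700 ^ 3 * Real.exp 700 + 700 * 720) * ‖a‖ ^ 3 =
    700 ^ 3 * Real.exp 700 * ‖a‖ ^ 3 + 600 * ‖a‖ ^ 3 + 700 * 720 * ‖a‖ ^ 3 := by ring
  rw [this]
  linarith

lemma Xf_meas : Measurable Xf := by
  unfold Xf
  exact (Complex.measurable_arg.comp (measurable_const.add measurable_id)).const_mul _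

lemma Xf_bound (w : ℂ) : |Xf w| ≤ 2 * π := by
  have := Complex.abs_arg_le_pi (1 + w)
  rw [Xf, abs_mul]; norm_num; linarith

lemma bdd_int' {α : Type*} [MeasurableSpace α] (μ : Measure α) [IsProbabilityMeasure μ]
    {E : Type*} [NormedAddCommGroup E] {f : α → E}
    [SecondCountableTopology E] [MeasurableSpace E] [BorelSpace E]
    (hf : Measurable f) (C : ℝ) (hC : ∀ u, ‖f u‖ ≤ C) : Integrable f μ :=
  Integrable.of_bound hf.aestronglyMeasurable C (Eventually.of_forall hC)

section
variable {n : ℕ} (μ : Measure (UG (n + 1))) [IsProbabilityMeasure μ] [μ.IsMulLeftInvariant]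

lemma mom3 : ∫ u, ‖u.1 0 0‖ ^ 3 ∂μ ≤ 2 / (((n : ℝ) + 1) * √((n : ℝ) + 1)) := by
  have hb : ∀ k : ℕ, Integrable (fun u : UG (n + 1) => ‖u.1 0 0‖ ^ k) μ := fun k =>
    bdd_int' μ ((entry_continuous 0 0).norm.pow k).measurable 1 (fun u => by
      rw [norm_pow, norm_norm]
      exact pow_le_one₀ (norm_nonneg _) (entry_norm_bound_of_unitary u.2 0 0))
  set x : ℝ := √((n : ℝ) + 1) with hx
  have hx0 : 0 < x := Real.sqrt_pos.mpr (by positivity)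
  have hxx : (n : ℝ) + 1 = x ^ 2 := by rw [hx, Real.sq_sqrt (by positivity)]
  have h1 : ∫ u, ‖u.1 0 0‖ ^ 3 ∂μ ≤ ∫ u, ((1 / (2 * x)) * ‖u.1 0 0‖ ^ 2 + (x / 2) * ‖u.1 0 0‖ ^ 4) ∂μ := by
    refine integral_mono (hb 3) (((hb 2).const_mul _).add ((hb 4).const_mul _)) fun u => ?_
    simp only
    set y := ‖u.1 0 0‖
    have : 1 / (2 * x) * y ^ 2 + x / 2 * y ^ 4 - y ^ 3 = y ^ 2 * (1 - x * y) ^ 2 / (2 * x) := by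
      field_simp; ring
    have h0 : 0 ≤ y ^ 2 * (1 - x * y) ^ 2 / (2 * x) := by positivity
    linarith
  rw [integral_add ((hb 2).const_mul _) ((hb 4).const_mul _), integral_const_mul, integral_const_mul,
    mom2] at h1
  have h4 := mom4 μ
  rw [hxx] at h1 h4 ⊢
  have h5 : x / 2 * ∫ u, ‖u.1 0 0‖ ^ 4 ∂μ ≤ x / 2 * (2 / (x ^ 2) ^ 2) := by gcongr
  refine h1.trans ((add_le_add_right h5 _).trans ?_)
  have : 1 / (2 * x) * (1 / x ^ 2) + x / 2 * (2 / (x ^ 2) ^ 2) = 3 / 2 / (x ^ 2 * x) := by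
    field_simp; norm_num
  rw [this]
  gcongr
  norm_num

lemma one_step (s s' u u' : ℂ) (hs : ‖s‖ ≤ 3) (hs' : ‖s'‖ ≤ 3) (hu : ‖u‖ = 1) (hu' : ‖u'‖ = 1) :
    ‖∫ v, Complex.exp (s * Xf (v.1 0 0 * u) + s' * Xf (v.1 0 0 * u')) ∂μ
      - (1 + (s * u + s' * u') * (s * starRingEnd ℂ u + s' * starRingEnd ℂ u') / (n + 1))‖
      ≤ 2 * C0 / (((n : ℝ) + 1) * √((n : ℝ) + 1)) := by
  have hb : ∀ k : ℕ, Integrable (fun u : UG (n + 1) => ‖u.1 0 0‖ ^ k) μ := fun k =>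
    bdd_int' μ ((entry_continuous 0 0).norm.pow k).measurable 1 (fun u => by
      rw [norm_pow, norm_norm]
      exact pow_le_one₀ (norm_nonneg _) (entry_norm_bound_of_unitary u.2 0 0))
  have hm : Measurable fun v : UG (n + 1) => v.1 0 0 := (entry_continuous 0 0).measurable
  have i1 : Integrable (fun v : UG (n + 1) => v.1 0 0) μ :=
    bdd_int' μ hm 1 (fun u => entry_norm_bound_of_unitary u.2 0 0)
  have i2 : Integrable (fun v : UG (n + 1) => (v.1 0 0) ^ 2) μ :=
    bdd_int' μ (hm.pow_const 2) 1 (fun u => by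
      rw [norm_pow]; exact pow_le_one₀ (norm_nonneg _) (entry_norm_bound_of_unitary u.2 0 0))
  have i1c : Integrable (fun v : UG (n + 1) => starRingEnd ℂ (v.1 0 0)) μ :=
    bdd_int' μ (Complex.continuous_conj.measurable.comp hm) 1 (fun u => by
      rw [RCLike.norm_conj]; exact entry_norm_bound_of_unitary u.2 0 0)
  have i2c : Integrable (fun v : UG (n + 1) => (starRingEnd ℂ (v.1 0 0)) ^ 2) μ :=
    bdd_int' μ ((Complex.continuous_conj.measurable.comp hm).pow_const 2) 1 (fun u => by
      rw [norm_pow, RCLike.norm_conj]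
      exact pow_le_one₀ (norm_nonneg _) (entry_norm_bound_of_unitary u.2 0 0))
  have e1 : ∫ v : UG (n + 1), starRingEnd ℂ (v.1 0 0) ∂μ = 0 := by
    rw [integral_conj, mom1, map_zero]
  have e2 : ∫ v : UG (n + 1), (starRingEnd ℂ (v.1 0 0)) ^ 2 ∂μ = 0 := by
    simp_rw [← map_pow]
    rw [integral_conj, mom1', map_zero]
  have e3' : ∀ v : UG (n + 1), v.1 0 0 * starRingEnd ℂ (v.1 0 0) = ((‖v.1 0 0‖ ^ 2 : ℝ) : ℂ) := by
    intro v; rw [Complex.mul_conj, Complex.normSq_eq_norm_sq]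
  have i3 : Integrable (fun v : UG (n + 1) => v.1 0 0 * starRingEnd ℂ (v.1 0 0)) μ := by
    simp_rw [e3']; exact (hb 2).ofReal
  have e3 : ∫ v : UG (n + 1), v.1 0 0 * starRingEnd ℂ (v.1 0 0) ∂μ = 1 / (n + 1) := by
    simp_rw [e3']
    have h := integral_ofReal (𝕜 := ℂ) (μ := μ) (f := fun v : UG (n + 1) => ‖v.1 0 0‖ ^ 2)
    refine h.trans ?_
    rw [mom2]; push_cast; ring
  set A := Complex.I * (s * u + s' * u')
  set B := Complex.I * (s * starRingEnd ℂ u + s' * starRingEnd ℂ u')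
  set A2 := (s * u ^ 2 + s' * u' ^ 2) / (2 * Complex.I) - (s * u + s' * u') ^ 2 / 2 with hA2
  set B2 := (-(s * starRingEnd ℂ u ^ 2 + s' * starRingEnd ℂ u' ^ 2) / (2 * Complex.I)
              - (s * starRingEnd ℂ u + s' * starRingEnd ℂ u') ^ 2 / 2) with hB2
  set D := (s * u + s' * u') * (s * starRingEnd ℂ u + s' * starRingEnd ℂ u') with hD
  have j1 : Integrable (fun v : UG (n + 1) => 1 + A * v.1 0 0) μ := (integrable_const _).add (i1.const_mul A)
  have j2 : Integrable (fun v : UG (n + 1) => 1 + A * v.1 0 0 - B * starRingEnd ℂ (v.1 0 0)) μ :=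
    j1.sub (i1c.const_mul B)
  have j3 : Integrable (fun v : UG (n + 1) => 1 + A * v.1 0 0 - B * starRingEnd ℂ (v.1 0 0)
      + A2 * v.1 0 0 ^ 2) μ := j2.add (i2.const_mul A2)
  have j4 : Integrable (fun v : UG (n + 1) => 1 + A * v.1 0 0 - B * starRingEnd ℂ (v.1 0 0)
      + A2 * v.1 0 0 ^ 2 + B2 * (starRingEnd ℂ (v.1 0 0)) ^ 2) μ := j3.add (i2c.const_mul B2)
  have j5 : Integrable (fun v : UG (n + 1) => 1 + A * v.1 0 0 - B * starRingEnd ℂ (v.1 0 0)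
      + A2 * v.1 0 0 ^ 2 + B2 * (starRingEnd ℂ (v.1 0 0)) ^ 2
      + D * (v.1 0 0 * starRingEnd ℂ (v.1 0 0))) μ := j4.add (i3.const_mul D)
  have hinteg : ∫ v : UG (n + 1), (1 + A * v.1 0 0 - B * starRingEnd ℂ (v.1 0 0)
      + A2 * v.1 0 0 ^ 2 + B2 * (starRingEnd ℂ (v.1 0 0)) ^ 2
      + D * (v.1 0 0 * starRingEnd ℂ (v.1 0 0))) ∂μ = 1 + D / (n + 1) := by
    refine (integral_add j4 (i3.const_mul D)).trans ?_
    rw [integral_const_mul, e3]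
    have q4 := integral_add j3 (i2c.const_mul B2)
    rw [integral_const_mul, e2] at q4
    have q3 := integral_add j2 (i2.const_mul A2)
    rw [integral_const_mul, mom1'] at q3
    have q2 := integral_sub j1 (i1c.const_mul B)
    rw [integral_const_mul, e1] at q2
    have q1 := integral_add (integrable_const (1 : ℂ)) (i1.const_mul A)
    rw [integral_const_mul, mom1] at q1
    rw [q4, q3, q2, q1]
    simp
    ring
  have iE : Integrable (fun v : UG (n + 1) =>
      Complex.exp (s * Xf (v.1 0 0 * u) + s' * Xf (v.1 0 0 * u'))) μ := by
    refine bdd_int' μ ?_ (Real.exp (3 * (2 * π) + 3 * (2 * π))) (fun v => ?_)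
    · refine Complex.measurable_exp.comp ?_
      exact ((Complex.measurable_ofReal.comp (Xf_meas.comp (hm.mul_const _))).const_mul _).add
        ((Complex.measurable_ofReal.comp (Xf_meas.comp (hm.mul_const _))).const_mul _)
    · rw [Complex.norm_exp]
      apply Real.exp_le_exp.mpr
      refine (Complex.re_le_norm _).trans ((norm_add_le _ _).trans ?_)
      rw [norm_mul, norm_mul, Complex.norm_real, Complex.norm_real]
      have h1 := Xf_bound (v.1 0 0 * u)
      have h2 := Xf_bound (v.1 0 0 * u')
      rw [← Real.norm_eq_abs] at h1 h2
      gcongr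
  rw [← hinteg]
  refine le_trans (le_of_eq (congrArg norm (integral_sub iE j5).symm)) ?_
  refine (norm_integral_le_integral_norm _).trans ?_
  have hfin : ∫ v : UG (n + 1), C0 * ‖v.1 0 0‖ ^ 3 ∂μ ≤ 2 * C0 / (((n : ℝ) + 1) * √((n : ℝ) + 1)) := by
    rw [integral_const_mul]
    have := mul_le_mul_of_nonneg_left (mom3 μ) C0_pos.le
    refine this.trans (le_of_eq ?_)
    ring
  refine le_trans (integral_mono (iE.sub j5).norm ((hb 3).const_mul C0) fun v => ?_) hfin
  exact point_expand s s' u u' _ hs hs' hu hu' (entry_norm_bound_of_unitary v.2 0 0)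

end

/-! ### Part G: recursions -/

/-- potential -/
noncomputable def xx (n : ℕ) : ℝ := 1 / ((n : ℝ) + 2)
noncomputable def yy (n : ℕ) : ℝ := 1 / (((n : ℝ) + 2) * √((n : ℝ) + 2))
noncomputable def g1 (n : ℕ) : ℝ := 2 / √((n : ℝ) + 1)
noncomputable def g2 (n : ℕ) : ℝ := 1 / ((n : ℝ) + 1)

lemma xx_pos (n : ℕ) : 0 < xx n := by unfold xx; positivity
lemma yy_pos (n : ℕ) : 0 < yy n := by unfold yy; positivity
lemma g1_pos (n : ℕ) : 0 < g1 n := by unfold g1; positivity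
lemma g2_pos (n : ℕ) : 0 < g2 n := by unfold g2; positivity
lemma xx_le (n : ℕ) : xx n ≤ 1 / 2 := by
  unfold xx
  gcongr
  have : (0:ℝ) ≤ n := by positivity
  linarith
lemma xx_g2 (n : ℕ) : xx n ≤ g2 n := by
  unfold xx g2
  gcongr; norm_num
lemma g2_anti : Antitone g2 := by
  intro m n h
  unfold g2
  gcongr
lemma xx_sq_le_yy (n : ℕ) : xx n ^ 2 ≤ yy n := by
  unfold xx yy
  have h0 : (0:ℝ) ≤ n := by positivity
  rw [div_pow, one_pow]
  gcongr
  rw [sq]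
  gcongr
  rw [Real.sqrt_le_left (by positivity)]
  nlinarith
lemma yy_le (n : ℕ) : yy n ≤ g1 n - g1 (n + 1) := by
  unfold yy g1
  push_cast
  set a := √((n : ℝ) + 1) with ha
  have e : (n : ℝ) + 1 + 1 = n + 2 := by ring
  rw [e]
  set b := √((n : ℝ) + 2) with hb
  have ha0 : 0 < a := Real.sqrt_pos.mpr (by positivity)
  have hab : a ≤ b := Real.sqrt_le_sqrt (by linarith)
  have hb0 : 0 < b := by linarith
  have a2 : a ^ 2 = (n : ℝ) + 1 := Real.sq_sqrt (by positivity)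
  have b2 : b ^ 2 = (n : ℝ) + 2 := Real.sq_sqrt (by positivity)
  rw [← b2, div_sub_div _ _ ha0.ne' hb0.ne', div_le_div_iff₀ (by positivity) (by positivity)]
  have hd : (b - a) * (b + a) = 1 := by nlinarith
  have h3 : 1 ≤ (b - a) * (2 * b) := by nlinarith
  have : 0 ≤ (b ^ 2) := by positivity
  nlinarith [mul_le_mul_of_nonneg_left hab hb0.le, mul_le_mul_of_nonneg_left h3 this]
lemma xx_sq_le (n : ℕ) : xx n ^ 2 ≤ g2 n - g2 (n + 1) := by
  unfold xx g2
  push_cast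
  have h0 : (0:ℝ) ≤ n := by positivity
  rw [div_sub_div _ _ (by positivity) (by positivity), div_pow, div_le_div_iff₀ (by positivity) (by positivity)]
  nlinarith
lemma xx_diff (n : ℕ) : |xx (n + 1) - xx n| ≤ xx n ^ 2 := by
  unfold xx
  push_cast
  have h0 : (0:ℝ) ≤ n := by positivity
  rw [abs_sub_comm, div_sub_div _ _ (by positivity) (by positivity), abs_of_nonneg (by apply div_nonneg <;> nlinarith), div_pow,
    div_le_div_iff₀ (by positivity) (by positivity)]
  nlinarith

/-- the ratio -/
noncomputable def rr (σ : ℝ) (n : ℕ) : ℝ := Real.exp (-σ * (Real.log ((n : ℝ) + 2) - Real.log ((n : ℝ) + 1)))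

lemma rr_bound {σ : ℝ} (h0 : 0 ≤ σ) (h8 : σ ≤ 8) (n : ℕ) :
    0 < rr σ n ∧ rr σ n ≤ 1 ∧ |rr σ n - (1 - σ * xx n)| ≤ 300 * xx n ^ 2 := by
  have hn : (0:ℝ) ≤ n := by positivity
  set L := Real.log ((n : ℝ) + 2) - Real.log ((n : ℝ) + 1) with hL
  have hx := xx_pos n
  have hx2 := xx_le n
  have L1 : xx n ≤ L := by
    rw [hL, ← Real.log_div (by positivity) (by positivity)]
    have := Real.one_sub_inv_le_log_of_pos (x := ((n : ℝ) + 2) / (n + 1)) (by positivity)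
    refine le_trans (le_of_eq ?_) this
    unfold xx
    field_simp
    ring
  have L2 : L ≤ xx n + 2 * xx n ^ 2 := by
    rw [hL, ← Real.log_div (by positivity) (by positivity)]
    have := Real.log_le_sub_one_of_pos (x := ((n : ℝ) + 2) / (n + 1)) (by positivity)
    refine this.trans ?_
    unfold xx
    rw [div_sub_one (by positivity), div_pow, mul_div, div_add_div _ _ (by positivity) (by positivity),
      div_le_div_iff₀ (by positivity) (by positivity)]
    nlinarith [mul_nonneg hn hn, mul_nonneg (mul_nonneg hn hn) hn]
  have hL0 : 0 ≤ L := by linarith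
  have hs : 0 ≤ σ * L := mul_nonneg h0 hL0
  refine ⟨Real.exp_pos _, ?_, ?_⟩
  · unfold rr
    rw [Real.exp_le_one_iff]
    rw [← hL]; linarith
  · unfold rr
    rw [← hL]
    have lo := Real.add_one_le_exp (-σ * L)
    have hi : Real.exp (-σ * L) ≤ 1 - σ * L + (σ * L) ^ 2 := by
      have h1 : Real.exp (-σ * L) ≤ 1 / (1 + σ * L) := by
        have := Real.add_one_le_exp (σ * L)
        rw [neg_mul, Real.exp_neg, ← one_div]
        gcongr
        linarith
      refine h1.trans ?_
      rw [div_le_iff₀ (by linarith)]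
      have := pow_nonneg hs 3
      nlinarith
    have hL3 : L ≤ 2 * xx n := by nlinarith
    have q1 : (σ * L) ^ 2 ≤ 8 ^ 2 * (2 * xx n) ^ 2 := by
      rw [mul_pow]; gcongr
    have q2 : σ * L ≤ σ * (xx n + 2 * xx n ^ 2) := by gcongr
    have q3 : σ * xx n ≤ σ * L := by gcongr
    have q4 : σ * xx n ^ 2 ≤ 8 * xx n ^ 2 := by gcongr
    rw [abs_le]
    constructor <;> nlinarith [sq_nonneg (xx n)]

lemma rr_sub {σ : ℝ} (h0 : 0 ≤ σ) (h8 : σ ≤ 8) (n : ℕ) : |rr σ n - 1| ≤ 158 * xx n := by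
  obtain ⟨_, _, h⟩ := rr_bound h0 h8 n
  have hx := xx_pos n
  have hx2 := xx_le n
  rw [abs_le] at h ⊢
  have : σ * xx n ≤ 8 * xx n := by gcongr
  have : 0 ≤ σ * xx n := by positivity
  constructor <;> nlinarith

lemma norm_a {σ c K b b' : ℝ} {h : ℂ} (n : ℕ) (h0 : 0 ≤ σ) (h8 : σ ≤ 8) (hc : |c| ≤ 8)
    (hb : 0 ≤ b) (hh : ‖h‖ ≤ b) (H : |b' - (1 + σ * xx n) * b - c * xx n * h.re| ≤ K * yy n * b) :
    |rr σ n * b' - b - c * xx n * h.re| ≤ (K + 3000) * yy n * b := by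
  obtain ⟨r0, r1, hr⟩ := rr_bound h0 h8 n
  have r2 := rr_sub h0 h8 n
  have hx := xx_pos n
  have hx2 := xx_le n
  have hxy := xx_sq_le_yy n
  set r := rr σ n
  set x := xx n
  have hre := (Complex.abs_re_le_norm h).trans hh
  have e : r * b' - b - c * x * h.re = r * (b' - (1 + σ * x) * b - c * x * h.re)
    + (r * (1 + σ * x) - 1) * b + (r - 1) * (c * x * h.re) := by ring
  have a1 : |r * (b' - (1 + σ * x) * b - c * x * h.re)| ≤ K * yy n * b := by
    rw [abs_mul, abs_of_pos r0]
    exact (mul_le_of_le_one_left (abs_nonneg _) r1).trans H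
  have a2 : |(r * (1 + σ * x) - 1) * b| ≤ 1564 * x ^ 2 * b := by
    rw [abs_mul, abs_of_nonneg hb]
    gcongr
    have e2 : r * (1 + σ * x) - 1 = - (σ * x) ^ 2 + (r - (1 - σ * x)) * (1 + σ * x) := by ring
    rw [e2]
    refine (abs_add_le _ _).trans ?_
    rw [abs_neg, abs_mul, abs_of_nonneg (sq_nonneg _), abs_of_pos (by positivity : 0 < 1 + σ * x)]
    have q1 : (σ * x) ^ 2 ≤ (8 * x) ^ 2 := by gcongr
    have q2 : 1 + σ * x ≤ 5 := by nlinarith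
    have q3 : |r - (1 - σ * x)| * (1 + σ * x) ≤ (300 * x ^ 2) * 5 := by gcongr
    nlinarith
  have a3 : |(r - 1) * (c * x * h.re)| ≤ 1264 * x ^ 2 * b := by
    rw [abs_mul, abs_mul, abs_mul, abs_of_pos hx]
    calc |r - 1| * (|c| * x * |h.re|) ≤ (158 * x) * (8 * x * b) := by gcongr
      _ = _ := by ring
  rw [e]
  refine (abs_add_three _ _ _).trans ?_
  have : x ^ 2 * b ≤ yy n * b := by gcongr
  have : 0 ≤ yy n * b := mul_nonneg (yy_pos n).le hb
  nlinarith

lemma norm_b {σ K b : ℝ} {h h' ζ : ℂ} (n : ℕ) (h0 : 0 ≤ σ) (h8 : σ ≤ 8) (hz : ‖ζ‖ = 1)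
    (hb : 0 ≤ b) (hh : ‖h‖ ≤ b) (H : ‖h' - ζ * h‖ ≤ K * xx n * b) :
    ‖rr σ n * h' - ζ * h‖ ≤ (K + 158) * xx n * b := by
  obtain ⟨r0, r1, _⟩ := rr_bound h0 h8 n
  have r2 := rr_sub h0 h8 n
  have hx := xx_pos n
  have e : (rr σ n : ℂ) * h' - ζ * h = rr σ n * (h' - ζ * h) + ((rr σ n - 1 : ℝ) : ℂ) * (ζ * h) := by
    push_cast; ring
  rw [e]
  refine (norm_add_le _ _).trans ?_
  rw [norm_mul, norm_mul, norm_mul, hz, Complex.norm_real, Complex.norm_real, Real.norm_eq_abs, Real.norm_eq_abs,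
    abs_of_pos r0]
  have b1 : rr σ n * ‖h' - ζ * h‖ ≤ K * xx n * b :=
    (mul_le_of_le_one_left (norm_nonneg _) r1).trans H
  have b2 : |rr σ n - 1| * (1 * ‖h‖) ≤ (158 * xx n) * (1 * b) := by gcongr
  linarith

lemma grow {A g : ℕ → ℝ} {K : ℝ} (m : ℕ) (H : ∀ n, m ≤ n → A (n + 1) ≤ A n + K * (g n - g (n + 1)) * A n)
    (hA : ∀ n, m ≤ n → 0 ≤ A n) :
    ∀ n, m ≤ n → A n ≤ A m * Real.exp (K * (g m - g n)) := by
  intro n hn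
  induction n, hn using Nat.le_induction with
  | base => simp
  | succ n hn ih =>
    have h1 : A (n + 1) ≤ A n * Real.exp (K * (g n - g (n + 1))) := by
      have := Real.add_one_le_exp (K * (g n - g (n + 1)))
      have := mul_le_mul_of_nonneg_left this (hA n hn)
      linarith [H n hn]
    refine h1.trans ((mul_le_mul_of_nonneg_right ih (Real.exp_pos _).le).trans (le_of_eq ?_))
    rw [mul_assoc, ← Real.exp_add]
    ring_nf

/-- single recursion -/
lemma rec_single {A : ℕ → ℝ} {K : ℝ} (hK : 0 ≤ K) (m : ℕ) (hA : ∀ n, m ≤ n → 0 ≤ A n)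
    (H : ∀ n, m ≤ n → |A (n + 1) - A n| ≤ K * yy n * A n) (n : ℕ) (hn : m ≤ n) :
    A n ≤ A m * Real.exp (K * g1 m) ∧ A m * (1 - K * Real.exp (K * g1 m) * g1 m) ≤ A n := by
  have up : ∀ n, m ≤ n → A n ≤ A m * Real.exp (K * g1 m) := by
    intro n hn
    have := grow (A := A) (g := g1) (K := K) m (fun n hn => by
      have h1 := (abs_le.mp (H n hn)).2
      have : K * yy n * A n ≤ K * (g1 n - g1 (n + 1)) * A n := by
        have := yy_le n
        have := hA n hn
        gcongr
      linarith) hA n hn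
    refine this.trans ?_
    have := hA m le_rfl
    gcongr
    linarith [g1_pos n]
  refine ⟨up n hn, ?_⟩
  have lo : A m * (1 - K * Real.exp (K * g1 m) * (g1 m - g1 n)) ≤ A n := by
    induction n, hn using Nat.le_induction with
    | base => simp
    | succ n hn ih =>
      have h1 := (abs_le.mp (H n hn)).1
      have h2 : K * yy n * A n ≤ K * (g1 n - g1 (n + 1)) * (A m * Real.exp (K * g1 m)) := by
        have h3 := yy_le n
        have := hA n hn
        have := yy_pos n
        have := up n hn
        have : 0 ≤ K * (g1 n - g1 (n + 1)) := mul_nonneg hK (by linarith)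
        gcongr
      nlinarith
  refine le_trans ?_ lo
  have := hA m le_rfl
  have := g1_pos n
  gcongr
  linarith

/-- double recursion -/
lemma rec_double {A : ℕ → ℝ} {H : ℕ → ℂ} {K c η : ℝ} {ζ : ℂ} (hK : 0 ≤ K) (hc : |c| ≤ 8) (hη : 0 < η)
    (hη2 : η ≤ ‖ζ - 1‖) (m : ℕ) (hm : 16 ≤ ((m : ℝ) + 2) * η) (hA : ∀ n, m ≤ n → 0 ≤ A n)
    (hHA : ∀ n, m ≤ n → ‖H n‖ ≤ A n) (hz : ‖ζ‖ = 1)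
    (H1 : ∀ n, m ≤ n → |A (n + 1) - A n - c * xx n * (H n).re| ≤ K * yy n * A n)
    (H2 : ∀ n, m ≤ n → ‖H (n + 1) - ζ * H n‖ ≤ K * xx n * A n) (n : ℕ) (hn : m ≤ n) :
    A n ≤ A m * Real.exp ((32 * K + 60) * (g1 m + g2 m / η)) := by
  have hz1 : ζ - 1 ≠ 0 := by
    intro h; rw [h, norm_zero] at hη2; linarith
  set w : ℕ → ℝ := fun n => ((c * xx n : ℝ) * H n / (ζ - 1)).re with hw
  set T : ℕ → ℝ := fun n => A n - w n with hT
  have wb : ∀ n, m ≤ n → |w n| ≤ 8 * xx n / η * A n := by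
    intro n hn
    refine (Complex.abs_re_le_norm _).trans ?_
    rw [norm_div, norm_mul, Complex.norm_real, Real.norm_eq_abs, abs_mul, abs_of_pos (xx_pos n)]
    have := hHA n hn
    have := xx_pos n
    have := hA n hn
    calc |c| * xx n * ‖H n‖ / ‖ζ - 1‖ ≤ 8 * xx n * A n / η := by gcongr
      _ = _ := by ring
  have xs : ∀ n, m ≤ n → 8 * xx n / η ≤ 1 / 2 := by
    intro n hn
    have : (m : ℝ) ≤ n := by exact_mod_cast hn
    unfold xx
    rw [mul_one_div, div_div, div_le_div_iff₀ (by positivity) (by norm_num)]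
    nlinarith
  have T1 : ∀ n, m ≤ n → A n ≤ 2 * T n := by
    intro n hn
    have := abs_le.mp (wb n hn)
    have h2 := mul_le_mul_of_nonneg_right (xs n hn) (hA n hn)
    simp only [hT]
    linarith [this.2]
  have step : ∀ n, m ≤ n → T (n + 1) ≤ T n + (32 * K + 32) * ((g1 n + g2 n / η) - (g1 (n + 1) + g2 (n + 1) / η)) * T n := by
    intro n hn
    have hx := xx_pos n
    have hAn := hA n hn
    set E := H (n + 1) - ζ * H n with hE
    have hEb := H2 n hn
    have e : w (n + 1) - w n = c * xx n * (H n).re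
        + ((c : ℂ) * ((xx n : ℂ) * E + ((xx (n + 1) - xx n : ℝ) : ℂ) * H (n + 1)) / (ζ - 1)).re := by
      simp only [hw]
      rw [← Complex.sub_re]
      have : c * xx n * (H n).re = ((c * xx n : ℝ) * H n : ℂ).re := by
        rw [Complex.re_ofReal_mul]
      rw [this, ← Complex.add_re]
      congr 1
      field_simp
      rw [hE]
      push_cast
      ring
    have hHn : ‖H (n + 1)‖ ≤ (1 + K) * A n := by
      have e2 : H (n + 1) = ζ * H n + E := by rw [hE]; ring
      rw [e2]
      refine (norm_add_le _ _).trans ?_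
      rw [norm_mul, hz]
      have := hHA n hn
      have := xx_le n
      have : K * xx n * A n ≤ K * 1 * A n := by gcongr; linarith
      linarith
    have r2 : |((c : ℂ) * ((xx n : ℂ) * E + ((xx (n + 1) - xx n : ℝ) : ℂ) * H (n + 1)) / (ζ - 1)).re|
        ≤ 8 * (2 * K + 1) * (xx n ^ 2 / η) * A n := by
      refine (Complex.abs_re_le_norm _).trans ?_
      rw [norm_div, norm_mul, Complex.norm_real, Real.norm_eq_abs]
      have q : ‖(xx n : ℂ) * E + ((xx (n + 1) - xx n : ℝ) : ℂ) * H (n + 1)‖ ≤ (2 * K + 1) * xx n ^ 2 * A n := by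
        refine (norm_add_le _ _).trans ?_
        rw [norm_mul, norm_mul, Complex.norm_real, Complex.norm_real, Real.norm_eq_abs, Real.norm_eq_abs,
          abs_of_pos hx]
        have := xx_diff n
        have q1 : xx n * ‖E‖ ≤ xx n * (K * xx n * A n) := by gcongr
        have q2 : |xx (n + 1) - xx n| * ‖H (n + 1)‖ ≤ xx n ^ 2 * ((1 + K) * A n) := by gcongr
        nlinarith
      calc |c| * ‖(xx n : ℂ) * E + ((xx (n + 1) - xx n : ℝ) : ℂ) * H (n + 1)‖ / ‖ζ - 1‖
          ≤ 8 * ((2 * K + 1) * xx n ^ 2 * A n) / η := by gcongr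
        _ = _ := by ring
    have h1 := (abs_le.mp (H1 n hn)).2
    have h2 := (abs_le.mp r2).1
    have h3 : T (n + 1) - T n ≤ K * yy n * A n + 8 * (2 * K + 1) * (xx n ^ 2 / η) * A n := by
      simp only [hT]
      linarith
    have hy := yy_le n
    have hq : xx n ^ 2 / η ≤ (g2 n - g2 (n + 1)) / η := by gcongr; exact xx_sq_le n
    have hy0 := yy_pos n
    have hq0 : 0 ≤ xx n ^ 2 / η := by positivity
    have h4 : K * yy n * A n + 8 * (2 * K + 1) * (xx n ^ 2 / η) * A n
        ≤ (16 * K + 16) * (yy n + xx n ^ 2 / η) * A n := by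
      have := mul_nonneg hy0.le hAn
      have := mul_nonneg (mul_nonneg hK hy0.le) hAn
      have := mul_nonneg hq0 hAn
      nlinarith
    have h5 : (16 * K + 16) * (yy n + xx n ^ 2 / η) * A n
        ≤ (16 * K + 16) * ((g1 n - g1 (n + 1)) + (g2 n - g2 (n + 1)) / η) * (2 * T n) := by
      have h7 := T1 n hn
      have h8 : yy n + xx n ^ 2 / η ≤ (g1 n - g1 (n + 1)) + (g2 n - g2 (n + 1)) / η := add_le_add hy hq
      have h9 : 0 ≤ yy n + xx n ^ 2 / η := by positivity
      exact mul_le_mul (mul_le_mul_of_nonneg_left h8 (by linarith)) h7 hAn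
        (mul_nonneg (by linarith) (h9.trans h8))
    have e6 : (16 * K + 16) * ((g1 n - g1 (n + 1)) + (g2 n - g2 (n + 1)) / η) * (2 * T n)
      = (32 * K + 32) * ((g1 n + g2 n / η) - (g1 (n + 1) + g2 (n + 1) / η)) * T n := by ring
    linarith
  have T0 : ∀ n, m ≤ n → 0 ≤ T n := fun n hn => by linarith [T1 n hn, hA n hn]
  have main := grow (A := T) (g := fun n => g1 n + g2 n / η) m step T0 n hn
  have hxg : ∀ n, m ≤ n → xx n / η ≤ g2 m / η := fun n hn => by
    gcongr
    exact (xx_g2 n).trans (g2_anti hn)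
  have e1 : T m ≤ A m * Real.exp (8 * (g2 m / η)) := by
    have h1 := (abs_le.mp (wb m le_rfl)).1
    have h2 := Real.add_one_le_exp (8 * (g2 m / η))
    have h3 := hxg m le_rfl
    have h4 : 8 * xx m / η = 8 * (xx m / η) := by ring
    rw [h4] at h1
    have := hA m le_rfl
    have : A m * (8 * (xx m / η) + 1) ≤ A m * Real.exp (8 * (g2 m / η)) := by
      gcongr
      linarith
    simp only [hT]
    linarith
  have e2 : A n ≤ T n * Real.exp (16 * (g2 m / η)) := by
    have h1 := (abs_le.mp (wb n hn)).2
    have h2 := Real.add_one_le_exp (16 * (g2 m / η))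
    have h3 := hxg n hn
    have h4 : 8 * xx n / η = 8 * (xx n / η) := by ring
    have h6 := xs n hn
    rw [h4] at h1 h6
    have hAn := hA n hn
    have hx := xx_pos n
    set q := xx n / η
    have hq0 : 0 < q := by positivity
    have h5 : A n * (1 - 8 * q) ≤ T n := by simp only [hT]; linarith
    have h7 : T n * (16 * q + 1) ≤ T n * Real.exp (16 * (g2 m / η)) := by
      have := T0 n hn
      gcongr
      linarith
    have h8 : A n * (1 - 8 * q) * (16 * q + 1) ≤ T n * (16 * q + 1) := by gcongr
    have h9 : A n * 1 ≤ A n * ((1 - 8 * q) * (16 * q + 1)) := by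
      gcongr
      nlinarith
    linarith
  have hAm := hA m le_rfl
  have hg := g1_pos n
  have hg' := g1_pos m
  have hg2 := g2_pos n
  have hg3 : 0 < g2 n / η := by positivity
  have hg4 := g2_pos m
  have hg5 : 0 < g2 m / η := by positivity
  calc A n ≤ T n * Real.exp (16 * (g2 m / η)) := e2
    _ ≤ (T m * Real.exp ((32 * K + 32) * (g1 m + g2 m / η - (g1 n + g2 n / η)))) * Real.exp (16 * (g2 m / η)) := by
      gcongr
    _ ≤ ((A m * Real.exp (8 * (g2 m / η))) * Real.exp ((32 * K + 32) * (g1 m + g2 m / η))) * Real.exp (16 * (g2 m / η)) := by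
      gcongr
      linarith
    _ = A m * Real.exp (8 * (g2 m / η) + (32 * K + 32) * (g1 m + g2 m / η) + 16 * (g2 m / η)) := by
      rw [Real.exp_add, Real.exp_add]; ring
    _ ≤ _ := by
      gcongr
      nlinarith

/-! ### Part H: one-step estimates -/

/-- unit vector of the phase -/
noncomputable def uu (n : ℕ) (ω : Om) (θ : ℝ) : ℂ := Complex.exp (phi n ω θ * Complex.I)

lemma uu_norm (n : ℕ) (ω : Om) (θ : ℝ) : ‖uu n ω θ‖ = 1 := Complex.norm_exp_ofReal_mul_I _

/-- functions not depending on the coordinates after `m` -/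
def Adp {α : Type*} (m : ℕ) (F : Om → α) : Prop :=
  ∀ (ω : Om) (k : ℕ) (u : UG (k + 1)), m < k → F (Function.update ω k u) = F ω

lemma Adp.mono {α : Type*} {m n : ℕ} {F : Om → α} (h : Adp m F) (hmn : m ≤ n) : Adp n F :=
  fun ω k u hk => h ω k u (hmn.trans_lt hk)

lemma aa_upd (ω : Om) (n k : ℕ) (u : UG (k + 1)) (h : n < k) :
    aa n (Function.update ω k u) = aa n ω := by
  unfold aa; rw [Function.update_of_ne h.ne]

lemma aa_upd_self (ω : Om) (k : ℕ) (u : UG (k + 1)) : aa k (Function.update ω k u) = u.1 0 0 := by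
  unfold aa; rw [Function.update_self]

lemma phi_adp (n : ℕ) (θ : ℝ) : Adp n (fun ω => phi n ω θ) := by
  intro ω k u hk
  induction n with
  | zero => simp only [phi, aa_upd ω 0 k u hk]
  | succ n ih =>
    have := ih (by omega)
    simp only at this ⊢
    simp only [phi, aa_upd ω (n + 1) k u hk, this]

lemma SS_adp (n : ℕ) (θ : ℝ) : Adp n (fun ω => SS n ω θ) := by
  intro ω k u hk
  have := phi_adp n θ ω k u hk
  simp only [SS] at this ⊢
  rw [this]

lemma uu_adp (n : ℕ) (θ : ℝ) : Adp n (fun ω => uu n ω θ) := by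
  intro ω k u hk
  have := phi_adp n θ ω k u hk
  simp only [uu] at this ⊢
  rw [this]

lemma aa_meas (n : ℕ) : Measurable (aa n) :=
  (entry_continuous 0 0).measurable.comp (measurable_pi_apply n)

lemma phi_meas (n : ℕ) (θ : ℝ) : Measurable (fun ω => phi n ω θ) := by
  induction n with
  | zero => exact measurable_const.sub (Complex.measurable_arg.comp (aa_meas 0))
  | succ n ih =>
    simp only [phi]
    refine (measurable_const.add ih).sub (Measurable.const_mul ?_ _)
    refine Complex.measurable_arg.comp (measurable_const.add ((aa_meas (n + 1)).mul ?_))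
    exact Complex.measurable_exp.comp ((Complex.measurable_ofReal.comp ih).mul_const _)

lemma SS_meas (n : ℕ) (θ : ℝ) : Measurable (fun ω => SS n ω θ) :=
  (phi_meas n θ).sub_const _

lemma uu_meas (n : ℕ) (θ : ℝ) : Measurable (fun ω => uu n ω θ) :=
  Complex.measurable_exp.comp ((Complex.measurable_ofReal.comp (phi_meas n θ)).mul_const _)

lemma SS_succ (n : ℕ) (ω : Om) (θ : ℝ) :
    SS (n + 1) ω θ = SS n ω θ + Xf (aa (n + 1) ω * uu n ω θ) := by
  simp only [SS, phi, Xf, uu]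
  push_cast
  ring

lemma SS_bound (n : ℕ) (ω : Om) (θ : ℝ) : |SS n ω θ| ≤ 2 * π * (n + 1) := by
  induction n with
  | zero =>
    simp only [SS, phi]
    have := Complex.abs_arg_le_pi (aa 0 ω)
    have h := pi_pos
    rw [abs_le] at this ⊢
    push_cast
    constructor <;> linarith
  | succ n ih =>
    rw [SS_succ]
    refine (abs_add_le _ _).trans ?_
    have := Xf_bound (aa (n + 1) ω * uu n ω θ)
    push_cast
    linarith

section
variable (μ : (n : ℕ) → Measure (UG (n + 1))) [∀ n, IsProbabilityMeasure (μ n)]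
  [∀ n, (μ n).IsMulLeftInvariant]

lemma cexp_real_norm (s s' : ℂ) (hs : ‖s‖ ≤ 3) (hs' : ‖s'‖ ≤ 3) (v w : ℂ) :
    ‖Complex.exp (s * Xf v + s' * Xf w)‖ ≤ Real.exp (12 * π) := by
  refine (Complex.norm_exp_le_exp_norm _).trans (Real.exp_le_exp.mpr ?_)
  refine (norm_add_le _ _).trans ?_
  rw [norm_mul, norm_mul, Complex.norm_real, Complex.norm_real, Real.norm_eq_abs, Real.norm_eq_abs]
  have h1 := Xf_bound v
  have h2 := Xf_bound w
  have : ‖s‖ * |Xf v| ≤ 3 * (2 * π) := by gcongr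
  have : ‖s'‖ * |Xf w| ≤ 3 * (2 * π) := by gcongr
  linarith

lemma step_c (n : ℕ) (G : Om → ℂ) (hG : Measurable G) (B : ℝ) (hB : ∀ ω, ‖G ω‖ ≤ B) (hA : Adp n G)
    (s s' : ℂ) (hs : ‖s‖ ≤ 3) (hs' : ‖s'‖ ≤ 3) (θ θ' : ℝ) :
    ‖∫ ω, G ω * Complex.exp (s * Xf (aa (n + 1) ω * uu n ω θ) + s' * Xf (aa (n + 1) ω * uu n ω θ'))
        ∂(Measure.infinitePi μ)
      - ∫ ω, G ω * (1 + (s * uu n ω θ + s' * uu n ω θ')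
          * (s * starRingEnd ℂ (uu n ω θ) + s' * starRingEnd ℂ (uu n ω θ')) * xx n)
        ∂(Measure.infinitePi μ)‖ ≤ 2 * C0 * yy n * ∫ ω, ‖G ω‖ ∂(Measure.infinitePi μ) := by
  have hB0 : 0 ≤ B := (norm_nonneg _).trans (hB (fun _ => 1))
  have hXm : ∀ θ, Measurable fun ω : Om => ((Xf (aa (n + 1) ω * uu n ω θ) : ℝ) : ℂ) := fun θ =>
    Complex.measurable_ofReal.comp (Xf_meas.comp ((aa_meas _).mul (uu_meas n θ)))
  have hm1 : Measurable fun ω : Om => G ω * Complex.exp (s * Xf (aa (n + 1) ω * uu n ω θ)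
      + s' * Xf (aa (n + 1) ω * uu n ω θ')) :=
    hG.mul (Complex.measurable_exp.comp (((hXm θ).const_mul s).add ((hXm θ').const_mul s')))
  have hi1 : Integrable (fun ω : Om => G ω * Complex.exp (s * Xf (aa (n + 1) ω * uu n ω θ)
      + s' * Xf (aa (n + 1) ω * uu n ω θ'))) (Measure.infinitePi μ) := by
    refine bdd_int' _ hm1 (B * Real.exp (12 * π)) fun ω => ?_
    rw [norm_mul]
    have := hB ω
    have := cexp_real_norm s s' hs hs' (aa (n + 1) ω * uu n ω θ) (aa (n + 1) ω * uu n ω θ')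
    gcongr
  have hcm : ∀ θ, Measurable fun ω : Om => starRingEnd ℂ (uu n ω θ) := fun θ =>
    Complex.continuous_conj.measurable.comp (uu_meas n θ)
  have hcn : ∀ z : ℂ, ‖starRingEnd ℂ z‖ = ‖z‖ := fun z => RCLike.norm_conj z
  have hi2 : Integrable (fun ω : Om => G ω * (1 + (s * uu n ω θ + s' * uu n ω θ')
          * (s * starRingEnd ℂ (uu n ω θ) + s' * starRingEnd ℂ (uu n ω θ')) * xx n))
      (Measure.infinitePi μ) := by
    refine bdd_int' _ (hG.mul (measurable_const.add (((((uu_meas n θ).const_mul s).add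
      ((uu_meas n θ').const_mul s')).mul (((hcm θ).const_mul s).add ((hcm θ').const_mul s'))).mul_const _)))
      (B * (1 + (3 + 3) * (3 + 3) * 1)) fun ω => ?_
    rw [norm_mul]
    have h1 := hB ω
    have h2 : ‖s * uu n ω θ + s' * uu n ω θ'‖ ≤ 3 + 3 := by
      refine (norm_add_le _ _).trans ?_
      rw [norm_mul, norm_mul, uu_norm, uu_norm]; linarith
    have h3 : ‖s * starRingEnd ℂ (uu n ω θ) + s' * starRingEnd ℂ (uu n ω θ')‖ ≤ 3 + 3 := by
      refine (norm_add_le _ _).trans ?_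
      rw [norm_mul, norm_mul, hcn, hcn, uu_norm, uu_norm]; linarith
    gcongr
    refine (norm_add_le _ _).trans ?_
    rw [norm_mul, norm_mul, norm_one, Complex.norm_real, Real.norm_eq_abs, abs_of_pos (xx_pos n)]
    have := xx_le n
    have := xx_pos n
    gcongr
    linarith
  rw [resample_int μ (n + 1) _ hi1]
  have hin : ∀ ω : Om, ∫ u, G (Function.update ω (n + 1) u) *
        Complex.exp (s * Xf (aa (n + 1) (Function.update ω (n + 1) u) * uu n (Function.update ω (n + 1) u) θ)
      + s' * Xf (aa (n + 1) (Function.update ω (n + 1) u) * uu n (Function.update ω (n + 1) u) θ')) ∂(μ (n + 1))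
      = G ω * ∫ u, Complex.exp (s * Xf (u.1 0 0 * uu n ω θ) + s' * Xf (u.1 0 0 * uu n ω θ')) ∂(μ (n + 1)) := by
    intro ω
    rw [← integral_const_mul]
    congr 1
    funext u
    have e1 := hA ω (n + 1) u (by omega)
    have e2 := uu_adp n θ ω (n + 1) u (by omega)
    have e3 := uu_adp n θ' ω (n + 1) u (by omega)
    simp only at e2 e3
    rw [e1, e2, e3, aa_upd_self]
  simp only [hin]
  have hi3 : Integrable (fun ω : Om => G ω * ∫ u, Complex.exp (s * Xf (u.1 0 0 * uu n ω θ)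
      + s' * Xf (u.1 0 0 * uu n ω θ')) ∂(μ (n + 1))) (Measure.infinitePi μ) := by
    have hp : IsProbabilityMeasure (μ (n + 1)) := inferInstance
    have : IsFiniteMeasure (μ (n + 1)) := ⟨by rw [hp.measure_univ]; exact ENNReal.one_lt_top⟩
    have : SFinite (μ (n + 1)) := @MeasureTheory.instSFiniteOfSigmaFinite _ _ _ (@IsFiniteMeasure.toSigmaFinite _ _ _ _)
    have := ((resample_mp μ (n + 1)).integrable_comp_of_integrable hi1).integral_prod_left
    refine this.congr (Eventually.of_forall fun ω => ?_)
    exact hin ω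
  rw [← integral_sub hi3 hi2]
  refine (norm_integral_le_integral_norm _).trans ?_
  rw [← integral_const_mul]
  refine integral_mono (hi3.sub hi2).norm ((bdd_int' _ hG B hB).norm.const_mul _) fun ω => ?_
  simp only
  rw [← mul_sub, norm_mul, mul_comm]
  gcongr
  have := one_step (μ (n + 1)) s s' (uu n ω θ) (uu n ω θ') hs hs' (uu_norm _ _ _) (uu_norm _ _ _)
  have e : (((n + 1 : ℕ) : ℝ) + 1) = (n : ℝ) + 2 := by push_cast; ring
  have e' : (((n + 1 : ℕ) : ℂ) + 1) = (n : ℂ) + 2 := by push_cast; ring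
  rw [e, e'] at this
  have ex : (xx n : ℂ) = 1 / ((n : ℂ) + 2) := by unfold xx; push_cast; rfl
  rw [ex, mul_one_div]
  refine this.trans (le_of_eq ?_)
  unfold yy
  ring
end

/-! ### Part I: exponential moments -/

/-- the exponential weight -/
noncomputable def EE (m n : ℕ) (s s' θ θ' : ℝ) (ω : Om) : ℝ :=
  Real.exp (s * (SS n ω θ - SS m ω θ) + s' * (SS n ω θ' - SS m ω θ'))

lemma EE_pos (m n : ℕ) (s s' θ θ' : ℝ) (ω : Om) : 0 < EE m n s s' θ θ' ω := Real.exp_pos _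

lemma EE_self (m : ℕ) (s s' θ θ' : ℝ) (ω : Om) : EE m m s s' θ θ' ω = 1 := by simp [EE]

lemma EE_meas (m n : ℕ) (s s' θ θ' : ℝ) : Measurable (EE m n s s' θ θ') :=
  Real.measurable_exp.comp ((((SS_meas n θ).sub (SS_meas m θ)).const_mul s).add
    (((SS_meas n θ').sub (SS_meas m θ')).const_mul s'))

lemma EE_adp (m n : ℕ) (hmn : m ≤ n) (s s' θ θ' : ℝ) : Adp n (EE m n s s' θ θ') := by
  intro ω k u hk
  have h1 := SS_adp n θ ω k u hk
  have h2 := SS_adp n θ' ω k u hk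
  have h3 := SS_adp m θ ω k u (by omega)
  have h4 := SS_adp m θ' ω k u (by omega)
  simp only at h1 h2 h3 h4
  simp only [EE, h1, h2, h3, h4]

lemma EE_bound (m n : ℕ) (s s' θ θ' : ℝ) : ∃ C : ℝ, ∀ ω, EE m n s s' θ θ' ω ≤ C := by
  refine ⟨Real.exp ((|s| + |s'|) * (2 * π * (n + 1) + 2 * π * (m + 1))), fun ω => ?_⟩
  refine Real.exp_le_exp.mpr ((le_abs_self _).trans ((abs_add_le _ _).trans ?_))
  have h : ∀ θ, |SS n ω θ - SS m ω θ| ≤ 2 * π * (n + 1) + 2 * π * (m + 1) := fun θ =>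
    (abs_sub _ _).trans (add_le_add (SS_bound _ _ _) (SS_bound _ _ _))
  rw [abs_mul, abs_mul, add_mul]
  have h1 := h θ
  have h2 := h θ'
  gcongr

lemma EE_succ (m n : ℕ) (s s' θ θ' : ℝ) (ω : Om) : EE m (n + 1) s s' θ θ' ω
    = EE m n s s' θ θ' ω * Real.exp (s * Xf (aa (n + 1) ω * uu n ω θ) + s' * Xf (aa (n + 1) ω * uu n ω θ')) := by
  simp only [EE, ← Real.exp_add, SS_succ]
  ring_nf

lemma uu_succ (n : ℕ) (ω : Om) (θ : ℝ) : uu (n + 1) ω θ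
    = Complex.exp (θ * Complex.I) * uu n ω θ * Complex.exp (Complex.I * Xf (aa (n + 1) ω * uu n ω θ)) := by
  have : phi (n + 1) ω θ = θ + phi n ω θ + Xf (aa (n + 1) ω * uu n ω θ) := by
    simp only [phi, Xf, uu]; ring
  simp only [uu] at *
  rw [this, ← Complex.exp_add, ← Complex.exp_add]
  congr 1
  push_cast
  ring

section
variable (μ : (n : ℕ) → Measure (UG (n + 1))) [∀ n, IsProbabilityMeasure (μ n)]
  [∀ n, (μ n).IsMulLeftInvariant]

/-- first quantity -/
noncomputable def BB (F : Om → ℝ) (m n : ℕ) (s s' θ θ' : ℝ) : ℝ :=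
  ∫ ω, F ω * EE m n s s' θ θ' ω ∂(Measure.infinitePi μ)

/-- oscillating quantity -/
noncomputable def HH (F : Om → ℝ) (m n : ℕ) (s s' θ θ' : ℝ) : ℂ :=
  ∫ ω, ((F ω * EE m n s s' θ θ' ω : ℝ) : ℂ) * (uu n ω θ * starRingEnd ℂ (uu n ω θ')) ∂(Measure.infinitePi μ)

/-- admissible prefactors -/
structure Adm (m : ℕ) (F : Om → ℝ) : Prop where
  meas : Measurable F
  nn : ∀ ω, 0 ≤ F ω
  bd : ∃ B, ∀ ω, F ω ≤ B
  adp : Adp m F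

lemma Adm.ee {m : ℕ} {F : Om → ℝ} (h : Adm m F) (n : ℕ) (hmn : m ≤ n) (s s' θ θ' : ℝ) :
    Adm n (fun ω => F ω * EE m n s s' θ θ' ω) := by
  refine ⟨h.meas.mul (EE_meas _ _ _ _ _ _), fun ω => mul_nonneg (h.nn ω) (EE_pos _ _ _ _ _ _ _).le, ?_, ?_⟩
  · obtain ⟨B, hB⟩ := h.bd
    obtain ⟨C, hC⟩ := EE_bound m n s s' θ θ'
    refine ⟨B * C, fun ω => ?_⟩
    have := hB ω
    have := hC ω
    have := h.nn ω
    have := (EE_pos m n s s' θ θ' ω).le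
    have : 0 ≤ B := by linarith
    gcongr
  · intro ω k u hk
    simp only
    rw [h.adp ω k u (by omega), EE_adp m n hmn s s' θ θ' ω k u hk]

lemma Adm.int {m : ℕ} {F : Om → ℝ} (h : Adm m F) : Integrable F (Measure.infinitePi μ) := by
  obtain ⟨B, hB⟩ := h.bd
  exact bdd_int' _ h.meas B fun ω => by rw [Real.norm_eq_abs, abs_of_nonneg (h.nn ω)]; exact hB ω

lemma BB_nn {m : ℕ} {F : Om → ℝ} (h : Adm m F) (n : ℕ) (s s' θ θ' : ℝ) : 0 ≤ BB μ F m n s s' θ θ' :=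
  integral_nonneg fun ω => mul_nonneg (h.nn ω) (EE_pos _ _ _ _ _ _ _).le

lemma HH_le {m : ℕ} {F : Om → ℝ} (h : Adm m F) (n : ℕ) (s s' θ θ' : ℝ) :
    ‖HH μ F m n s s' θ θ'‖ ≤ BB μ F m n s s' θ θ' := by
  refine (norm_integral_le_integral_norm _).trans (le_of_eq ?_)
  unfold BB
  congr 1
  funext ω
  rw [norm_mul, norm_mul, RCLike.norm_conj, uu_norm, uu_norm, Complex.norm_real, Real.norm_eq_abs,
    abs_of_nonneg (mul_nonneg (h.nn ω) (EE_pos _ _ _ _ _ _ _).le)]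
  ring

lemma stepB {m : ℕ} {F : Om → ℝ} (h : Adm m F) (n : ℕ) (hmn : m ≤ n) (s s' θ θ' : ℝ) (hs : |s| ≤ 2) (hs' : |s'| ≤ 2) :
    |BB μ F m (n + 1) s s' θ θ' - (1 + (s ^ 2 + s' ^ 2) * xx n) * BB μ F m n s s' θ θ'
      - (2 * s * s') * xx n * (HH μ F m n s s' θ θ').re| ≤ 2 * C0 * yy n * BB μ F m n s s' θ θ' := by
  have hE := h.ee n hmn s s' θ θ'
  obtain ⟨B, hB⟩ := hE.bd
  set G : Om → ℂ := fun ω => ((F ω * EE m n s s' θ θ' ω : ℝ) : ℂ) with hG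
  have hGm : Measurable G := Complex.measurable_ofReal.comp hE.meas
  have hGn : ∀ ω, ‖G ω‖ = F ω * EE m n s s' θ θ' ω := fun ω => by
    rw [hG]; simp only; rw [Complex.norm_real, Real.norm_eq_abs, abs_of_nonneg (hE.nn ω)]
  have hGB : ∀ ω, ‖G ω‖ ≤ B := fun ω => by rw [hGn]; exact hB ω
  have hGA : Adp n G := fun ω k u hk => by
    have := hE.adp ω k u hk
    simp only [hG, this]
  have key := step_c μ n G hGm B hGB hGA (s : ℂ) (s' : ℂ)
    (by rw [Complex.norm_real, Real.norm_eq_abs]; linarith)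
    (by rw [Complex.norm_real, Real.norm_eq_abs]; linarith) θ θ'
  have e1 : ∫ ω, G ω * Complex.exp ((s : ℂ) * Xf (aa (n + 1) ω * uu n ω θ) + s' * Xf (aa (n + 1) ω * uu n ω θ'))
        ∂(Measure.infinitePi μ) = (BB μ F m (n + 1) s s' θ θ' : ℂ) := by
    unfold BB
    rw [← integral_complex_ofReal]
    congr 1
    funext ω
    rw [EE_succ, hG]
    push_cast
    ring
  have huc : ∀ ω θ, uu n ω θ * starRingEnd ℂ (uu n ω θ) = 1 := fun ω θ => by
    rw [Complex.mul_conj, Complex.normSq_eq_norm_sq, uu_norm]; simp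
  have hkm : Measurable fun ω => G ω * (uu n ω θ * starRingEnd ℂ (uu n ω θ')) :=
    hGm.mul ((uu_meas n θ).mul (Complex.continuous_conj.measurable.comp (uu_meas n θ')))
  have hki : Integrable (fun ω => G ω * (uu n ω θ * starRingEnd ℂ (uu n ω θ'))) (Measure.infinitePi μ) := by
    refine bdd_int' _ hkm B fun ω => ?_
    rw [norm_mul, norm_mul, RCLike.norm_conj, uu_norm, uu_norm]
    simpa using hGB ω
  have hGi : Integrable G (Measure.infinitePi μ) := bdd_int' _ hGm B hGB
  have e2 : ∫ ω, G ω * (1 + ((s : ℂ) * uu n ω θ + s' * uu n ω θ')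
          * (s * starRingEnd ℂ (uu n ω θ) + s' * starRingEnd ℂ (uu n ω θ')) * xx n)
        ∂(Measure.infinitePi μ) = (((1 + (s ^ 2 + s' ^ 2) * xx n) * BB μ F m n s s' θ θ'
      + (2 * s * s') * xx n * (HH μ F m n s s' θ θ').re : ℝ) : ℂ) := by
    have p : ∀ ω, G ω * (1 + ((s : ℂ) * uu n ω θ + s' * uu n ω θ')
          * (s * starRingEnd ℂ (uu n ω θ) + s' * starRingEnd ℂ (uu n ω θ')) * xx n)
        = ((1 + (s ^ 2 + s' ^ 2) * xx n : ℝ) : ℂ) * G ω + ((s * s' * xx n : ℝ) : ℂ) *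
          (G ω * (uu n ω θ * starRingEnd ℂ (uu n ω θ')) + starRingEnd ℂ (G ω * (uu n ω θ * starRingEnd ℂ (uu n ω θ')))) := by
      intro ω
      have h1 := huc ω θ
      have h2 := huc ω θ'
      have h3 : starRingEnd ℂ (G ω) = G ω := Complex.conj_ofReal _
      rw [map_mul, map_mul, h3, Complex.conj_conj]
      push_cast
      linear_combination (G ω * s ^ 2 * xx n) * h1 + (G ω * s' ^ 2 * xx n) * h2
    have hkc : Integrable (fun ω => starRingEnd ℂ (G ω * (uu n ω θ * starRingEnd ℂ (uu n ω θ')))) (Measure.infinitePi μ) := by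
      refine bdd_int' _ (Complex.continuous_conj.measurable.comp hkm) B fun ω => ?_
      rw [RCLike.norm_conj, norm_mul, norm_mul, RCLike.norm_conj, uu_norm, uu_norm]
      simpa using hGB ω
    simp only [p]
    have hadd : Integrable (fun ω => G ω * (uu n ω θ * starRingEnd ℂ (uu n ω θ'))
        + starRingEnd ℂ (G ω * (uu n ω θ * starRingEnd ℂ (uu n ω θ')))) (Measure.infinitePi μ) := hki.add hkc
    rw [integral_add (hGi.const_mul _) (hadd.const_mul _), integral_const_mul, integral_const_mul,
      integral_add hki hkc, integral_conj]
    have q1 : ∫ ω, G ω ∂(Measure.infinitePi μ) = (BB μ F m n s s' θ θ' : ℂ) := integral_complex_ofReal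
    have q2 : ∫ ω, G ω * (uu n ω θ * starRingEnd ℂ (uu n ω θ')) ∂(Measure.infinitePi μ) = HH μ F m n s s' θ θ' := rfl
    rw [q1, q2, Complex.add_conj]
    push_cast
    ring
  have e3 : ∫ ω, ‖G ω‖ ∂(Measure.infinitePi μ) = BB μ F m n s s' θ θ' := by simp only [hGn]; rfl
  rw [e1, e2, e3, ← Complex.ofReal_sub, Complex.norm_real, Real.norm_eq_abs] at key
  rw [sub_sub]
  exact key

lemma stepH {m : ℕ} {F : Om → ℝ} (h : Adm m F) (n : ℕ) (hmn : m ≤ n) (s s' θ θ' : ℝ) (hs : |s| ≤ 2) (hs' : |s'| ≤ 2) :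
    ‖HH μ F m (n + 1) s s' θ θ' - Complex.exp ((θ - θ' : ℝ) * Complex.I) * HH μ F m n s s' θ θ'‖
      ≤ (36 + 2 * C0) * xx n * BB μ F m n s s' θ θ' := by
  have hE := h.ee n hmn s s' θ θ'
  obtain ⟨B, hB⟩ := hE.bd
  set ζ := Complex.exp ((θ - θ' : ℝ) * Complex.I) with hζ
  have hζ1 : ‖ζ‖ = 1 := Complex.norm_exp_ofReal_mul_I _
  set G : Om → ℂ := fun ω => ζ * (((F ω * EE m n s s' θ θ' ω : ℝ) : ℂ) * (uu n ω θ * starRingEnd ℂ (uu n ω θ'))) with hG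
  have hcm : ∀ θ, Measurable fun ω : Om => starRingEnd ℂ (uu n ω θ) := fun θ =>
    Complex.continuous_conj.measurable.comp (uu_meas n θ)
  have hGm : Measurable G := measurable_const.mul ((Complex.measurable_ofReal.comp hE.meas).mul ((uu_meas n θ).mul (hcm θ')))
  have hGn : ∀ ω, ‖G ω‖ = F ω * EE m n s s' θ θ' ω := fun ω => by
    rw [hG]; simp only
    rw [norm_mul, norm_mul, norm_mul, RCLike.norm_conj, uu_norm, uu_norm, hζ1, Complex.norm_real, Real.norm_eq_abs, abs_of_nonneg (hE.nn ω)]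
    ring
  have hGB : ∀ ω, ‖G ω‖ ≤ B := fun ω => by rw [hGn]; exact hB ω
  have hGA : Adp n G := fun ω k u hk => by
    have := hE.adp ω k u hk
    have h1 := uu_adp n θ ω k u hk
    have h2 := uu_adp n θ' ω k u hk
    simp only at this h1 h2
    simp only [hG, this, h1, h2]
  have n1 : ‖(s : ℂ) + Complex.I‖ ≤ 3 := by
    refine (norm_add_le _ _).trans ?_
    rw [Complex.norm_real, Real.norm_eq_abs, Complex.norm_I]; linarith
  have n2 : ‖(s' : ℂ) - Complex.I‖ ≤ 3 := by
    refine (norm_sub_le _ _).trans ?_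
    rw [Complex.norm_real, Real.norm_eq_abs, Complex.norm_I]; linarith
  have key := step_c μ n G hGm B hGB hGA (s + Complex.I) (s' - Complex.I) n1 n2 θ θ'
  have e1 : ∫ ω, G ω * Complex.exp ((s + Complex.I) * Xf (aa (n + 1) ω * uu n ω θ)
        + (s' - Complex.I) * Xf (aa (n + 1) ω * uu n ω θ'))
        ∂(Measure.infinitePi μ) = HH μ F m (n + 1) s s' θ θ' := by
    unfold HH
    congr 1
    funext ω
    rw [EE_succ, uu_succ, uu_succ, hG]
    simp only [map_mul, ← Complex.exp_conj, Complex.conj_I, Complex.conj_ofReal]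
    rw [hζ]
    set X := Xf (aa (n + 1) ω * uu n ω θ)
    set X' := Xf (aa (n + 1) ω * uu n ω θ')
    have a1 : Complex.exp ((s + Complex.I) * X + (s' - Complex.I) * X')
      = Complex.exp (s * X + s' * X') * Complex.exp (Complex.I * X) * Complex.exp (-Complex.I * X') := by
      rw [← Complex.exp_add, ← Complex.exp_add]; congr 1; ring
    have a2 : Complex.exp ((θ - θ' : ℝ) * Complex.I) = Complex.exp (θ * Complex.I) * Complex.exp (θ' * -Complex.I) := by
      rw [← Complex.exp_add]; congr 1; push_cast; ring
    rw [a1, a2]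
    push_cast
    ring
  rw [e1] at key
  have hGi : Integrable G (Measure.infinitePi μ) := bdd_int' _ hGm B hGB
  set Q : Om → ℂ := fun ω => ((s + Complex.I) * uu n ω θ + (s' - Complex.I) * uu n ω θ')
          * ((s + Complex.I) * starRingEnd ℂ (uu n ω θ) + (s' - Complex.I) * starRingEnd ℂ (uu n ω θ')) * xx n with hQ
  have hQm : Measurable Q :=
    ((((uu_meas n θ).const_mul _).add ((uu_meas n θ').const_mul _)).mul
      (((hcm θ).const_mul _).add ((hcm θ').const_mul _))).mul_const _
  have hQn : ∀ ω, ‖Q ω‖ ≤ 36 * xx n := by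
    intro ω
    have h2 : ‖(s + Complex.I) * uu n ω θ + (s' - Complex.I) * uu n ω θ'‖ ≤ 6 := by
      refine (norm_add_le _ _).trans ?_
      rw [norm_mul, norm_mul, uu_norm, uu_norm]; linarith
    have h3 : ‖(s + Complex.I) * starRingEnd ℂ (uu n ω θ) + (s' - Complex.I) * starRingEnd ℂ (uu n ω θ')‖ ≤ 6 := by
      refine (norm_add_le _ _).trans ?_
      rw [norm_mul, norm_mul, RCLike.norm_conj, RCLike.norm_conj, uu_norm, uu_norm]; linarith
    rw [hQ]
    simp only
    rw [norm_mul, norm_mul, Complex.norm_real, Real.norm_eq_abs, abs_of_pos (xx_pos n)]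
    have := xx_pos n
    calc _ ≤ 6 * 6 * xx n := by gcongr
      _ = _ := by ring
  have hGQ : Integrable (fun ω => G ω * Q ω) (Measure.infinitePi μ) := by
    refine bdd_int' _ (hGm.mul hQm) (B * (36 * xx n)) fun ω => ?_
    rw [norm_mul]
    have := hGB ω
    have := hQn ω
    have := (norm_nonneg _).trans (hGB ω)
    gcongr
  have e2 : ∫ ω, G ω * (1 + Q ω) ∂(Measure.infinitePi μ) = ζ * HH μ F m n s s' θ θ'
      + ∫ ω, G ω * Q ω ∂(Measure.infinitePi μ) := by
    simp only [mul_add, mul_one]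
    rw [integral_add hGi hGQ]
    congr 1
    rw [hG, integral_const_mul]
    rfl
  have e2' := e2
  simp only [hQ] at e2'
  rw [e2'] at key
  have e3 : ∫ ω, ‖G ω‖ ∂(Measure.infinitePi μ) = BB μ F m n s s' θ θ' := by simp only [hGn]; rfl
  rw [e3] at key
  have e4 : ‖∫ ω, G ω * Q ω ∂(Measure.infinitePi μ)‖ ≤ 36 * xx n * BB μ F m n s s' θ θ' := by
    refine (norm_integral_le_integral_norm _).trans ?_
    rw [← e3, ← integral_const_mul]
    refine integral_mono hGQ.norm (hGi.norm.const_mul _) fun ω => ?_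
    simp only
    rw [norm_mul, mul_comm]
    have := hQn ω
    gcongr
  have hb := BB_nn μ h n s s' θ θ'
  have hy : yy n ≤ xx n := by
    unfold yy xx
    gcongr
    have h1 : (1:ℝ) ≤ √((n : ℝ) + 2) := by
      rw [Real.one_le_sqrt]
      have : (0:ℝ) ≤ n := by positivity
      linarith
    have : (0:ℝ) < (n : ℝ) + 2 := by positivity
    nlinarith
  have e5 : 2 * C0 * yy n * BB μ F m n s s' θ θ' ≤ 2 * C0 * xx n * BB μ F m n s s' θ θ' := by
    have := C0_pos
    gcongr
  simp only [hQ] at e4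
  set R := ∫ ω, G ω * (((s + Complex.I) * uu n ω θ + (s' - Complex.I) * uu n ω θ')
          * ((s + Complex.I) * starRingEnd ℂ (uu n ω θ) + (s' - Complex.I) * starRingEnd ℂ (uu n ω θ')) * xx n) ∂(Measure.infinitePi μ)
  have e6 : HH μ F m (n + 1) s s' θ θ' - ζ * HH μ F m n s s' θ θ'
    = (HH μ F m (n + 1) s s' θ θ' - (ζ * HH μ F m n s s' θ θ' + R)) + R := by ring
  rw [e6]
  refine (norm_add_le _ _).trans ?_
  linarith
end

/-! ### Part J: exponential moment bounds -/

noncomputable def CK : ℝ := 2 * C0 + 4000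

lemma CK_pos : 0 < CK := by unfold CK; linarith [C0_pos]

/-- log ratio -/
noncomputable def lam (m n : ℕ) : ℝ := Real.log ((n : ℝ) + 1) - Real.log ((m : ℝ) + 1)

lemma lam_nonneg {m n : ℕ} (h : m ≤ n) : 0 ≤ lam m n := by
  unfold lam
  have : (m : ℝ) ≤ n := by exact_mod_cast h
  rw [sub_nonneg]
  apply Real.log_le_log (by positivity)
  linarith

/-- normalization -/
noncomputable def Rw (σ : ℝ) (n : ℕ) : ℝ := Real.exp (-σ * Real.log ((n : ℝ) + 1))

lemma Rw_succ (σ : ℝ) (n : ℕ) : Rw σ (n + 1) = Rw σ n * rr σ n := by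
  unfold Rw rr
  rw [← Real.exp_add]
  push_cast
  have : (n : ℝ) + 1 + 1 = n + 2 := by ring
  rw [this]
  ring_nf

lemma Rw_pos (σ : ℝ) (n : ℕ) : 0 < Rw σ n := Real.exp_pos _

lemma Rw_ratio (σ : ℝ) (m n : ℕ) : Rw σ n * Real.exp (σ * lam m n) = Rw σ m := by
  unfold Rw lam
  rw [← Real.exp_add]
  ring_nf

section
variable (μ : (n : ℕ) → Measure (UG (n + 1))) [∀ n, IsProbabilityMeasure (μ n)]
  [∀ n, (μ n).IsMulLeftInvariant]

lemma BB_self (F : Om → ℝ) (m : ℕ) (s s' θ θ' : ℝ) : BB μ F m m s s' θ θ' = ∫ ω, F ω ∂(Measure.infinitePi μ) := by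
  unfold BB; simp only [EE_self, mul_one]

lemma norm_rec {m : ℕ} {F : Om → ℝ} (h : Adm m F) (n : ℕ) (hmn : m ≤ n) (s s' θ θ' : ℝ) (hs : |s| ≤ 2) (hs' : |s'| ≤ 2) :
    |Rw (s ^ 2 + s' ^ 2) (n + 1) * BB μ F m (n + 1) s s' θ θ' - Rw (s ^ 2 + s' ^ 2) n * BB μ F m n s s' θ θ'
      - (2 * s * s') * xx n * ((Rw (s ^ 2 + s' ^ 2) n : ℂ) * HH μ F m n s s' θ θ').re|
      ≤ CK * yy n * (Rw (s ^ 2 + s' ^ 2) n * BB μ F m n s s' θ θ') ∧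
    ‖(Rw (s ^ 2 + s' ^ 2) (n + 1) : ℂ) * HH μ F m (n + 1) s s' θ θ'
      - Complex.exp ((θ - θ' : ℝ) * Complex.I) * ((Rw (s ^ 2 + s' ^ 2) n : ℂ) * HH μ F m n s s' θ θ')‖
      ≤ CK * xx n * (Rw (s ^ 2 + s' ^ 2) n * BB μ F m n s s' θ θ') := by
  set σ := s ^ 2 + s' ^ 2 with hσ
  have hs2 : s ^ 2 ≤ 4 := by have := sq_abs s; nlinarith [abs_nonneg s]
  have hs2' : s' ^ 2 ≤ 4 := by have := sq_abs s'; nlinarith [abs_nonneg s']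
  have h0 : 0 ≤ σ := by positivity
  have h8 : σ ≤ 8 := by linarith
  have hc : |2 * s * s'| ≤ 8 := by
    rw [abs_mul, abs_mul]
    norm_num
    nlinarith [abs_nonneg s, abs_nonneg s', sq_abs s, sq_abs s', sq_nonneg (|s| - |s'|)]
  have hb := BB_nn μ h n s s' θ θ'
  have hh := HH_le μ h n s s' θ θ'
  have hR := Rw_pos σ n
  have hC := C0_pos
  constructor
  · have := norm_a n h0 h8 hc hb hh (stepB μ h n hmn s s' θ θ' hs hs')
    rw [Rw_succ, Complex.re_ofReal_mul]
    have e : Rw σ n * rr σ n * BB μ F m (n + 1) s s' θ θ' - Rw σ n * BB μ F m n s s' θ θ'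
        - 2 * s * s' * xx n * (Rw σ n * (HH μ F m n s s' θ θ').re)
        = Rw σ n * (rr σ n * BB μ F m (n + 1) s s' θ θ' - BB μ F m n s s' θ θ'
          - 2 * s * s' * xx n * (HH μ F m n s s' θ θ').re) := by ring
    rw [e, abs_mul, abs_of_pos hR]
    have h2 := mul_le_mul_of_nonneg_left this hR.le
    refine h2.trans ?_
    have := yy_pos n
    have : (2 * C0 + 3000) * (Rw σ n * yy n * BB μ F m n s s' θ θ') ≤ CK * (Rw σ n * yy n * BB μ F m n s s' θ θ') := by
      apply mul_le_mul_of_nonneg_right _ (by positivity)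
      unfold CK; linarith
    linarith
  · have := norm_b n h0 h8 (Complex.norm_exp_ofReal_mul_I (θ - θ')) hb hh (stepH μ h n hmn s s' θ θ' hs hs')
    rw [Rw_succ]
    push_cast at this ⊢
    have e : (Rw σ n : ℂ) * rr σ n * HH μ F m (n + 1) s s' θ θ'
        - Complex.exp (((θ : ℂ) - θ') * Complex.I) * (Rw σ n * HH μ F m n s s' θ θ')
        = Rw σ n * (rr σ n * HH μ F m (n + 1) s s' θ θ'
        - Complex.exp (((θ : ℂ) - θ') * Complex.I) * HH μ F m n s s' θ θ') := by ring
    rw [e, norm_mul, Complex.norm_real, Real.norm_eq_abs, abs_of_pos hR]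
    have h2 := mul_le_mul_of_nonneg_left this hR.le
    refine h2.trans ?_
    have := xx_pos n
    have : (36 + 2 * C0 + 158) * (Rw σ n * xx n * BB μ F m n s s' θ θ') ≤ CK * (Rw σ n * xx n * BB μ F m n s s' θ θ') := by
      apply mul_le_mul_of_nonneg_right _ (by positivity)
      unfold CK; linarith
    linarith

lemma lemU {m : ℕ} {F : Om → ℝ} (h : Adm m F) (n : ℕ) (hmn : m ≤ n) (s θ : ℝ) (hs : |s| ≤ 2) :
    ∫ ω, F ω * Real.exp (s * (SS n ω θ - SS m ω θ)) ∂(Measure.infinitePi μ)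
      ≤ (∫ ω, F ω ∂(Measure.infinitePi μ)) * Real.exp (s ^ 2 * lam m n) * Real.exp (CK * g1 m) ∧
    (∫ ω, F ω ∂(Measure.infinitePi μ)) * Real.exp (s ^ 2 * lam m n) * (1 - CK * Real.exp (CK * g1 m) * g1 m)
      ≤ ∫ ω, F ω * Real.exp (s * (SS n ω θ - SS m ω θ)) ∂(Measure.infinitePi μ) := by
  have e : ∫ ω, F ω * Real.exp (s * (SS n ω θ - SS m ω θ)) ∂(Measure.infinitePi μ) = BB μ F m n s 0 θ θ := by
    unfold BB EE; simp
  have e0 := BB_self μ F m s 0 θ θ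
  have hr := Rw_ratio (s ^ 2) m n
  have hR := Rw_pos (s ^ 2) n
  have key := rec_single (A := fun n => Rw (s ^ 2) n * BB μ F m n s 0 θ θ) CK_pos.le m
    (fun n _ => mul_nonneg (Rw_pos _ _).le (BB_nn μ h n s 0 θ θ))
    (fun n hn => by
      have := (norm_rec μ h n hn s 0 θ θ hs (by norm_num)).1
      simpa using this) n hmn
  rw [e0, ← hr] at key
  rw [e]
  obtain ⟨k1, k2⟩ := key
  constructor
  · refine le_of_mul_le_mul_left ?_ hR
    refine k1.trans (le_of_eq ?_)
    ring
  · refine le_of_mul_le_mul_left ?_ hR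
    refine le_trans (le_of_eq ?_) k2
    ring

lemma lemV {m : ℕ} {F : Om → ℝ} (h : Adm m F) (n : ℕ) (hmn : m ≤ n) (s s' θ θ' η : ℝ) (hs : |s| ≤ 2) (hs' : |s'| ≤ 2)
    (hη : 0 < η) (hη2 : η ≤ ‖Complex.exp ((θ - θ' : ℝ) * Complex.I) - 1‖) (hm : 16 ≤ ((m : ℝ) + 2) * η) :
    ∫ ω, F ω * Real.exp (s * (SS n ω θ - SS m ω θ) + s' * (SS n ω θ' - SS m ω θ')) ∂(Measure.infinitePi μ)
      ≤ (∫ ω, F ω ∂(Measure.infinitePi μ)) * Real.exp ((s ^ 2 + s' ^ 2) * lam m n)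
        * Real.exp ((32 * CK + 60) * (g1 m + g2 m / η)) := by
  have e : ∫ ω, F ω * Real.exp (s * (SS n ω θ - SS m ω θ) + s' * (SS n ω θ' - SS m ω θ')) ∂(Measure.infinitePi μ)
    = BB μ F m n s s' θ θ' := rfl
  have e0 := BB_self μ F m s s' θ θ'
  have hr := Rw_ratio (s ^ 2 + s' ^ 2) m n
  have hR := Rw_pos (s ^ 2 + s' ^ 2) n
  have hc : |2 * s * s'| ≤ 8 := by
    rw [abs_mul, abs_mul]
    norm_num
    nlinarith [abs_nonneg s, abs_nonneg s', mul_le_mul hs hs' (abs_nonneg _) (by norm_num)]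
  have key := rec_double (A := fun n => Rw (s ^ 2 + s' ^ 2) n * BB μ F m n s s' θ θ')
    (H := fun n => (Rw (s ^ 2 + s' ^ 2) n : ℂ) * HH μ F m n s s' θ θ') CK_pos.le hc hη hη2 m hm
    (fun n _ => mul_nonneg (Rw_pos _ _).le (BB_nn μ h n s s' θ θ'))
    (fun n _ => by
      have := Rw_pos (s ^ 2 + s' ^ 2) n
      rw [norm_mul, Complex.norm_real, Real.norm_eq_abs, abs_of_pos this]
      have := HH_le μ h n s s' θ θ'
      gcongr)
    (Complex.norm_exp_ofReal_mul_I _)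
    (fun n hn => (norm_rec μ h n hn s s' θ θ' hs hs').1)
    (fun n hn => (norm_rec μ h n hn s s' θ θ' hs hs').2) n hmn
  rw [e0, ← hr] at key
  rw [e]
  refine le_of_mul_le_mul_left ?_ hR
  refine key.trans (le_of_eq ?_)
  ring
end

/-! ### Part K: truncated moments -/

lemma lam_add (a b c : ℕ) : lam a c = lam a b + lam b c := by unfold lam; ring

lemma lam_self (a : ℕ) : lam a a = 0 := by unfold lam; ring

lemma g1_le (n : ℕ) : g1 n ≤ 2 := by
  unfold g1
  rw [div_le_iff₀ (by positivity)]
  have : 1 ≤ √((n : ℝ) + 1) := by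
    rw [Real.one_le_sqrt]
    have : (0:ℝ) ≤ n := by positivity
    linarith
  linarith

/-- increments -/
noncomputable def Yv (m q : ℕ) (θ : ℝ) (ω : Om) : ℝ := SS q ω θ - SS m ω θ

lemma Yv_meas (m q : ℕ) (θ : ℝ) : Measurable (Yv m q θ) := (SS_meas q θ).sub (SS_meas m θ)

lemma Yv_adp (m q : ℕ) (h : m ≤ q) (θ : ℝ) : Adp q (Yv m q θ) := by
  intro ω k u hk
  have h1 := SS_adp q θ ω k u hk
  have h3 := SS_adp m θ ω k u (by omega)
  simp only at h1 h3
  simp only [Yv, h1, h3]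

lemma Yv_bound (m q : ℕ) (θ : ℝ) (ω : Om) : |Yv m q θ ω| ≤ 2 * π * (q + 1) + 2 * π * (m + 1) :=
  (abs_sub _ _).trans (add_le_add (SS_bound _ _ _) (SS_bound _ _ _))

lemma adm_exp (m q : ℕ) (h : m ≤ q) (θ s : ℝ) : Adm q (fun ω => Real.exp (s * Yv m q θ ω)) := by
  refine ⟨Real.measurable_exp.comp ((Yv_meas m q θ).const_mul s), fun ω => (Real.exp_pos _).le,
    ⟨Real.exp (|s| * (2 * π * (q + 1) + 2 * π * (m + 1))), fun ω => ?_⟩, ?_⟩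
  · refine Real.exp_le_exp.mpr ((le_abs_self _).trans ?_)
    rw [abs_mul]
    have := Yv_bound m q θ ω
    gcongr
  · intro ω k u hk
    simp only
    rw [Yv_adp m q h θ ω k u hk]

lemma adm_one (m : ℕ) : Adm m (fun _ => 1) :=
  ⟨measurable_const, fun _ => zero_le_one, ⟨1, fun _ => le_rfl⟩, fun _ _ _ _ => rfl⟩

lemma Adm.add {m : ℕ} {F G : Om → ℝ} (hF : Adm m F) (hG : Adm m G) : Adm m (fun ω => F ω + G ω) := by
  obtain ⟨B, hB⟩ := hF.bd
  obtain ⟨C, hC⟩ := hG.bd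
  refine ⟨hF.meas.add hG.meas, fun ω => add_nonneg (hF.nn ω) (hG.nn ω), ⟨B + C, fun ω => add_le_add (hB ω) (hC ω)⟩, ?_⟩
  intro ω k u hk
  simp only
  rw [hF.adp ω k u hk, hG.adp ω k u hk]

lemma Adm.smul {m : ℕ} {F : Om → ℝ} (hF : Adm m F) (c : ℝ) (hc : 0 ≤ c) : Adm m (fun ω => c * F ω) := by
  obtain ⟨B, hB⟩ := hF.bd
  refine ⟨hF.meas.const_mul c, fun ω => mul_nonneg hc (hF.nn ω), ⟨c * B, fun ω => mul_le_mul_of_nonneg_left (hB ω) hc⟩, ?_⟩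
  intro ω k u hk
  simp only
  rw [hF.adp ω k u hk]

section
variable (μ : (n : ℕ) → Measure (UG (n + 1))) [∀ n, IsProbabilityMeasure (μ n)]
  [∀ n, (μ n).IsMulLeftInvariant]

/-- upper bound for a single exponential moment -/
lemma exp_up (m n : ℕ) (hmn : m ≤ n) (s θ : ℝ) (hs : |s| ≤ 2) :
    ∫ ω, Real.exp (s * Yv m n θ ω) ∂(Measure.infinitePi μ) ≤ Real.exp (2 * CK) * Real.exp (s ^ 2 * lam m n) := by
  have := (lemU μ (adm_one m) n hmn s θ hs).1
  simp only [one_mul, integral_const, probReal_univ, smul_eq_mul, mul_one] at this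
  refine this.trans ?_
  rw [mul_comm]
  have := CK_pos
  have := g1_le m
  have h2 : CK * g1 m ≤ 2 * CK := by nlinarith
  exact mul_le_mul_of_nonneg_right (Real.exp_le_exp.mpr h2) (Real.exp_pos _).le

lemma exp_lo (m n : ℕ) (hmn : m ≤ n) (s θ : ℝ) (hs : |s| ≤ 2) :
    Real.exp (s ^ 2 * lam m n) * (1 - CK * Real.exp (2 * CK) * g1 m) ≤ ∫ ω, Real.exp (s * Yv m n θ ω) ∂(Measure.infinitePi μ) := by
  have := (lemU μ (adm_one m) n hmn s θ hs).2
  simp only [one_mul, integral_const, probReal_univ, smul_eq_mul, mul_one] at this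
  refine le_trans ?_ this
  have := CK_pos
  have := g1_le m
  have := g1_pos m
  have h2 : CK * g1 m ≤ 2 * CK := by nlinarith
  have h3 : CK * Real.exp (CK * g1 m) * g1 m ≤ CK * Real.exp (2 * CK) * g1 m := by
    have := Real.exp_le_exp.mpr h2
    gcongr
  refine mul_le_mul_of_nonneg_left ?_ (Real.exp_pos _).le
  linarith

/-- upper bound for a two-stage exponential moment -/
lemma exp_up2 (m q n : ℕ) (hmq : m ≤ q) (hqn : q ≤ n) (s s' θ : ℝ) (hs : |s| ≤ 2) (hs' : |s'| ≤ 2) :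
    ∫ ω, Real.exp (s * Yv m q θ ω + s' * Yv q n θ ω) ∂(Measure.infinitePi μ)
      ≤ Real.exp (4 * CK) * Real.exp (s ^ 2 * lam m q + s' ^ 2 * lam q n) := by
  have := (lemU μ (adm_exp m q hmq θ s) n hqn s' θ hs').1
  simp only [Real.exp_add]
  refine this.trans ?_
  have h2 := exp_up μ m q hmq s θ hs
  have := CK_pos
  have := g1_le q
  have h3 : CK * g1 q ≤ 2 * CK := by nlinarith
  have h4 := Real.exp_le_exp.mpr h3
  calc _ ≤ (Real.exp (2 * CK) * Real.exp (s ^ 2 * lam m q)) * Real.exp (s' ^ 2 * lam q n) * Real.exp (2 * CK) := by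
        gcongr
    _ = _ := by
      rw [show (4 * CK) = 2 * CK + 2 * CK by ring, Real.exp_add]; ring
end

/-- the good event -/
def Gs (I : ℕ) (q : ℕ → ℕ) (m n : ℕ) (ε M0 θ : ℝ) : Set Om :=
  {ω | (∀ i ∈ Finset.range (I + 1), Yv m (q i) θ ω ≤ 2 * lam m (q i) + M0) ∧ 2 * (1 - 2 * ε) * lam m n ≤ Yv m n θ ω}

lemma Gs_meas (I : ℕ) (q : ℕ → ℕ) (m n : ℕ) (ε M0 θ : ℝ) : MeasurableSet (Gs I q m n ε M0 θ) := by
  have : Gs I q m n ε M0 θ = (⋂ i ∈ Finset.range (I + 1), {ω : Om | Yv m (q i) θ ω ≤ 2 * lam m (q i) + M0})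
      ∩ {ω : Om | 2 * (1 - 2 * ε) * lam m n ≤ Yv m n θ ω} := by
    ext ω; simp [Gs]
  rw [this]
  exact (Finset.measurableSet_biInter _ fun i _ => measurableSet_le (Yv_meas m (q i) θ) measurable_const).inter
    (measurableSet_le measurable_const (Yv_meas m n θ))

/-- weights -/
noncomputable def Wv (m n : ℕ) (ε θ : ℝ) (ω : Om) : ℝ := Real.exp ((1 - ε) * Yv m n θ ω - (1 - ε) ^ 2 * lam m n)

noncomputable def Vv (I : ℕ) (q : ℕ → ℕ) (m n : ℕ) (ε M0 θ : ℝ) : Om → ℝ :=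
  (Gs I q m n ε M0 θ).indicator (Wv m n ε θ)

lemma Wv_meas (m n : ℕ) (ε θ : ℝ) : Measurable (Wv m n ε θ) :=
  Real.measurable_exp.comp (((Yv_meas m n θ).const_mul _).sub_const _)

lemma exp_int {f : Om → ℝ} (μ : (n : ℕ) → Measure (UG (n + 1))) [∀ n, IsProbabilityMeasure (μ n)]
    (hf : Measurable f) (C : ℝ) (h : ∀ ω, |f ω| ≤ C) :
    Integrable (fun ω => Real.exp (f ω)) (Measure.infinitePi μ) :=
  bdd_int' _ (Real.measurable_exp.comp hf) (Real.exp C) fun ω => by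
    rw [Real.norm_eq_abs, abs_of_pos (Real.exp_pos _)]
    exact Real.exp_le_exp.mpr ((le_abs_self _).trans (h ω))

lemma exp_int2 (μ : (n : ℕ) → Measure (UG (n + 1))) [∀ n, IsProbabilityMeasure (μ n)]
    (m q n r : ℕ) (s s' c θ θ' : ℝ) :
    Integrable (fun ω => Real.exp (s * Yv m q θ ω + s' * Yv r n θ' ω + c)) (Measure.infinitePi μ) := by
  refine exp_int μ ((((Yv_meas m q θ).const_mul _).add ((Yv_meas r n θ').const_mul _)).add_const _)
    (|s| * (2 * π * (q + 1) + 2 * π * (m + 1)) + |s'| * (2 * π * (n + 1) + 2 * π * (r + 1)) + |c|) fun ω => ?_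
  refine (abs_add_three _ _ _).trans ?_
  rw [abs_mul, abs_mul]
  have := Yv_bound m q θ ω
  have := Yv_bound r n θ' ω
  gcongr

/-- geometric constant -/
noncomputable def Cg (c : ℝ) : ℝ := Real.exp (c * Real.log 2) / (1 - Real.exp (-c * Real.log 2))

lemma Cg_sum {c : ℝ} (hc : 0 < c) (I : ℕ) (l : ℕ → ℝ) (hl : ∀ i, i ≤ I → ((i : ℝ) - 1) * Real.log 2 ≤ l i) :
    ∑ i ∈ Finset.range (I + 1), Real.exp (-c * l i) ≤ Cg c := by
  have hlog : 0 < Real.log 2 := Real.log_pos (by norm_num)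
  set r := Real.exp (-c * Real.log 2) with hr
  have r0 : 0 < r := Real.exp_pos _
  have r1 : r < 1 := by rw [hr, Real.exp_lt_one_iff]; nlinarith
  have h1 : ∀ i ∈ Finset.range (I + 1), Real.exp (-c * l i) ≤ Real.exp (c * Real.log 2) * r ^ i := by
    intro i hi
    have := hl i (by simpa [Nat.lt_succ_iff] using hi)
    rw [hr, ← Real.exp_nat_mul, ← Real.exp_add]
    apply Real.exp_le_exp.mpr
    nlinarith [mul_le_mul_of_nonneg_left this hc.le]
  refine (Finset.sum_le_sum h1).trans ?_
  rw [← Finset.mul_sum]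
  unfold Cg
  rw [div_eq_mul_inv]
  gcongr
  have h := (summable_geometric_of_lt_one r0.le r1).sum_le_tsum (Finset.range (I + 1)) (fun i _ => by positivity)
  rw [tsum_geometric_of_lt_one r0.le r1] at h
  exact h

section
variable (μ : (n : ℕ) → Measure (UG (n + 1))) [∀ n, IsProbabilityMeasure (μ n)]
  [∀ n, (μ n).IsMulLeftInvariant]

lemma Vv_le (I : ℕ) (q : ℕ → ℕ) (m n : ℕ) (ε M0 θ : ℝ) (ω : Om) : 0 ≤ Vv I q m n ε M0 θ ω ∧ Vv I q m n ε M0 θ ω ≤ Wv m n ε θ ω :=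
  ⟨Set.indicator_nonneg (fun _ _ => (Real.exp_pos _).le) _, Set.indicator_le_self' (fun _ _ => (Real.exp_pos _).le) _⟩

lemma Vv_meas (I : ℕ) (q : ℕ → ℕ) (m n : ℕ) (ε M0 θ : ℝ) : Measurable (Vv I q m n ε M0 θ) :=
  (Wv_meas m n ε θ).indicator (Gs_meas _ _ _ _ _ _ _)

lemma Wv_bound (m n : ℕ) (ε θ : ℝ) : ∃ C, ∀ ω, Wv m n ε θ ω ≤ C := by
  refine ⟨Real.exp (|1 - ε| * (2 * π * (n + 1) + 2 * π * (m + 1)) + |(1 - ε) ^ 2 * lam m n|), fun ω => ?_⟩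
  refine Real.exp_le_exp.mpr ((le_abs_self _).trans ((abs_sub _ _).trans ?_))
  rw [abs_mul]
  have := Yv_bound m n θ ω
  gcongr

lemma Vv_int (I : ℕ) (q : ℕ → ℕ) (m n : ℕ) (ε M0 θ : ℝ) : Integrable (Vv I q m n ε M0 θ) (Measure.infinitePi μ) := by
  obtain ⟨C, hC⟩ := Wv_bound m n ε θ
  refine bdd_int' _ (Vv_meas _ _ _ _ _ _ _) C fun ω => ?_
  have := Vv_le I q m n ε M0 θ ω
  rw [Real.norm_eq_abs, abs_of_nonneg this.1]
  exact this.2.trans (hC ω)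

lemma first_moment (I : ℕ) (q : ℕ → ℕ) (m n : ℕ) (ε M0 θ : ℝ) (hε : 0 < ε) (hε1 : ε < 1 / 4) (hmn : m ≤ n)
    (hq1 : ∀ i, m ≤ q i) (hq2 : ∀ i, q i ≤ n) (hl : ∀ i, i ≤ I → ((i : ℝ) - 1) * Real.log 2 ≤ lam m (q i)) :
    1 - CK * Real.exp (2 * CK) * g1 m - Real.exp (4 * CK) * Cg (ε ^ 2) * Real.exp (-ε * M0)
      - Real.exp (2 * CK) * Real.exp (-ε ^ 2 * lam m n) ≤ ∫ ω, Vv I q m n ε M0 θ ω ∂(Measure.infinitePi μ) := by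
  set t := 1 - ε with ht
  set Λ := lam m n with hΛ
  -- the three kinds of terms
  set T1 : ℕ → Om → ℝ := fun i ω => Real.exp ((t + ε) * Yv m (q i) θ ω + t * Yv (q i) n θ ω
      + (- t ^ 2 * Λ - ε * (2 * lam m (q i) + M0))) with hT1
  set T2 : Om → ℝ := fun ω => Real.exp ((t - ε) * Yv m n θ ω + 0 * Yv m n θ ω
      + (- t ^ 2 * Λ + ε * (2 * (1 - 2 * ε) * Λ))) with hT2
  have iT1 : ∀ i, Integrable (T1 i) (Measure.infinitePi μ) := fun i => exp_int2 μ _ _ _ _ _ _ _ _ _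
  have iT2 : Integrable T2 (Measure.infinitePi μ) := exp_int2 μ _ _ _ _ _ _ _ _ _
  have hYadd : ∀ i ω, Yv m n θ ω = Yv m (q i) θ ω + Yv (q i) n θ ω := fun i ω => by unfold Yv; ring
  have e1 : ∀ i ω, T1 i ω = Wv m n ε θ ω * Real.exp (ε * (Yv m (q i) θ ω - (2 * lam m (q i) + M0))) := by
    intro i ω
    rw [hT1, Wv, ← Real.exp_add]
    simp only
    congr 1
    rw [hYadd i ω, ← hΛ, ← ht]; ring
  have e2 : ∀ ω, T2 ω = Wv m n ε θ ω * Real.exp (-(ε * (Yv m n θ ω - (2 * (1 - 2 * ε) * Λ)))) := by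
    intro ω
    rw [hT2, Wv, ← Real.exp_add]
    simp only
    congr 1
    rw [← hΛ, ← ht]; ring
  have iW : Integrable (Wv m n ε θ) (Measure.infinitePi μ) := by
    have := exp_int2 μ m n n m t 0 (- t ^ 2 * Λ) θ θ
    refine this.congr (Eventually.of_forall fun ω => ?_)
    simp only [Wv]
    congr 1
    rw [← hΛ, ← ht]; ring
  have pw : ∀ ω, Wv m n ε θ ω - (∑ i ∈ Finset.range (I + 1), T1 i ω) - T2 ω ≤ Vv I q m n ε M0 θ ω := by
    intro ω
    have hp1 : ∀ i, 0 ≤ T1 i ω := fun i => (Real.exp_pos _).le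
    have hp2 : 0 ≤ T2 ω := (Real.exp_pos _).le
    have hs : 0 ≤ ∑ i ∈ Finset.range (I + 1), T1 i ω := Finset.sum_nonneg fun i _ => hp1 i
    have hW : 0 < Wv m n ε θ ω := Real.exp_pos _
    by_cases h : ω ∈ Gs I q m n ε M0 θ
    · rw [Vv, Set.indicator_of_mem h]; linarith
    · rw [Vv, Set.indicator_of_notMem h]
      simp only [Gs, Set.mem_ofPred_eq, not_and_or, not_forall, not_le] at h
      rcases h with ⟨i, hi, h⟩ | h
      · have h1 : T1 i ω ≤ ∑ i ∈ Finset.range (I + 1), T1 i ω :=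
          Finset.single_le_sum (fun i _ => hp1 i) hi
        have h2 : Wv m n ε θ ω ≤ T1 i ω := by
          rw [e1]
          refine le_mul_of_one_le_right hW.le (Real.one_le_exp ?_)
          have : 0 < Yv m (q i) θ ω - (2 * lam m (q i) + M0) := by linarith
          positivity
        linarith
      · have h2 : Wv m n ε θ ω ≤ T2 ω := by
          rw [e2]
          refine le_mul_of_one_le_right hW.le (Real.one_le_exp ?_)
          nlinarith
        linarith
  have I0 := integral_mono ((iW.sub (integrable_finsetSum (Finset.range (I + 1)) (fun i _ => iT1 i))).sub iT2) (Vv_int μ I q m n ε M0 θ) pw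
  have iS : Integrable (fun ω => ∑ i ∈ Finset.range (I + 1), T1 i ω) (Measure.infinitePi μ) :=
    integrable_finsetSum (Finset.range (I + 1)) (fun i _ => iT1 i)
  have eI : ∫ ω, (Wv m n ε θ ω - (∑ i ∈ Finset.range (I + 1), T1 i ω) - T2 ω) ∂(Measure.infinitePi μ)
      = ∫ ω, Wv m n ε θ ω ∂(Measure.infinitePi μ) - (∑ i ∈ Finset.range (I + 1), ∫ ω, T1 i ω ∂(Measure.infinitePi μ))
        - ∫ ω, T2 ω ∂(Measure.infinitePi μ) := by
    have iD : Integrable (fun ω => Wv m n ε θ ω - ∑ i ∈ Finset.range (I + 1), T1 i ω) (Measure.infinitePi μ) := iW.sub iS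
    rw [integral_sub iD iT2, integral_sub iW iS, integral_finsetSum _ (fun i _ => iT1 i)]
  have b0 : 1 - CK * Real.exp (2 * CK) * g1 m ≤ ∫ ω, Wv m n ε θ ω ∂(Measure.infinitePi μ) := by
    have h1 := exp_lo μ m n hmn t θ (by rw [abs_le]; constructor <;> linarith)
    have : ∀ ω, Wv m n ε θ ω = Real.exp (-(t ^ 2 * Λ)) * Real.exp (t * Yv m n θ ω) := fun ω => by
      rw [Wv, ← Real.exp_add]; congr 1; rw [← hΛ, ← ht]; ring
    simp only [this]
    rw [integral_const_mul]
    have h2 := mul_le_mul_of_nonneg_left h1 (Real.exp_pos (-(t ^ 2 * Λ))).le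
    refine le_trans (le_of_eq ?_) h2
    rw [← mul_assoc, ← Real.exp_add, ← hΛ]; simp
  have b1 : ∀ i, ∫ ω, T1 i ω ∂(Measure.infinitePi μ) ≤ Real.exp (4 * CK) * Real.exp (-ε * M0) * Real.exp (-ε ^ 2 * lam m (q i)) := by
    intro i
    have h1 := exp_up2 μ m (q i) n (hq1 i) (hq2 i) (t + ε) t θ (by rw [abs_le]; constructor <;> linarith)
      (by rw [abs_le]; constructor <;> linarith)
    have : ∀ ω, T1 i ω = Real.exp (- t ^ 2 * Λ - ε * (2 * lam m (q i) + M0)) * Real.exp ((t + ε) * Yv m (q i) θ ω + t * Yv (q i) n θ ω) := fun ω => by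
      rw [hT1, ← Real.exp_add]; simp only; congr 1; ring
    simp only [this]
    rw [integral_const_mul]
    have h2 := mul_le_mul_of_nonneg_left h1 (Real.exp_pos (- t ^ 2 * Λ - ε * (2 * lam m (q i) + M0))).le
    refine h2.trans (le_of_eq ?_)
    rw [← Real.exp_add, ← Real.exp_add, ← Real.exp_add, ← Real.exp_add]
    congr 1
    rw [hΛ, lam_add m (q i) n, ht]
    ring
  have b2 : ∫ ω, T2 ω ∂(Measure.infinitePi μ) ≤ Real.exp (2 * CK) * Real.exp (-ε ^ 2 * Λ) := by
    have h1 := exp_up μ m n hmn (t - ε) θ (by rw [abs_le]; constructor <;> linarith)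
    have : ∀ ω, T2 ω = Real.exp (- t ^ 2 * Λ + ε * (2 * (1 - 2 * ε) * Λ)) * Real.exp ((t - ε) * Yv m n θ ω) := fun ω => by
      rw [hT2, ← Real.exp_add]; simp only; congr 1; ring
    simp only [this]
    rw [integral_const_mul]
    have h2 := mul_le_mul_of_nonneg_left h1 (Real.exp_pos (- t ^ 2 * Λ + ε * (2 * (1 - 2 * ε) * Λ))).le
    refine h2.trans (le_of_eq ?_)
    rw [← Real.exp_add, ← Real.exp_add, ← Real.exp_add]
    congr 1
    rw [← hΛ, ht]
    ring
  have b3 : ∑ i ∈ Finset.range (I + 1), ∫ ω, T1 i ω ∂(Measure.infinitePi μ) ≤ Real.exp (4 * CK) * Cg (ε ^ 2) * Real.exp (-ε * M0) := by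
    refine (Finset.sum_le_sum (fun i _ => b1 i)).trans ?_
    rw [← Finset.mul_sum]
    have := Cg_sum (c := ε ^ 2) (by positivity) I (fun i => lam m (q i)) hl
    have h3 := mul_le_mul_of_nonneg_left this (by positivity : 0 ≤ Real.exp (4 * CK) * Real.exp (-ε * M0))
    linarith
  have I1 := eI ▸ I0
  linarith
end

/-! ### Part L: pair bounds -/

noncomputable def Cp : ℝ := 2 * CK + 3 * (32 * CK + 60) + 1

section
variable (μ : (n : ℕ) → Measure (UG (n + 1))) [∀ n, IsProbabilityMeasure (μ n)]
  [∀ n, (μ n).IsMulLeftInvariant]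

lemma VV_int (I : ℕ) (q : ℕ → ℕ) (m n : ℕ) (ε M0 θ θ' : ℝ) :
    Integrable (fun ω => Vv I q m n ε M0 θ ω * Vv I q m n ε M0 θ' ω) (Measure.infinitePi μ) := by
  obtain ⟨C, hC⟩ := Wv_bound m n ε θ
  obtain ⟨C', hC'⟩ := Wv_bound m n ε θ'
  refine bdd_int' _ ((Vv_meas _ _ _ _ _ _ _).mul (Vv_meas _ _ _ _ _ _ _)) (C * C') fun ω => ?_
  have h1 := Vv_le I q m n ε M0 θ ω
  have h2 := Vv_le I q m n ε M0 θ' ω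
  rw [Real.norm_eq_abs, abs_of_nonneg (mul_nonneg h1.1 h2.1)]
  have h3 := h1.2.trans (hC ω)
  have h4 := h2.2.trans (hC' ω)
  exact mul_le_mul h3 h4 h2.1 (h1.1.trans h3)

lemma pair_far (I : ℕ) (q : ℕ → ℕ) (m n : ℕ) (ε M0 θ θ' η : ℝ) (hε : 0 < ε) (hε1 : ε < 1 / 4) (hmn : m ≤ n)
    (hη : 0 < η) (hη2 : η ≤ ‖Complex.exp ((θ - θ' : ℝ) * Complex.I) - 1‖) (hm : 16 ≤ ((m : ℝ) + 2) * η) :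
    ∫ ω, Vv I q m n ε M0 θ ω * Vv I q m n ε M0 θ' ω ∂(Measure.infinitePi μ)
      ≤ Real.exp ((32 * CK + 60) * (g1 m + g2 m / η)) := by
  set t := 1 - ε with ht
  have ha : |t| ≤ 2 := by rw [abs_le]; constructor <;> linarith
  have h := lemV μ (adm_one m) n hmn t t θ θ' η ha ha hη hη2 hm
  simp only [one_mul, integral_const, probReal_univ, smul_eq_mul, mul_one] at h
  have i1 : Integrable (fun ω => Real.exp (t * (SS n ω θ - SS m ω θ) + t * (SS n ω θ' - SS m ω θ'))) (Measure.infinitePi μ) := by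
    have := exp_int2 μ m n n m t t 0 θ θ'
    simpa only [add_zero, Yv] using this
  have pw : ∀ ω, Vv I q m n ε M0 θ ω * Vv I q m n ε M0 θ' ω
      ≤ Real.exp (-(2 * t ^ 2 * lam m n)) * Real.exp (t * (SS n ω θ - SS m ω θ) + t * (SS n ω θ' - SS m ω θ')) := by
    intro ω
    have h1 := Vv_le I q m n ε M0 θ ω
    have h2 := Vv_le I q m n ε M0 θ' ω
    refine (mul_le_mul h1.2 h2.2 h2.1 (Real.exp_pos _).le).trans (le_of_eq ?_)
    rw [Wv, Wv, ← Real.exp_add, ← Real.exp_add]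
    congr 1
    unfold Yv
    rw [ht]; ring
  refine (integral_mono (VV_int μ I q m n ε M0 θ θ') (i1.const_mul _) pw).trans ?_
  rw [integral_const_mul]
  refine (mul_le_mul_of_nonneg_left h (Real.exp_pos _).le).trans (le_of_eq ?_)
  rw [← Real.exp_add, ← Real.exp_add]
  congr 1
  ring

lemma pair_close (I : ℕ) (q : ℕ → ℕ) (m n i : ℕ) (ε M0 θ θ' η : ℝ) (hε : 0 < ε) (hε1 : ε < 1 / 4) (hi : i ≤ I)
    (hM : 0 ≤ M0) (hmq : m ≤ q i) (hqn : q i ≤ n)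
    (hη : 0 < η) (hη2 : η ≤ ‖Complex.exp ((θ - θ' : ℝ) * Complex.I) - 1‖) (hm : 16 ≤ (((q i : ℕ) : ℝ) + 2) * η)
    (hg : g2 (q i) / η ≤ 1) :
    ∫ ω, Vv I q m n ε M0 θ ω * Vv I q m n ε M0 θ' ω ∂(Measure.infinitePi μ)
      ≤ Real.exp Cp * Real.exp M0 * Real.exp ((1 - 2 * ε ^ 2) * lam m (q i)) := by
  set t := 1 - ε with ht
  have ha : |t| ≤ 2 := by rw [abs_le]; constructor <;> linarith
  set r := q i with hr
  set b := 2 * lam m r + M0 with hb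
  set F : Om → ℝ := fun ω => Real.exp ((2 * t - 1) * b) * (Real.exp (1 * Yv m r θ ω) + Real.exp (1 * Yv m r θ' ω)) with hF
  have aF : Adm r F := ((adm_exp m r hmq θ 1).add (adm_exp m r hmq θ' 1)).smul _ (Real.exp_pos _).le
  have IF : ∫ ω, F ω ∂(Measure.infinitePi μ) ≤ Real.exp ((2 * t - 1) * b) * (2 * (Real.exp (2 * CK) * Real.exp (lam m r))) := by
    rw [hF, integral_const_mul, integral_add ((adm_exp m r hmq θ 1).int μ) ((adm_exp m r hmq θ' 1).int μ)]
    have h1 := exp_up μ m r hmq 1 θ (by norm_num)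
    have h2 := exp_up μ m r hmq 1 θ' (by norm_num)
    rw [one_pow, one_mul] at h1 h2
    refine mul_le_mul_of_nonneg_left ?_ (Real.exp_pos _).le
    linarith
  have h := lemV μ aF n hqn t t θ θ' η ha ha hη hη2 hm
  have i1 : Integrable (fun ω => F ω * Real.exp (t * (SS n ω θ - SS r ω θ) + t * (SS n ω θ' - SS r ω θ'))) (Measure.infinitePi μ) :=
    (aF.ee n hqn t t θ θ').int μ
  have pw : ∀ ω, Vv I q m n ε M0 θ ω * Vv I q m n ε M0 θ' ω
      ≤ Real.exp (-(2 * t ^ 2 * lam m n)) * (F ω * Real.exp (t * (SS n ω θ - SS r ω θ) + t * (SS n ω θ' - SS r ω θ'))) := by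
    intro ω
    have hRHS : 0 ≤ Real.exp (-(2 * t ^ 2 * lam m n)) * (F ω * Real.exp (t * (SS n ω θ - SS r ω θ) + t * (SS n ω θ' - SS r ω θ'))) :=
      mul_nonneg (Real.exp_pos _).le (mul_nonneg (aF.nn ω) (Real.exp_pos _).le)
    by_cases g1 : ω ∈ Gs I q m n ε M0 θ
    swap
    · rw [Vv, Set.indicator_of_notMem g1, zero_mul]; exact hRHS
    by_cases g2 : ω ∈ Gs I q m n ε M0 θ'
    swap
    · rw [Vv, Vv, Set.indicator_of_notMem g2, mul_zero]; exact hRHS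
    rw [Vv, Vv, Set.indicator_of_mem g1, Set.indicator_of_mem g2]
    simp only [Gs, Set.mem_ofPred_eq] at g1 g2
    have b1 : Yv m r θ ω ≤ b := g1.1 i (by simp; omega)
    have b2 : Yv m r θ' ω ≤ b := g2.1 i (by simp; omega)
    have key : Real.exp (t * (Yv m r θ ω + Yv m r θ' ω)) ≤ F ω := by
      simp only [hF]
      rw [mul_add (Real.exp _), ← Real.exp_add, ← Real.exp_add]
      have ht1 : 0 ≤ 2 * t - 1 := by rw [ht]; linarith
      have ht2 : 0 ≤ t := by rw [ht]; linarith
      have e1 := Real.exp_pos ((2 * t - 1) * b + 1 * Yv m r θ ω)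
      have e2 := Real.exp_pos ((2 * t - 1) * b + 1 * Yv m r θ' ω)
      rcases le_total (Yv m r θ ω) (Yv m r θ' ω) with hh | hh
      · have : Real.exp (t * (Yv m r θ ω + Yv m r θ' ω)) ≤ Real.exp ((2 * t - 1) * b + 1 * Yv m r θ' ω) := by
          apply Real.exp_le_exp.mpr
          nlinarith [mul_le_mul_of_nonneg_left hh ht2, mul_le_mul_of_nonneg_left b2 ht1]
        linarith
      · have : Real.exp (t * (Yv m r θ ω + Yv m r θ' ω)) ≤ Real.exp ((2 * t - 1) * b + 1 * Yv m r θ ω) := by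
          apply Real.exp_le_exp.mpr
          nlinarith [mul_le_mul_of_nonneg_left hh ht2, mul_le_mul_of_nonneg_left b1 ht1]
        linarith
    refine le_trans (le_of_eq ?_) (mul_le_mul_of_nonneg_left (mul_le_mul_of_nonneg_right key (Real.exp_pos _).le) (Real.exp_pos _).le)
    rw [Wv, Wv, ← Real.exp_add, ← Real.exp_add, ← Real.exp_add]
    congr 1
    unfold Yv
    rw [ht]; ring
  refine (integral_mono (VV_int μ I q m n ε M0 θ θ') (i1.const_mul _) pw).trans ?_
  rw [integral_const_mul]
  have hCK := CK_pos
  have hg1 := g1_le r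
  have h3 : Real.exp ((32 * CK + 60) * (g1 r + g2 r / η)) ≤ Real.exp (3 * (32 * CK + 60)) := by
    apply Real.exp_le_exp.mpr
    nlinarith
  have h5 : Real.exp (-(2 * t ^ 2 * lam m n)) * ∫ ω, F ω * Real.exp (t * (SS n ω θ - SS r ω θ) + t * (SS n ω θ' - SS r ω θ')) ∂(Measure.infinitePi μ)
      ≤ Real.exp (-(2 * t ^ 2 * lam m n)) * ((Real.exp ((2 * t - 1) * b) * (2 * (Real.exp (2 * CK) * Real.exp (lam m r))))
        * Real.exp ((t ^ 2 + t ^ 2) * lam r n) * Real.exp (3 * (32 * CK + 60))) := by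
    refine mul_le_mul_of_nonneg_left (h.trans ?_) (Real.exp_pos _).le
    have : 0 ≤ ∫ ω, F ω ∂(Measure.infinitePi μ) := integral_nonneg aF.nn
    gcongr
  refine h5.trans ?_
  have h2 : (2:ℝ) ≤ Real.exp 1 := by have := Real.add_one_le_exp 1; linarith
  calc _ ≤ Real.exp (-(2 * t ^ 2 * lam m n)) * ((Real.exp ((2 * t - 1) * b) * (Real.exp 1 * (Real.exp (2 * CK) * Real.exp (lam m r))))
        * Real.exp ((t ^ 2 + t ^ 2) * lam r n) * Real.exp (3 * (32 * CK + 60))) := by gcongr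
    _ ≤ _ := by
      simp only [← Real.exp_add]
      apply Real.exp_le_exp.mpr
      have : Cp = 2 * CK + 3 * (32 * CK + 60) + 1 := rfl
      rw [lam_add m r n, hb, ht, this]
      nlinarith [mul_nonneg hε.le hM]

lemma pair_diag (I : ℕ) (q : ℕ → ℕ) (m n i : ℕ) (ε M0 θ : ℝ) (hε : 0 < ε) (hε1 : ε < 1 / 4) (hi : i ≤ I)
    (hM : 0 ≤ M0) (hmn : m ≤ n) (hqn : q i = n) :
    ∫ ω, Vv I q m n ε M0 θ ω * Vv I q m n ε M0 θ ω ∂(Measure.infinitePi μ)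
      ≤ Real.exp Cp * Real.exp M0 * Real.exp ((1 - 2 * ε ^ 2) * lam m (q i)) := by
  set t := 1 - ε with ht
  rw [hqn]
  set b := 2 * lam m n + M0 with hb
  have i1 := (adm_exp m n hmn θ 1).int μ
  have pw : ∀ ω, Vv I q m n ε M0 θ ω * Vv I q m n ε M0 θ ω
      ≤ Real.exp (-(2 * t ^ 2 * lam m n) + (2 * t - 1) * b) * Real.exp (1 * Yv m n θ ω) := by
    intro ω
    by_cases g1 : ω ∈ Gs I q m n ε M0 θ
    swap
    · rw [Vv, Set.indicator_of_notMem g1, zero_mul]; positivity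
    rw [Vv, Set.indicator_of_mem g1]
    simp only [Gs, Set.mem_ofPred_eq] at g1
    have b1 := g1.1 i (by simp; omega)
    rw [hqn] at b1
    have ht1 : 0 ≤ 2 * t - 1 := by rw [ht]; linarith
    rw [Wv, ← Real.exp_add, ← Real.exp_add]
    apply Real.exp_le_exp.mpr
    nlinarith [mul_le_mul_of_nonneg_left b1 ht1]
  refine (integral_mono (VV_int μ I q m n ε M0 θ θ) (i1.const_mul _) pw).trans ?_
  rw [integral_const_mul]
  have h1 := exp_up μ m n hmn 1 θ (by norm_num)
  refine (mul_le_mul_of_nonneg_left h1 (Real.exp_pos _).le).trans ?_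
  simp only [← Real.exp_add]
  apply Real.exp_le_exp.mpr
  have : Cp = 2 * CK + 3 * (32 * CK + 60) + 1 := rfl
  have hCK := CK_pos
  rw [hb, ht, this]
  nlinarith [mul_nonneg hε.le hM]
end

/-- chord length bound -/
lemma chord_lb {δ : ℝ} (h : |δ| ≤ 1) : |δ| / 2 ≤ ‖Complex.exp ((δ : ℝ) * Complex.I) - 1‖ := by
  have h1 : |Real.sin δ| ≤ ‖Complex.exp ((δ : ℝ) * Complex.I) - 1‖ := by
    have := Complex.abs_im_le_norm (Complex.exp ((δ : ℝ) * Complex.I) - 1)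
    simpa [Complex.exp_ofReal_mul_I_im] using this
  refine le_trans ?_ h1
  have h3 : ∀ x : ℝ, 0 ≤ x → x ≤ 1 → x / 2 ≤ |Real.sin x| := by
    intro x h0 h1
    rcases h0.eq_or_lt with rfl | h0
    · simp
    have := Real.sin_gt_sub_cube h0
    have h4 : x ^ 3 ≤ x := by nlinarith [sq_nonneg x, mul_pos h0 h0]
    exact le_trans (by linarith) (le_abs_self _)
  rcases le_total 0 δ with h0 | h0
  · rw [abs_of_nonneg h0] at h ⊢; exact h3 δ h0 h
  · rw [abs_of_nonpos h0] at h ⊢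
    have := h3 (-δ) (by linarith) h
    rwa [Real.sin_neg, abs_neg] at this

/-! ### Part M: second moment -/

structure Lev (I : ℕ) (q : ℕ → ℕ) (m n : ℕ) : Prop where
  lo : ∀ i, m ≤ q i
  hi : ∀ i, q i ≤ n
  zero : q 0 = m
  top : q I = n
  step : ∀ i, q (i + 1) + 1 ≤ 2 * (q i + 1)
  grow : ∀ i, i ≤ I → ((i : ℝ) - 1) * Real.log 2 ≤ lam m (q i)

lemma lev_exists (m n : ℕ) (hmn : m ≤ n) : ∃ I q, Lev I q m n := by
  classical
  have hex : ∃ I, n + 1 ≤ (m + 1) * 2 ^ I := ⟨n + 1, by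
    have : n + 1 < 2 ^ (n + 1) := Nat.lt_two_pow_self
    nlinarith [Nat.zero_le m, Nat.zero_le (m * 2 ^ (n + 1))]⟩
  have hI := Nat.find_spec hex
  have hmin := fun i => Nat.find_min hex (m := i)
  set I := Nat.find hex
  have hp : ∀ i, m + 1 ≤ (m + 1) * 2 ^ i := fun i => Nat.le_mul_of_pos_right _ (by positivity)
  refine ⟨I, fun i => min ((m + 1) * 2 ^ i - 1) n, ?_, ?_, ?_, ?_, ?_, ?_⟩
  · intro i; have := hp i; simp only [le_min_iff]; omega
  · intro i; exact min_le_right _ _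
  · simp; omega
  · simp only [min_eq_right_iff]; omega
  · intro i
    have := hp i
    have h2 : (m + 1) * 2 ^ (i + 1) = 2 * ((m + 1) * 2 ^ i) := by ring
    simp only [h2]
    omega
  · intro i hi
    have hlog : 0 < Real.log 2 := Real.log_pos (by norm_num)
    rcases i with _ | i
    · have : 0 ≤ lam m (min ((m + 1) * 2 ^ 0 - 1) n) := lam_nonneg (by simp; omega)
      refine le_trans ?_ this
      push_cast; linarith
    · have h1 := hmin i (by omega)
      have h2 : (m + 1) * 2 ^ (i + 1) = 2 * ((m + 1) * 2 ^ i) := by ring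
      have h3 : (m + 1) * 2 ^ i ≤ min ((m + 1) * 2 ^ (i + 1) - 1) n + 1 := by
        have := hp i
        rw [h2]; omega
      have h4 : ((m : ℝ) + 1) * 2 ^ i ≤ ((min ((m + 1) * 2 ^ (i + 1) - 1) n : ℕ) : ℝ) + 1 := by exact_mod_cast h3
      have h5 := Real.log_le_log (by positivity) h4
      rw [Real.log_mul (by positivity) (by positivity), Real.log_pow] at h5
      unfold lam
      push_cast at h5 ⊢
      linarith

open Classical in
/-- counting -/
lemma count_close (K k : ℕ) (Δ x : ℝ) (hΔ : 0 < Δ) (hx : Δ ≤ x) :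
    (((Finset.range K).filter (fun l : ℕ => |(k : ℝ) * Δ - (l : ℝ) * Δ| < x)).card : ℝ) ≤ 3 * x / Δ := by
  set j := ⌊x / Δ⌋₊ with hj
  have h1 : ((Finset.range K).filter (fun l : ℕ => |(k : ℝ) * Δ - (l : ℝ) * Δ| < x)) ⊆ Finset.Icc (k - j) (k + j) := by
    intro l hl
    simp only [Finset.mem_filter, Finset.mem_range] at hl
    have h2 := hl.2
    rw [← sub_mul, abs_mul, abs_of_pos hΔ, ← lt_div_iff₀ hΔ] at h2
    have h3 : |(k : ℝ) - l| < j + 1 := h2.trans (Nat.lt_floor_add_one _)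
    rw [abs_lt] at h3
    have h4 : (k : ℝ) < l + j + 1 := by linarith
    have h5 : (l : ℝ) < k + j + 1 := by linarith
    have h4' : k < l + j + 1 := by exact_mod_cast h4
    have h5' : l < k + j + 1 := by exact_mod_cast h5
    simp only [Finset.mem_Icc]; omega
  have h2 := Finset.card_le_card h1
  rw [Nat.card_Icc] at h2
  have h3 : ((Finset.range K).filter (fun l : ℕ => |(k : ℝ) * Δ - (l : ℝ) * Δ| < x)).card ≤ 2 * j + 1 := by omega
  have h4 : (((Finset.range K).filter (fun l : ℕ => |(k : ℝ) * Δ - (l : ℝ) * Δ| < x)).card : ℝ) ≤ 2 * j + 1 := by exact_mod_cast h3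
  have h5 : (j : ℝ) ≤ x / Δ := Nat.floor_le (div_nonneg (by linarith) hΔ.le)
  have h6 : 1 ≤ x / Δ := by rw [le_div_iff₀ hΔ]; linarith
  rw [mul_div_assoc]; linarith

section
variable (μ : (n : ℕ) → Measure (UG (n + 1))) [∀ n, IsProbabilityMeasure (μ n)]
  [∀ n, (μ n).IsMulLeftInvariant]

open Classical in
lemma pair_unified {I : ℕ} {q : ℕ → ℕ} {m n : ℕ} (hL : Lev I q m n) (ε M0 θ θ' : ℝ) (hε : 0 < ε) (hε1 : ε < 1 / 4)
    (hM : 0 ≤ M0) (hmn : m ≤ n) (hm : 32 ≤ √((m : ℝ) + 1)) (hd1 : |θ - θ'| ≤ 1)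
    (hd : θ = θ' ∨ 32 ≤ ((n : ℝ) + 1) * |θ - θ'|) :
    ∫ ω, Vv I q m n ε M0 θ ω * Vv I q m n ε M0 θ' ω ∂(Measure.infinitePi μ)
      ≤ Real.exp ((32 * CK + 60) * (2 * g1 m)) + Real.exp Cp * Real.exp M0 *
        ((if |θ - θ'| < 1 / √((m : ℝ) + 1) then 1 else 0)
          + ∑ i ∈ Finset.range (I + 1), Real.exp ((1 - 2 * ε ^ 2) * lam m (q i)) *
            (if |θ - θ'| < 64 / ((q i : ℝ) + 1) then 1 else 0)) := by
  set δ := |θ - θ'| with hδ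
  set x := √((m : ℝ) + 1) with hx
  have hx0 : 0 < x := by linarith
  have hxx : x * x = (m : ℝ) + 1 := Real.mul_self_sqrt (by positivity)
  have hδ0 : 0 ≤ δ := abs_nonneg _
  have hch := chord_lb hd1
  have hCK := CK_pos
  have hg1 := g1_pos m
  have hA : 0 ≤ Real.exp ((32 * CK + 60) * (2 * g1 m)) := (Real.exp_pos _).le
  have hBt : ∀ i, 0 ≤ Real.exp ((1 - 2 * ε ^ 2) * lam m (q i)) * (if δ < 64 / ((q i : ℝ) + 1) then (1:ℝ) else 0) := by
    intro i; split_ifs <;> positivity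
  have hB : 0 ≤ ∑ i ∈ Finset.range (I + 1), Real.exp ((1 - 2 * ε ^ 2) * lam m (q i)) *
            (if δ < 64 / ((q i : ℝ) + 1) then (1:ℝ) else 0) := Finset.sum_nonneg fun i _ => hBt i
  have hE : 0 ≤ Real.exp Cp * Real.exp M0 := by positivity
  by_cases hfar : δ < 1 / x
  swap
  · -- far pairs
    push Not at hfar
    rw [div_le_iff₀ hx0] at hfar
    have hδp : 0 < δ := by nlinarith
    have h := pair_far μ I q m n ε M0 θ θ' (δ / 2) hε hε1 hmn (by positivity) hch (by nlinarith)
    refine h.trans ?_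
    have h2 : g2 m / (δ / 2) ≤ g1 m := by
      unfold g1 g2
      rw [← hx, ← hxx, div_div, div_le_div_iff₀ (by positivity) hx0]
      nlinarith
    have h3 : Real.exp ((32 * CK + 60) * (g1 m + g2 m / (δ / 2))) ≤ Real.exp ((32 * CK + 60) * (2 * g1 m)) := by
      apply Real.exp_le_exp.mpr
      nlinarith
    refine h3.trans (le_add_of_nonneg_right (mul_nonneg hE (add_nonneg ?_ hB)))
    split_ifs <;> norm_num
  rw [if_pos hfar]
  have fin : ∀ i, i ≤ I → δ < 64 / ((q i : ℝ) + 1) →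
      ∫ ω, Vv I q m n ε M0 θ ω * Vv I q m n ε M0 θ' ω ∂(Measure.infinitePi μ)
      ≤ Real.exp Cp * Real.exp M0 * Real.exp ((1 - 2 * ε ^ 2) * lam m (q i)) →
      ∫ ω, Vv I q m n ε M0 θ ω * Vv I q m n ε M0 θ' ω ∂(Measure.infinitePi μ)
      ≤ Real.exp ((32 * CK + 60) * (2 * g1 m)) + Real.exp Cp * Real.exp M0 *
        (1 + ∑ i ∈ Finset.range (I + 1), Real.exp ((1 - 2 * ε ^ 2) * lam m (q i)) *
            (if δ < 64 / ((q i : ℝ) + 1) then 1 else 0)) := by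
    intro i hi hc h
    refine h.trans ?_
    have h1 := Finset.single_le_sum (fun i _ => hBt i) (Finset.mem_range.mpr (by omega : i < I + 1))
    simp only [if_pos hc, mul_one] at h1
    have h2 := mul_le_mul_of_nonneg_left (h1.trans (le_add_of_nonneg_left (zero_le_one))) hE
    linarith
  rcases hd with hd | hd
  · have h0 : δ = 0 := by rw [hδ, hd]; simp
    refine fin I le_rfl (by rw [h0]; positivity) ?_
    rw [← hd]
    exact pair_diag μ I q m n I ε M0 θ hε hε1 le_rfl hM hmn hL.top
  · have hδp : 0 < δ := by
      rcases hδ0.eq_or_lt with h | h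
      · rw [← h] at hd; norm_num at hd
      · exact h
    have hex : ∃ i, 32 ≤ ((q i : ℝ) + 1) * δ := ⟨I, by rw [hL.top]; exact hd⟩
    have hs := Nat.find_spec hex
    have hmin := fun i => Nat.find_min hex (m := i)
    have hle : Nat.find hex ≤ I := Nat.find_min' hex (by rw [hL.top]; exact hd)
    set i := Nat.find hex
    have h := pair_close μ I q m n i ε M0 θ θ' (δ / 2) hε hε1 hle hM (hL.lo i) (hL.hi i) (by positivity) hch
      (by nlinarith) (by
        unfold g2
        rw [div_div, div_le_one (by positivity)]; linarith)
    rcases hi0 : i with _ | j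
    · rw [hi0, hL.zero, lam_self, mul_zero, Real.exp_zero] at h
      refine h.trans ?_
      nlinarith
    · refine fin i hle ?_ h
      have h1 := hmin j (by omega)
      push Not at h1
      have h2 : (q (j + 1) : ℝ) + 1 ≤ 2 * ((q j : ℝ) + 1) := by exact_mod_cast hL.step j
      rw [hi0, lt_div_iff₀ (by positivity)]
      nlinarith

/-- average of the truncated weights -/
noncomputable def Zv (I : ℕ) (q : ℕ → ℕ) (m n : ℕ) (ε M0 : ℝ) (K : ℕ) (ω : Om) : ℝ :=
  (1 / (K : ℝ)) * ∑ k ∈ Finset.range K, Vv I q m n ε M0 (gr n (6 * k)) ω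

set_option maxHeartbeats 1600000 in
open Classical in
lemma second_moment {I : ℕ} {q : ℕ → ℕ} {m n : ℕ} (hL : Lev I q m n) (ε M0 : ℝ) (hε : 0 < ε) (hε1 : ε < 1 / 4)
    (hM : 0 ≤ M0) (hm : 32 ≤ √((m : ℝ) + 1)) (hn : 64 * (m + 1) ≤ n + 1) :
    ∫ ω, (Zv I q m n ε M0 ((n + 1) / 64) ω) ^ 2 ∂(Measure.infinitePi μ)
      ≤ Real.exp ((32 * CK + 60) * (2 * g1 m)) + Real.exp Cp * Real.exp M0 *
        (12 / √((m : ℝ) + 1) + 768 * Cg (2 * ε ^ 2) / ((m : ℝ) + 1)) := by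
  have hmn : m ≤ n := by omega
  set K := (n + 1) / 64 with hK
  have hK1 : 64 * K ≤ n + 1 := by omega
  have hK2 : n + 1 ≤ 128 * K := by omega
  have hK0 : 0 < K := by omega
  have hK1' : 64 * (K : ℝ) ≤ n + 1 := by exact_mod_cast hK1
  have hK2' : (n : ℝ) + 1 ≤ 128 * K := by exact_mod_cast hK2
  have hK0' : 0 < (K : ℝ) := by exact_mod_cast hK0
  set Δ : ℝ := 12 * π / (n + 1) with hΔ
  have hpi3 := Real.pi_gt_three
  have hpi4 := Real.pi_lt_d2
  have hn0 : (0:ℝ) < n + 1 := by positivity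
  have hΔ0 : 0 < Δ := by positivity
  have hΔn : Δ * (n + 1) = 12 * π := by rw [hΔ]; field_simp
  have hgr : ∀ k : ℕ, gr n (6 * k) = (k : ℝ) * Δ := by
    intro k; unfold gr; rw [hΔ]; push_cast; ring
  set x := √((m : ℝ) + 1) with hx
  have hx0 : 0 < x := by linarith
  have hxx : x * x = (m : ℝ) + 1 := Real.mul_self_sqrt (by positivity)
  set A := Real.exp ((32 * CK + 60) * (2 * g1 m)) with hA
  set E := Real.exp Cp * Real.exp M0 with hE
  have hE0 : 0 ≤ E := by positivity
  set w : ℕ → ℝ := fun i => Real.exp ((1 - 2 * ε ^ 2) * lam m (q i)) with hw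
  have hmn64 : 64 * ((m : ℝ) + 1) ≤ n + 1 := by exact_mod_cast hn
  -- single row
  have row : ∀ k ∈ Finset.range K, ∑ l ∈ Finset.range K,
      ∫ ω, Vv I q m n ε M0 (gr n (6 * k)) ω * Vv I q m n ε M0 (gr n (6 * l)) ω ∂(Measure.infinitePi μ)
      ≤ K * A + E * (3 * (1 / x) / Δ + ∑ i ∈ Finset.range (I + 1), w i * (3 * (64 / ((q i : ℝ) + 1)) / Δ)) := by
    intro k hk
    have hk' : (k : ℝ) + 1 ≤ K := by exact_mod_cast Finset.mem_range.mp hk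
    have hpt : ∀ l ∈ Finset.range K,
        ∫ ω, Vv I q m n ε M0 (gr n (6 * k)) ω * Vv I q m n ε M0 (gr n (6 * l)) ω ∂(Measure.infinitePi μ)
        ≤ A + E * ((if |(k : ℝ) * Δ - l * Δ| < 1 / x then 1 else 0)
          + ∑ i ∈ Finset.range (I + 1), w i * (if |(k : ℝ) * Δ - l * Δ| < 64 / ((q i : ℝ) + 1) then 1 else 0)) := by
      intro l hl
      have hl' : (l : ℝ) + 1 ≤ K := by exact_mod_cast Finset.mem_range.mp hl
      have hab : |(k : ℝ) * Δ - l * Δ| = |(k : ℝ) - l| * Δ := by rw [← sub_mul, abs_mul, abs_of_pos hΔ0]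
      rw [hgr, hgr]
      refine pair_unified μ hL ε M0 ((k : ℝ) * Δ) (l * Δ) hε hε1 hM hmn hm ?_ ?_
      · rw [hab]
        have h0k : (0:ℝ) ≤ k := by positivity
        have h0l : (0:ℝ) ≤ l := by positivity
        have : |(k : ℝ) - l| ≤ K := by rw [abs_le]; constructor <;> linarith
        nlinarith
      · by_cases hkl : k = l
        · left; rw [hkl]
        · right
          rw [hab]
          have : (1:ℝ) ≤ |(k : ℝ) - l| := by
            have h1 : (1:ℤ) ≤ |(k : ℤ) - l| := Int.one_le_abs (by omega)
            exact_mod_cast h1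
          nlinarith
    refine (Finset.sum_le_sum hpt).trans ?_
    rw [Finset.sum_add_distrib, Finset.sum_const, Finset.card_range, nsmul_eq_mul, ← Finset.mul_sum, Finset.sum_add_distrib,
      Finset.sum_comm]
    refine add_le_add le_rfl (mul_le_mul_of_nonneg_left (add_le_add ?_ (Finset.sum_le_sum fun i hi => ?_)) hE0)
    · rw [Finset.sum_boole]
      refine count_close K k Δ (1 / x) hΔ0 ?_
      rw [le_div_iff₀ hx0]
      have : x ≤ x * x := by nlinarith
      nlinarith
    · rw [← Finset.mul_sum, Finset.sum_boole]
      refine mul_le_mul_of_nonneg_left (count_close K k Δ _ hΔ0 ?_) (Real.exp_pos _).le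
      have hq : (q i : ℝ) + 1 ≤ n + 1 := by exact_mod_cast Nat.succ_le_succ (hL.hi i)
      rw [le_div_iff₀ (by positivity)]
      nlinarith
  have hwb : ∑ i ∈ Finset.range (I + 1), w i * (3 * (64 / ((q i : ℝ) + 1)) / Δ) ≤ 192 / Δ * (Cg (2 * ε ^ 2) / (m + 1)) := by
    have h1 := Cg_sum (c := 2 * ε ^ 2) (by positivity) I (fun i => lam m (q i)) hL.grow
    have h2 : ∀ i ∈ Finset.range (I + 1), w i * (3 * (64 / ((q i : ℝ) + 1)) / Δ)
        = 192 / Δ * (Real.exp (-(2 * ε ^ 2) * lam m (q i)) / (m + 1)) := by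
      intro i _
      have h3 : w i = Real.exp (-(2 * ε ^ 2) * lam m (q i)) * (((q i : ℝ) + 1) / (m + 1)) := by
        have : ((q i : ℝ) + 1) / (m + 1) = Real.exp (lam m (q i)) := by
          unfold lam
          rw [Real.exp_sub, Real.exp_log (by positivity), Real.exp_log (by positivity)]
        rw [this, ← Real.exp_add]
        simp only [hw]
        congr 1; ring
      rw [h3]; field_simp; ring
    rw [Finset.sum_congr rfl h2, ← Finset.mul_sum, ← Finset.sum_div]
    gcongr
  have hKΔ : 1 / (K * Δ) ≤ 4 := by
    rw [div_le_iff₀ (by positivity)]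
    nlinarith
  have eZ : ∫ ω, (Zv I q m n ε M0 K ω) ^ 2 ∂(Measure.infinitePi μ)
      = (1 / (K : ℝ)) ^ 2 * ∑ k ∈ Finset.range K, ∑ l ∈ Finset.range K,
        ∫ ω, Vv I q m n ε M0 (gr n (6 * k)) ω * Vv I q m n ε M0 (gr n (6 * l)) ω ∂(Measure.infinitePi μ) := by
    have : ∀ ω, (Zv I q m n ε M0 K ω) ^ 2 = (1 / (K : ℝ)) ^ 2 * ∑ k ∈ Finset.range K, ∑ l ∈ Finset.range K,
        Vv I q m n ε M0 (gr n (6 * k)) ω * Vv I q m n ε M0 (gr n (6 * l)) ω := by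
      intro ω
      rw [Zv, mul_pow, sq (∑ k ∈ Finset.range K, _), Finset.sum_mul_sum]
    simp only [this]
    rw [integral_const_mul, integral_finsetSum _ (fun k _ => integrable_finsetSum _ (fun l _ => VV_int μ I q m n ε M0 _ _))]
    congr 1
    refine Finset.sum_congr rfl fun k _ => ?_
    rw [integral_finsetSum _ (fun l _ => VV_int μ I q m n ε M0 _ _)]
  rw [eZ]
  have hS := Finset.sum_le_sum row
  rw [Finset.sum_const, Finset.card_range, nsmul_eq_mul] at hS
  have hCg : 0 ≤ Cg (2 * ε ^ 2) := by
    have h1 := Cg_sum (c := 2 * ε ^ 2) (by positivity) I (fun i => lam m (q i)) hL.grow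
    exact le_trans (Finset.sum_nonneg fun i _ => (Real.exp_pos _).le) h1
  calc _ ≤ (1 / (K : ℝ)) ^ 2 * (K * (K * A + E * (3 * (1 / x) / Δ + 192 / Δ * (Cg (2 * ε ^ 2) / (m + 1))))) := by
        refine mul_le_mul_of_nonneg_left (hS.trans ?_) (by positivity)
        gcongr
    _ = A + (1 / (K * Δ)) * (E * (3 / x + 192 * Cg (2 * ε ^ 2) / (m + 1))) := by
        field_simp
    _ ≤ A + 4 * (E * (3 / x + 192 * Cg (2 * ε ^ 2) / (m + 1))) := by
        gcongr
    _ = _ := by ring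
end

/-! ### Part N: tails -/

noncomputable def C1 : ℝ := Real.exp (2 * CK + 4 * π)

lemma C1_pos : 0 < C1 := Real.exp_pos _

noncomputable def ll (n : ℕ) : ℝ := Real.log ((n : ℝ) + 1)

lemma lam_zero (n : ℕ) : lam 0 n = ll n := by unfold lam ll; simp

lemma MM_ge (n : ℕ) (ω : Om) (k : ℕ) (hk : k < n + 1) : |SS n ω (gr n k) - SS n ω 0| ≤ MM n ω :=
  Finset.le_sup' (fun k : Fin (n + 1) => |SS n ω (gr n k) - SS n ω 0|) (Finset.mem_univ (⟨k, hk⟩ : Fin (n + 1)))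

lemma MM_ex (n : ℕ) (ω : Om) : ∃ k : Fin (n + 1), MM n ω = |SS n ω (gr n k) - SS n ω 0| := by
  obtain ⟨k, -, hk⟩ := Finset.exists_mem_eq_sup' (Finset.univ_nonempty) (fun k : Fin (n + 1) => |SS n ω (gr n k) - SS n ω 0|)
  exact ⟨k, hk⟩

lemma MM_nonneg (n : ℕ) (ω : Om) : 0 ≤ MM n ω := by
  obtain ⟨k, hk⟩ := MM_ex n ω
  rw [hk]; exact abs_nonneg _

lemma MM_le (n : ℕ) (ω : Om) : MM n ω ≤ 4 * π * (n + 1) := by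
  obtain ⟨k, hk⟩ := MM_ex n ω
  rw [hk]
  have h1 := SS_bound n ω (gr n k)
  have h2 := SS_bound n ω 0
  have := abs_sub (SS n ω (gr n k)) (SS n ω 0)
  linarith

lemma MM_meas (n : ℕ) : Measurable (MM n) := by
  have : MM n = Finset.univ.sup' Finset.univ_nonempty (fun (k : Fin (n + 1)) (ω : Om) => |SS n ω (gr n k) - SS n ω 0|) := by
    ext ω
    rw [Finset.sup'_apply]
    rfl
  rw [this]
  refine Finset.measurable_sup' _ fun k _ => ?_
  have := (SS_meas n (gr n k)).sub (SS_meas n 0)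
  exact this.abs

section
variable (μ : (n : ℕ) → Measure (UG (n + 1))) [∀ n, IsProbabilityMeasure (μ n)]
  [∀ n, (μ n).IsMulLeftInvariant]

lemma SSexp_int (n : ℕ) (s θ : ℝ) : Integrable (fun ω => Real.exp (s * SS n ω θ)) (Measure.infinitePi μ) := by
  refine exp_int μ ((SS_meas n θ).const_mul s) (|s| * (2 * π * (n + 1))) fun ω => ?_
  rw [abs_mul]
  exact mul_le_mul_of_nonneg_left (SS_bound n ω θ) (abs_nonneg _)

lemma SSexp_up (n : ℕ) (s θ : ℝ) (hs : |s| ≤ 2) :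
    ∫ ω, Real.exp (s * SS n ω θ) ∂(Measure.infinitePi μ) ≤ C1 * Real.exp (s ^ 2 * ll n) := by
  have h := exp_up μ 0 n (Nat.zero_le _) s θ hs
  have i1 := (adm_exp 0 n (Nat.zero_le _) θ s).int μ
  have pw : ∀ ω, Real.exp (s * SS n ω θ) ≤ Real.exp (4 * π) * Real.exp (s * Yv 0 n θ ω) := by
    intro ω
    rw [← Real.exp_add]
    apply Real.exp_le_exp.mpr
    have h0 := SS_bound 0 ω θ
    have h1 : |s * SS 0 ω θ| ≤ 2 * (2 * π) := by
      rw [abs_mul]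
      refine mul_le_mul hs (h0.trans (by simp)) (abs_nonneg _) (by norm_num)
    have h2 := le_abs_self (s * SS 0 ω θ)
    unfold Yv
    linarith
  refine (integral_mono (SSexp_int μ n s θ) (i1.const_mul _) pw).trans ?_
  rw [integral_const_mul]
  refine (mul_le_mul_of_nonneg_left h (Real.exp_pos _).le).trans (le_of_eq ?_)
  rw [lam_zero, C1, Real.exp_add]; ring

lemma tail_one (n : ℕ) (s θ a : ℝ) (hs : |s| ≤ 2) :
    (Measure.infinitePi μ).real {ω | a ≤ s * SS n ω θ} ≤ C1 * Real.exp (s ^ 2 * ll n - a) := by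
  have h := mul_meas_ge_le_integral_of_nonneg (Eventually.of_forall fun ω => (Real.exp_pos (s * SS n ω θ)).le)
    (SSexp_int μ n s θ) (Real.exp a)
  simp only [Real.exp_le_exp] at h
  have h2 := h.trans (SSexp_up μ n s θ hs)
  rw [Real.exp_sub, ← mul_div_assoc, le_div_iff₀ (Real.exp_pos _)]
  linarith

lemma tail_abs (n : ℕ) (s θ a : ℝ) (hs0 : 0 < s) (hs : s ≤ 2) :
    (Measure.infinitePi μ).real {ω | a ≤ |SS n ω θ|} ≤ 2 * C1 * Real.exp (s ^ 2 * ll n - s * a) := by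
  have h1 := tail_one μ n s θ (s * a) (by rwa [abs_of_pos hs0])
  have h2 := tail_one μ n (-s) θ (s * a) (by rwa [abs_neg, abs_of_pos hs0])
  rw [neg_sq] at h2
  have hsub : {ω : Om | a ≤ |SS n ω θ|} ⊆ {ω | s * a ≤ s * SS n ω θ} ∪ {ω | s * a ≤ -s * SS n ω θ} := by
    intro ω hω
    simp only [Set.mem_ofPred_eq, Set.mem_union] at hω ⊢
    rcases le_abs.mp hω with h | h
    · left; nlinarith
    · right; nlinarith
  have h3 := (measureReal_mono hsub).trans (measureReal_union_le (μ := Measure.infinitePi μ) _ _)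
  linarith

lemma MM_upper (n : ℕ) (η : ℝ) (hη : 0 < η) (hη1 : η ≤ 1) :
    (Measure.infinitePi μ).real {ω | (2 + 3 * η) * ll n ≤ MM n ω}
      ≤ 2 * C1 * Real.exp (-(η * ll n)) + 2 * C1 * Real.exp (-(η ^ 2 / 4 * ll n)) := by
  have hl : 0 ≤ ll n := Real.log_nonneg (by linarith [(Nat.cast_nonneg n : (0:ℝ) ≤ n)])
  have hsub : {ω : Om | (2 + 3 * η) * ll n ≤ MM n ω} ⊆
      (⋃ k ∈ (Finset.range (n + 1)), {ω | (2 + 2 * η) * ll n ≤ |SS n ω (gr n k)|}) ∪ {ω | η * ll n ≤ |SS n ω 0|} := by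
    intro ω hω
    simp only [Set.mem_ofPred_eq, Set.mem_union, Set.mem_iUnion, Finset.mem_range] at hω ⊢
    by_contra hcon
    push Not at hcon
    obtain ⟨k, hk⟩ := MM_ex n ω
    have h1 := hcon.1 k k.2
    have h2 := hcon.2
    have := abs_sub (SS n ω (gr n k)) (SS n ω 0)
    linarith
  refine ((measureReal_mono hsub).trans (measureReal_union_le (μ := Measure.infinitePi μ) _ _)).trans ?_
  refine add_le_add ?_ ?_
  · refine (measureReal_biUnion_finset_le _ _).trans ?_
    refine (Finset.sum_le_sum fun k _ => tail_abs μ n (1 + η) (gr n k) ((2 + 2 * η) * ll n) (by linarith) (by linarith)).trans ?_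
    rw [Finset.sum_const, Finset.card_range, nsmul_eq_mul]
    have : ((n + 1 : ℕ) : ℝ) = Real.exp (ll n) := by
      rw [ll, Real.exp_log (by positivity)]; push_cast; ring
    rw [this, mul_comm, mul_assoc, ← Real.exp_add]
    have := C1_pos
    gcongr
    nlinarith [mul_nonneg hη.le hl, mul_nonneg (mul_nonneg hη.le hl) hη.le]
  · refine (tail_abs μ n (η / 2) 0 (η * ll n) (by linarith) (by linarith)).trans (le_of_eq ?_)
    congr 2; ring

lemma MMexp_int (n : ℕ) : Integrable (fun ω => Real.exp (MM n ω)) (Measure.infinitePi μ) := by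
  refine exp_int μ (MM_meas n) (4 * π * (n + 1)) fun ω => ?_
  rw [abs_of_nonneg (MM_nonneg n ω)]
  exact MM_le n ω

lemma MM_exp (n : ℕ) : ∫ ω, Real.exp (MM n ω) ∂(Measure.infinitePi μ) ≤ 4 * C1 * Real.exp (5 * ll n) := by
  set f : ℝ → Om → ℝ := fun θ ω => Real.exp (2 * SS n ω θ) + Real.exp (-2 * SS n ω θ) with hf
  have i1 : ∀ θ, Integrable (f θ) (Measure.infinitePi μ) := fun θ => (SSexp_int μ n 2 θ).add (SSexp_int μ n (-2) θ)
  have b1 : ∀ θ, ∫ ω, f θ ω ∂(Measure.infinitePi μ) ≤ 2 * C1 * Real.exp (4 * ll n) := by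
    intro θ
    rw [hf, integral_add (SSexp_int μ n 2 θ) (SSexp_int μ n (-2) θ)]
    have h1 := SSexp_up μ n 2 θ (by norm_num)
    have h2 := SSexp_up μ n (-2) θ (by norm_num)
    rw [show (2:ℝ) ^ 2 = 4 by norm_num] at h1
    rw [show (-2:ℝ) ^ 2 = 4 by norm_num] at h2
    linarith
  have fpos : ∀ θ ω, 0 ≤ f θ ω := fun θ ω => by simp only [hf]; positivity
  have fabs : ∀ θ ω, Real.exp (2 * |SS n ω θ|) ≤ f θ ω := by
    intro θ ω
    have e1 := Real.exp_pos (2 * SS n ω θ)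
    have e2 := Real.exp_pos (-2 * SS n ω θ)
    simp only [hf]
    rcases abs_cases (SS n ω θ) with h | h
    · rw [h.1]; linarith
    · rw [h.1, show 2 * -SS n ω θ = -2 * SS n ω θ by ring]; linarith
  have pw : ∀ ω, Real.exp (MM n ω) ≤ ∑ k ∈ Finset.range (n + 1), (f (gr n k) ω + f 0 ω) := by
    intro ω
    obtain ⟨k, hk⟩ := MM_ex n ω
    have h1 : Real.exp (MM n ω) ≤ f (gr n k) ω + f 0 ω := by
      have h3 := abs_sub (SS n ω (gr n k)) (SS n ω 0)
      rcases le_total |SS n ω (gr n k)| |SS n ω 0| with h | h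
      · have : Real.exp (MM n ω) ≤ Real.exp (2 * |SS n ω 0|) := Real.exp_le_exp.mpr (by linarith)
        have := fabs 0 ω
        have := fpos (gr n k) ω
        linarith
      · have : Real.exp (MM n ω) ≤ Real.exp (2 * |SS n ω (gr n k)|) := Real.exp_le_exp.mpr (by linarith)
        have := fabs (gr n k) ω
        have := fpos 0 ω
        linarith
    refine h1.trans ?_
    exact Finset.single_le_sum (f := fun k : ℕ => f (gr n k) ω + f 0 ω) (fun k _ => add_nonneg (fpos _ _) (fpos _ _)) (Finset.mem_range.mpr k.2)
  have iS : ∀ k ∈ Finset.range (n + 1), Integrable (fun ω => f (gr n k) ω + f 0 ω) (Measure.infinitePi μ) := fun k _ => (i1 _).add (i1 _)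
  refine (integral_mono (MMexp_int μ n) (integrable_finsetSum _ iS) pw).trans ?_
  rw [integral_finsetSum _ iS]
  have hb : ∀ k ∈ Finset.range (n + 1), ∫ ω, (f (gr n k) ω + f 0 ω) ∂(Measure.infinitePi μ) ≤ 4 * C1 * Real.exp (4 * ll n) := by
    intro k _
    rw [integral_add (i1 _) (i1 _)]
    have := b1 (gr n k)
    have := b1 0
    linarith
  refine (Finset.sum_le_sum hb).trans ?_
  rw [Finset.sum_const, Finset.card_range, nsmul_eq_mul]
  have : ((n + 1 : ℕ) : ℝ) = Real.exp (ll n) := by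
    rw [ll, Real.exp_log (by positivity)]; push_cast; ring
  rw [this, mul_comm, mul_assoc, ← Real.exp_add]
  refine le_of_eq ?_
  congr 2; ring

lemma Zv_meas (I : ℕ) (q : ℕ → ℕ) (m n : ℕ) (ε M0 : ℝ) (K : ℕ) : Measurable (Zv I q m n ε M0 K) := by
  unfold Zv
  exact (Finset.measurable_sum _ fun k _ => Vv_meas _ _ _ _ _ _ _).const_mul _

lemma Zv_first {I : ℕ} {q : ℕ → ℕ} {m n : ℕ} (hL : Lev I q m n) (ε M0 : ℝ) (hε : 0 < ε) (hε1 : ε < 1 / 4)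
    (hmn : m ≤ n) (K : ℕ) (hK : 0 < K) :
    1 - CK * Real.exp (2 * CK) * g1 m - Real.exp (4 * CK) * Cg (ε ^ 2) * Real.exp (-ε * M0)
      - Real.exp (2 * CK) * Real.exp (-ε ^ 2 * lam m n) ≤ ∫ ω, Zv I q m n ε M0 K ω ∂(Measure.infinitePi μ) := by
  unfold Zv
  rw [integral_const_mul, integral_finsetSum _ (fun k _ => Vv_int μ I q m n ε M0 _)]
  have h := Finset.sum_le_sum (fun k (_ : k ∈ Finset.range K) =>
    first_moment μ I q m n ε M0 (gr n (6 * k)) hε hε1 hmn hL.lo hL.hi hL.grow)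
  rw [Finset.sum_const, Finset.card_range, nsmul_eq_mul] at h
  have hK' : (0:ℝ) < K := by exact_mod_cast hK
  have h2 := mul_le_mul_of_nonneg_left h (by positivity : 0 ≤ 1 / (K : ℝ))
  rwa [← mul_assoc, one_div, inv_mul_cancel₀ hK'.ne', one_mul, ← one_div] at h2

/-- deterministic error depending on the first scale only -/
noncomputable def err (ε : ℝ) (m : ℕ) : ℝ :=
  (Real.exp ((32 * CK + 60) * (2 * g1 m)) - 1) + Real.exp Cp * Real.exp (ll m / 4) *
        (12 / √((m : ℝ) + 1) + 768 * Cg (2 * ε ^ 2) / ((m : ℝ) + 1))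
    + 2 * (CK * Real.exp (2 * CK) * g1 m) + 2 * (Real.exp (4 * CK) * Cg (ε ^ 2) * Real.exp (-ε * (ll m / 4)))

lemma MM_lower0 (m n : ℕ) (ε : ℝ) (hε : 0 < ε) (hε1 : ε < 1 / 4)
    (hm : 32 ≤ √((m : ℝ) + 1)) (hn : 64 * (m + 1) ≤ n + 1)
    (hn2 : 2 * ll m + 2 * π * (m + 1) ≤ ε * ll n) :
    (Measure.infinitePi μ).real {ω | MM n ω ≤ (2 - 7 * ε) * ll n}
      ≤ err ε m + 2 * (Real.exp (2 * CK) * Real.exp (-ε ^ 2 * lam m n)) + 2 * C1 * Real.exp (-(ε ^ 2 / 4 * ll n)) := by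
  have hmn : m ≤ n := by omega
  obtain ⟨I, q, hL⟩ := lev_exists m n hmn
  set M0 := ll m / 4 with hM0
  have hlm : 0 ≤ ll m := Real.log_nonneg (by linarith [(Nat.cast_nonneg m : (0:ℝ) ≤ m)])
  have hM : 0 ≤ M0 := by positivity
  set K := (n + 1) / 64 with hK
  have hK0 : 0 < K := by omega
  have hK1 : 64 * K ≤ n + 1 := by omega
  set Z := Zv I q m n ε M0 K with hZ
  have mZ : Measurable Z := Zv_meas I q m n ε M0 K
  have hfirst := Zv_first μ hL ε M0 hε hε1 hmn K hK0
  have hsec := second_moment μ hL ε M0 hε hε1 hM hm hn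
  rw [← hK, ← hZ] at hsec
  rw [← hZ] at hfirst
  have iZ : Integrable Z (Measure.infinitePi μ) := by
    rw [hZ]; unfold Zv
    exact (integrable_finsetSum _ (fun k _ => Vv_int μ I q m n ε M0 _)).const_mul _
  have iZ2 : Integrable (fun ω => Z ω ^ 2) (Measure.infinitePi μ) := by
    have : ∀ ω, Z ω ^ 2 = (1 / (K : ℝ)) ^ 2 * ∑ k ∈ Finset.range K, ∑ l ∈ Finset.range K,
        Vv I q m n ε M0 (gr n (6 * k)) ω * Vv I q m n ε M0 (gr n (6 * l)) ω := by
      intro ω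
      rw [hZ, Zv, mul_pow, sq (∑ k ∈ Finset.range K, _), Finset.sum_mul_sum]
    simp only [this]
    exact (integrable_finsetSum _ (fun k _ => integrable_finsetSum _ (fun l _ => VV_int μ I q m n ε M0 _ _))).const_mul _
  have iD : Integrable (fun ω => Z ω ^ 2 - 2 * Z ω + 1) (Measure.infinitePi μ) :=
    (iZ2.sub (iZ.const_mul 2)).add (integrable_const 1)
  have eD : ∫ ω, (Z ω ^ 2 - 2 * Z ω + 1) ∂(Measure.infinitePi μ)
      = ∫ ω, Z ω ^ 2 ∂(Measure.infinitePi μ) - 2 * ∫ ω, Z ω ∂(Measure.infinitePi μ) + 1 := by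
    have i3 : Integrable (fun ω => Z ω ^ 2 - 2 * Z ω) (Measure.infinitePi μ) := iZ2.sub (iZ.const_mul 2)
    rw [integral_add i3 (integrable_const 1), integral_sub iZ2 (iZ.const_mul 2), integral_const_mul]
    simp
  have hcheb := mul_meas_ge_le_integral_of_nonneg (μ := Measure.infinitePi μ) (f := fun ω => Z ω ^ 2 - 2 * Z ω + 1)
    (Eventually.of_forall fun ω => by
      have := sq_nonneg (Z ω - 1)
      simp only [Pi.zero_apply]
      nlinarith) iD 1
  rw [one_mul, eD] at hcheb
  have hsub : {ω : Om | MM n ω ≤ (2 - 7 * ε) * ll n} ⊆ {ω | 1 ≤ Z ω ^ 2 - 2 * Z ω + 1} ∪ {ω | ε * ll n ≤ |SS n ω 0|} := by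
    intro ω hω
    simp only [Set.mem_ofPred_eq, Set.mem_union] at hω ⊢
    by_contra hcon
    push Not at hcon
    obtain ⟨h1, h2⟩ := hcon
    have hZ0 : Z ω ≠ 0 := by
      intro h; rw [h] at h1; norm_num at h1
    have : ∃ k ∈ Finset.range K, Vv I q m n ε M0 (gr n (6 * k)) ω ≠ 0 := by
      by_contra hno
      push Not at hno
      apply hZ0
      rw [hZ, Zv, Finset.sum_eq_zero hno, mul_zero]
    obtain ⟨k, hk, hV⟩ := this
    have hG : ω ∈ Gs I q m n ε M0 (gr n (6 * k)) := by
      by_contra hG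
      exact hV (Set.indicator_of_notMem hG _)
    simp only [Gs, Set.mem_ofPred_eq] at hG
    have hY := hG.2
    have hb := MM_ge n ω (6 * k) (by have := Finset.mem_range.mp hk; omega)
    have hb2 := abs_le.mp hb
    have h3 := (abs_lt.mp h2)
    have h4 := abs_le.mp (SS_bound m ω (gr n (6 * k)))
    have e : lam m n = ll n - ll m := rfl
    unfold Yv at hY
    rw [e] at hY
    have : 0 ≤ ε * ll m := by positivity
    nlinarith
  refine ((measureReal_mono hsub).trans (measureReal_union_le (μ := Measure.infinitePi μ) _ _)).trans ?_
  have ht := tail_abs μ n (ε / 2) 0 (ε * ll n) (by linarith) (by linarith)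
  have e2 : (ε / 2) ^ 2 * ll n - ε / 2 * (ε * ll n) = -(ε ^ 2 / 4 * ll n) := by ring
  rw [e2] at ht
  have : err ε m = (Real.exp ((32 * CK + 60) * (2 * g1 m)) - 1) + Real.exp Cp * Real.exp M0 *
        (12 / √((m : ℝ) + 1) + 768 * Cg (2 * ε ^ 2) / ((m : ℝ) + 1))
    + 2 * (CK * Real.exp (2 * CK) * g1 m) + 2 * (Real.exp (4 * CK) * Cg (ε ^ 2) * Real.exp (-ε * M0)) := rfl
  linarith
end

/-! ### Part O: conclusion -/

section
variable (μ : (n : ℕ) → Measure (UG (n + 1))) [∀ n, IsProbabilityMeasure (μ n)]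
    [∀ n, (μ n).IsMulLeftInvariant]

lemma E_reduce2 {Ω : Type*} [MeasureSpace Ω] (n : ℕ) (V : Ω → UG (n + 1)) (hV : Measurable V)
    (hVμ : Measure.map V volume = μ n) (hn : 1 ≤ n) (p : ℝ) (hp : 0 < p) :
    ∫⁻ x, ENNReal.ofReal (|((n + 1 : ℕ) : ℝ) / Real.log ((n + 1 : ℕ) : ℝ) * dK (n + 1) (V x) - 1 / π| ^ p)
      ≤ ∫⁻ ω, ENNReal.ofReal ((|MM n ω / (2 * π * Real.log ((n + 1 : ℕ) : ℝ)) - 1 / π|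
          + 2 / Real.log ((n + 1 : ℕ) : ℝ)) ^ p) ∂(Measure.infinitePi μ) := by
  set l := Real.log ((n + 1 : ℕ) : ℝ) with hl
  have hlpos : 0 < l := by
    apply Real.log_pos
    push_cast
    have : (1 : ℝ) ≤ n := by exact_mod_cast hn
    linarith
  set φ : UG (n + 1) → ENNReal := fun U => ENNReal.ofReal ((|DD n U / l - 1 / π| + 1 / l) ^ p) with hφ
  have hφm : Measurable φ := by
    have h1 : Measurable fun x : ℝ => ENNReal.ofReal ((|x / l - 1 / π| + 1 / l) ^ p) := by
      apply Measurable.ennreal_ofReal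
      apply Measurable.pow_const
      fun_prop
    exact h1.comp (DD_meas n)
  calc _ ≤ ∫⁻ x, φ (V x) := by
        refine lintegral_mono fun x => ENNReal.ofReal_le_ofReal ?_
        refine Real.rpow_le_rpow (abs_nonneg _) ?_ hp.le
        have h1 := DD_dK n (V x)
        have e : ((n + 1 : ℕ) : ℝ) / l * dK (n + 1) (V x) - 1 / π
          = (DD n (V x) / l - 1 / π) + (((n + 1 : ℕ) : ℝ) * dK (n + 1) (V x) - DD n (V x)) / l := by ring
        rw [e]
        refine (abs_add_le _ _).trans ?_
        rw [abs_div _ l, abs_of_pos hlpos]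
        gcongr
    _ = ∫⁻ U, φ U ∂(μ n) := by rw [← hVμ, lintegral_map hφm hV]
    _ = ∫⁻ ω, φ (TT n ω) ∂(Measure.infinitePi μ) :=
        law_TT μ n φ hφm fun W U => by simp only [hφ, DD_conj]
    _ ≤ _ := by
        refine lintegral_mono_ae ?_
        filter_upwards [good_ae μ] with ω hω
        refine ENNReal.ofReal_le_ofReal (Real.rpow_le_rpow (by positivity) ?_ hp.le)
        have h1 := DD_MM n ω hω
        have e : DD n (TT n ω) / l - 1 / π
          = (MM n ω / (2 * π * l) - 1 / π) + (DD n (TT n ω) - MM n ω / (2 * π)) / l := by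
          field_simp; ring
        rw [e]
        have h2 := abs_add_le (MM n ω / (2 * π * l) - 1 / π) ((DD n (TT n ω) - MM n ω / (2 * π)) / l)
        rw [abs_div _ l, abs_of_pos hlpos] at h2
        have h3 : |DD n (TT n ω) - MM n ω / (2 * π)| / l ≤ 1 / l := by gcongr
        have h4 : 2 / l = 1 / l + 1 / l := by ring
        linarith

end

lemma ll_tendsto : Tendsto ll atTop atTop := by
  unfold ll
  exact Real.tendsto_log_atTop.comp (tendsto_atTop_add_const_right _ _ tendsto_natCast_atTop_atTop)

lemma exp_ll_tendsto (c : ℝ) (hc : 0 < c) : Tendsto (fun n => Real.exp (-(c * ll n))) atTop (nhds 0) :=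
  Real.tendsto_exp_neg_atTop_nhds_zero.comp (ll_tendsto.const_mul_atTop hc)

lemma sqrt_ll (m : ℕ) : √((m : ℝ) + 1) = Real.exp (ll m / 2) := by
  have h : (m : ℝ) + 1 = Real.exp (ll m / 2) * Real.exp (ll m / 2) := by
    rw [← Real.exp_add, ll, add_halves, Real.exp_log (by positivity)]
  rw [h, Real.sqrt_mul_self (Real.exp_pos _).le]

lemma g1_tendsto : Tendsto g1 atTop (nhds 0) := by
  have : g1 = fun m => 2 * Real.exp (-(1 / 2 * ll m)) := by
    ext m
    unfold g1
    rw [sqrt_ll, Real.exp_neg, div_eq_mul_inv]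
    congr 3; ring
  rw [this]
  simpa using (exp_ll_tendsto (1 / 2) (by norm_num)).const_mul 2

lemma err_tendsto (ε : ℝ) (hε : 0 < ε) : Tendsto (err ε) atTop (nhds 0) := by
  have e : err ε = fun m => (Real.exp ((32 * CK + 60) * (2 * g1 m)) - 1) + Real.exp Cp *
        (12 * Real.exp (-(1 / 4 * ll m)) + 768 * Cg (2 * ε ^ 2) * Real.exp (-(3 / 4 * ll m)))
    + 2 * (CK * Real.exp (2 * CK) * g1 m) + 2 * (Real.exp (4 * CK) * Cg (ε ^ 2) * Real.exp (-(ε / 4 * ll m))) := by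
    ext m
    unfold err
    have h1 : Real.exp (ll m / 4) * (1 / √((m : ℝ) + 1)) = Real.exp (-(1 / 4 * ll m)) := by
      rw [sqrt_ll, one_div, ← Real.exp_neg, ← Real.exp_add]; congr 1; ring
    have h2 : Real.exp (ll m / 4) * (1 / ((m : ℝ) + 1)) = Real.exp (-(3 / 4 * ll m)) := by
      have : (m : ℝ) + 1 = Real.exp (ll m) := by rw [ll, Real.exp_log (by positivity)]
      rw [this, one_div, ← Real.exp_neg, ← Real.exp_add]; congr 1; ring
    have h3 : -ε * (ll m / 4) = -(ε / 4 * ll m) := by ring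
    rw [h3, ← h1, ← h2]
    ring
  rw [e]
  have a1 : Tendsto (fun m => Real.exp ((32 * CK + 60) * (2 * g1 m)) - 1) atTop (nhds 0) := by
    have h := (((g1_tendsto.const_mul 2).const_mul (32 * CK + 60)).rexp).sub_const 1
    simpa using h
  have a2 := ((exp_ll_tendsto (1 / 4) (by norm_num)).const_mul 12).add
    ((exp_ll_tendsto (3 / 4) (by norm_num)).const_mul (768 * Cg (2 * ε ^ 2)))
  have a3 := (g1_tendsto.const_mul (CK * Real.exp (2 * CK))).const_mul 2
  have a4 := ((exp_ll_tendsto (ε / 4) (by positivity)).const_mul (Real.exp (4 * CK) * Cg (ε ^ 2))).const_mul 2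
  have h := ((a1.add (a2.const_mul (Real.exp Cp))).add a3).add a4
  simpa using h

section
variable (μ : (n : ℕ) → Measure (UG (n + 1))) [∀ n, IsProbabilityMeasure (μ n)]
    [∀ n, (μ n).IsMulLeftInvariant]

lemma lower_tendsto (ε : ℝ) (hε : 0 < ε) (hε1 : ε < 1 / 4) :
    Tendsto (fun n => (Measure.infinitePi μ).real {ω | MM n ω ≤ (2 - 7 * ε) * ll n}) atTop (nhds 0) := by
  rw [Metric.tendsto_atTop]
  intro κ hκ
  have h1 : ∀ᶠ m in atTop, err ε m < κ / 2 := (err_tendsto ε hε).eventually_lt_const (by positivity)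
  have h2 : ∀ᶠ m : ℕ in atTop, 32 ≤ √((m : ℝ) + 1) := by
    filter_upwards [eventually_ge_atTop 1024] with m hm
    apply Real.le_sqrt_of_sq_le
    have : (1024 : ℝ) ≤ m := by exact_mod_cast hm
    linarith
  obtain ⟨m, hm1, hm2⟩ := (h1.and h2).exists
  have t1 : Tendsto (fun n => 2 * (Real.exp (2 * CK) * Real.exp (-ε ^ 2 * lam m n)) + 2 * C1 * Real.exp (-(ε ^ 2 / 4 * ll n)))
      atTop (nhds 0) := by
    have : ∀ n, Real.exp (-ε ^ 2 * lam m n) = Real.exp (ε ^ 2 * ll m) * Real.exp (-(ε ^ 2 * ll n)) := by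
      intro n
      have e : lam m n = ll n - ll m := rfl
      rw [e, ← Real.exp_add]; congr 1; ring
    simp only [this]
    have a1 := (((exp_ll_tendsto (ε ^ 2) (by positivity)).const_mul (Real.exp (ε ^ 2 * ll m))).const_mul (Real.exp (2 * CK))).const_mul 2
    have a2 := (exp_ll_tendsto (ε ^ 2 / 4) (by positivity)).const_mul (2 * C1)
    simpa using a1.add a2
  have h3 := t1.eventually_lt_const (by positivity : 0 < κ / 2)
  have h4 : ∀ᶠ n in atTop, 2 * ll m + 2 * π * (m + 1) ≤ ε * ll n :=
    (ll_tendsto.const_mul_atTop hε).eventually_ge_atTop _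
  obtain ⟨n0, hn0⟩ := eventually_atTop.mp (h3.and (h4.and (eventually_ge_atTop (64 * (m + 1)))))
  refine ⟨n0, fun n hn => ?_⟩
  obtain ⟨b1, b2, b3⟩ := hn0 n hn
  have := MM_lower0 μ m n ε hε hε1 hm2 (by omega) b2
  rw [Real.dist_eq, sub_zero, abs_of_nonneg measureReal_nonneg]
  linarith

lemma upper_tendsto (η : ℝ) (hη : 0 < η) (hη1 : η ≤ 1) :
    Tendsto (fun n => (Measure.infinitePi μ).real {ω | (2 + 3 * η) * ll n ≤ MM n ω}) atTop (nhds 0) := by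
  have h := ((exp_ll_tendsto η hη).const_mul (2 * C1)).add ((exp_ll_tendsto (η ^ 2 / 4) (by positivity)).const_mul (2 * C1))
  rw [mul_zero, add_zero] at h
  exact squeeze_zero (fun n => measureReal_nonneg) (fun n => MM_upper μ n η hη hη1) h

/-- the exceptional event -/
def Bad (ρ : ℝ) (n : ℕ) : Set Om := {ω | ρ < |MM n ω / (2 * π * ll n) - 1 / π|}

lemma Bad_meas (ρ : ℝ) (n : ℕ) : MeasurableSet (Bad ρ n) :=
  measurableSet_lt measurable_const (((MM_meas n).div_const _).sub_const _).abs

lemma bad_tendsto (ρ : ℝ) (hρ : 0 < ρ) :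
    Tendsto (fun n => (Measure.infinitePi μ).real (Bad ρ n)) atTop (nhds 0) := by
  set ε := min (1 / 8) (ρ / 2) with hε
  have hε0 : 0 < ε := by positivity
  have hε1 : ε ≤ 1 / 8 := min_le_left _ _
  have hε2 : ε ≤ ρ / 2 := min_le_right _ _
  have h := (lower_tendsto μ ε hε0 (by linarith)).add (upper_tendsto μ ε hε0 (by linarith))
  rw [add_zero] at h
  refine squeeze_zero' (Eventually.of_forall fun n => measureReal_nonneg) ?_ h
  filter_upwards [ll_tendsto.eventually_ge_atTop 1] with n hn
  refine (measureReal_mono ?_).trans (measureReal_union_le (μ := Measure.infinitePi μ) _ _)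
  intro ω hω
  simp only [Bad, Set.mem_ofPred_eq, Set.mem_union] at hω ⊢
  by_contra hcon
  push Not at hcon
  obtain ⟨h1, h2⟩ := hcon
  have hpi := Real.pi_gt_three
  have e : MM n ω / (2 * π * ll n) - 1 / π = (MM n ω - 2 * ll n) / (2 * π * ll n) := by
    field_simp
  rw [e, abs_div, abs_of_pos (by positivity : 0 < 2 * π * ll n), lt_div_iff₀ (by positivity)] at hω
  have h3 : |MM n ω - 2 * ll n| ≤ 7 * ε * ll n := by
    rw [abs_le]; constructor <;> nlinarith
  have h4 : 7 * ε * ll n ≤ ρ * (2 * π * ll n) := by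
    have : 7 * ε ≤ ρ * (2 * π) := by nlinarith
    nlinarith
  linarith

lemma pointwise_p (p : ℝ) (hp : 0 < p) (ρ : ℝ) (hρ : 0 < ρ) (n : ℕ) (hn : 1 ≤ ll n) (ω : Om) :
    (|MM n ω / (2 * π * ll n) - 1 / π| + 2 / ll n) ^ p
      ≤ (ρ + 2 / ll n) ^ p + (15 : ℝ) ^ p * (Bad ρ n).indicator (fun _ => 1) ω
        + (4 * p) ^ p * Real.exp (-(6 * ll n)) * Real.exp (MM n ω) := by
  set l := ll n with hl
  have hl0 : 0 < l := by linarith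
  have hM := MM_nonneg n ω
  set v := |MM n ω / (2 * π * l) - 1 / π| + 2 / l with hv
  have hv0 : 0 ≤ v := by positivity
  have t1 : 0 ≤ (ρ + 2 / l) ^ p := by positivity
  have t2 : 0 ≤ (15 : ℝ) ^ p * (Bad ρ n).indicator (fun _ => 1) ω :=
    mul_nonneg (by positivity) (Set.indicator_nonneg (fun _ _ => zero_le_one) _)
  have t3 : 0 ≤ (4 * p) ^ p * Real.exp (-(6 * l)) * Real.exp (MM n ω) := by positivity
  by_cases hb : ω ∈ Bad ρ n
  swap
  · have h1 : |MM n ω / (2 * π * l) - 1 / π| ≤ ρ := by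
      simp only [Bad, Set.mem_ofPred_eq, not_lt] at hb
      exact hb
    have : v ^ p ≤ (ρ + 2 / l) ^ p := Real.rpow_le_rpow hv0 (by rw [hv]; linarith) hp.le
    linarith
  rw [Set.indicator_of_mem hb, mul_one] at *
  set R := MM n ω / l with hR
  have hMR : MM n ω = R * l := by rw [hR]; field_simp
  have hR0 : 0 ≤ R := by positivity
  have hpi := Real.pi_gt_three
  have hvR : v ≤ R / 6 + 3 := by
    have e : MM n ω / (2 * π * l) = R / (2 * π) := by rw [hMR]; field_simp
    have h1 : R / (2 * π) ≤ R / 6 := by gcongr; linarith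
    have h2 : 1 / π ≤ 1 := by rw [div_le_one (by positivity)]; linarith
    have h3 : 2 / l ≤ 2 := by rw [div_le_iff₀ hl0]; linarith
    have h4 : 0 ≤ 1 / π := by positivity
    have h5 : 0 ≤ R / (2 * π) := by positivity
    have h6 : |MM n ω / (2 * π * l) - 1 / π| ≤ R / 6 + 1 := by
      rw [e, abs_le]; constructor <;> linarith
    linarith
  rcases le_or_gt R 12 with hc | hc
  · have : v ^ p ≤ (15:ℝ) ^ p := Real.rpow_le_rpow hv0 (by linarith) hp.le
    linarith
  · have h1 : v ≤ 4 * p * Real.exp (R / (2 * p)) := by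
      have h2 := Real.add_one_le_exp (R / (2 * p))
      have h3 : 4 * p * (R / (2 * p)) = 2 * R := by field_simp; ring
      nlinarith
    have h2 : v ^ p ≤ (4 * p) ^ p * Real.exp (R / 2) := by
      refine (Real.rpow_le_rpow hv0 h1 hp.le).trans (le_of_eq ?_)
      rw [Real.mul_rpow (by positivity) (Real.exp_pos _).le, ← Real.exp_mul]
      congr 2; field_simp
    have h3 : (4 * p) ^ p * Real.exp (R / 2) ≤ (4 * p) ^ p * Real.exp (-(6 * l)) * Real.exp (MM n ω) := by
      rw [mul_assoc, ← Real.exp_add]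
      have : R / 2 ≤ -(6 * l) + MM n ω := by rw [hMR]; nlinarith
      have h6 := Real.exp_le_exp.mpr this
      gcongr
    have h4 : 0 ≤ (15:ℝ) ^ p := by positivity
    linarith

lemma final_tendsto (p : ℝ) (hp : 0 < p) :
    Tendsto (fun n => ∫⁻ ω, ENNReal.ofReal ((|MM n ω / (2 * π * ll n) - 1 / π| + 2 / ll n) ^ p) ∂(Measure.infinitePi μ))
      atTop (nhds 0) := by
  rw [ENNReal.tendsto_nhds_zero]
  intro κ' hκ'
  obtain ⟨κ, hκ0, hκ⟩ : ∃ κ : ℝ, 0 < κ ∧ ENNReal.ofReal κ ≤ κ' := by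
    obtain ⟨r, hr0, hr⟩ := ENNReal.lt_iff_exists_nnreal_btwn.mp hκ'
    refine ⟨r, by exact_mod_cast hr0, ?_⟩
    rw [ENNReal.ofReal_coe_nnreal]; exact hr.le
  set ρ := (κ / 2) ^ (1 / p) with hρ
  have hρ0 : 0 < ρ := by positivity
  have hρp : ρ ^ p = κ / 2 := by
    rw [hρ, ← Real.rpow_mul (by positivity), one_div, inv_mul_cancel₀ hp.ne', Real.rpow_one]
  have T : Tendsto (fun n => (ρ + 2 / ll n) ^ p + (15 : ℝ) ^ p * (Measure.infinitePi μ).real (Bad ρ n)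
        + (4 * p) ^ p * Real.exp (-(6 * ll n)) * (4 * C1 * Real.exp (5 * ll n))) atTop (nhds (κ / 2)) := by
    have a1 : Tendsto (fun n => (ρ + 2 / ll n) ^ p) atTop (nhds (ρ ^ p)) := by
      have h := (ll_tendsto.const_div_atTop 2).const_add ρ
      rw [add_zero] at h
      exact h.rpow_const (Or.inr hp.le)
    have a2 := (bad_tendsto μ ρ hρ0).const_mul ((15 : ℝ) ^ p)
    have a3 := (exp_ll_tendsto 1 (by norm_num)).const_mul ((4 * p) ^ p * (4 * C1))
    have h := (a1.add a2).add a3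
    rw [mul_zero, mul_zero, add_zero, add_zero, hρp] at h
    refine h.congr fun n => ?_
    have : Real.exp (-(1 * ll n)) = Real.exp (-(6 * ll n)) * Real.exp (5 * ll n) := by
      rw [← Real.exp_add]; congr 1; ring
    rw [this]; ring
  filter_upwards [T.eventually_lt_const (by linarith : κ / 2 < κ), ll_tendsto.eventually_ge_atTop 1] with n h1 h2
  refine le_trans ?_ hκ
  have ib : Integrable ((Bad ρ n).indicator (fun _ => (1:ℝ))) (Measure.infinitePi μ) :=
    (integrable_const 1).indicator (Bad_meas ρ n)
  have i12 : Integrable (fun ω => (ρ + 2 / ll n) ^ p + (15 : ℝ) ^ p * (Bad ρ n).indicator (fun _ => (1:ℝ)) ω) (Measure.infinitePi μ) :=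
    (integrable_const _).add (ib.const_mul _)
  have i3 : Integrable (fun ω => (4 * p) ^ p * Real.exp (-(6 * ll n)) * Real.exp (MM n ω)) (Measure.infinitePi μ) :=
    (MMexp_int μ n).const_mul _
  have i123 := i12.add i3
  have hl0 : 0 < ll n := by linarith
  calc _ ≤ ∫⁻ ω, ENNReal.ofReal (((ρ + 2 / ll n) ^ p + (15 : ℝ) ^ p * (Bad ρ n).indicator (fun _ => 1) ω)
        + (4 * p) ^ p * Real.exp (-(6 * ll n)) * Real.exp (MM n ω)) ∂(Measure.infinitePi μ) :=
        lintegral_mono fun ω => ENNReal.ofReal_le_ofReal (pointwise_p p hp ρ hρ0 n h2 ω)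
    _ = ENNReal.ofReal (∫ ω, (((ρ + 2 / ll n) ^ p + (15 : ℝ) ^ p * (Bad ρ n).indicator (fun _ => 1) ω)
        + (4 * p) ^ p * Real.exp (-(6 * ll n)) * Real.exp (MM n ω)) ∂(Measure.infinitePi μ)) := by
        refine (ofReal_integral_eq_lintegral_ofReal i123 (Eventually.of_forall fun ω => ?_)).symm
        refine le_trans ?_ (pointwise_p p hp ρ hρ0 n h2 ω)
        simp only [Pi.zero_apply]
        positivity
    _ ≤ _ := by
        refine ENNReal.ofReal_le_ofReal (le_trans ?_ h1.le)
        rw [integral_add i12 i3, integral_add (integrable_const _) (ib.const_mul _), integral_const_mul, integral_const_mul,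
          integral_indicator_const _ (Bad_meas ρ n), integral_const, probReal_univ]
        have := MM_exp μ n
        simp only [smul_eq_mul, one_mul, mul_one]
        have h5 := mul_le_mul_of_nonneg_left this (by positivity : 0 ≤ (4 * p) ^ p * Real.exp (-(6 * ll n)))
        linarith
end

/-- For every `p > 0`, `(N / log N) · d_K(μ_N, ν)` converges to `1/π` in `L_p` as `N → ∞`. -/
theorem kolmogorov_Lp_convergence :
    ∀ (Ω : Type) [MeasureSpace Ω],
      IsProbabilityMeasure (volume : Measure Ω) →
      ∀ U : (N : ℕ) → Ω → Matrix.unitaryGroup (Fin N) ℂ,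
        (∀ N, Measurable (U N)) →
        (∀ N, IsProbabilityMeasure (Measure.map (U N) volume) ∧
          (Measure.map (U N) volume).IsHaarMeasure) →
        ∀ p : ℝ, 0 < p →
          Tendsto (fun N : ℕ =>
              ∫ ω, |((N : ℝ) / Real.log N) * dK N (U N ω) - 1 / π| ^ p)
            atTop (nhds 0) := by
  intro Ω _ _ U hU hH p hp
  set μ : (n : ℕ) → Measure (UG (n + 1)) := fun n => Measure.map (U (n + 1)) volume with hμ
  have ip : ∀ n, IsProbabilityMeasure (μ n) := fun n => (hH (n + 1)).1
  have il : ∀ n, (μ n).IsMulLeftInvariant := fun n => by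
    have := (hH (n + 1)).2
    infer_instance
  rw [← tendsto_add_atTop_iff_nat 1]
  have T := final_tendsto μ p hp
  have T2 := (ENNReal.tendsto_toReal ENNReal.zero_ne_top).comp T
  rw [ENNReal.toReal_zero] at T2
  have hfin : ∀ᶠ n in atTop, ∫⁻ ω, ENNReal.ofReal ((|MM n ω / (2 * π * ll n) - 1 / π| + 2 / ll n) ^ p) ∂(Measure.infinitePi μ) < 1 :=
    T.eventually_lt_const (by norm_num)
  refine squeeze_zero' (Eventually.of_forall fun n => integral_nonneg fun ω => by positivity) ?_ T2
  filter_upwards [hfin, eventually_ge_atTop 1] with n h1 h2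
  have e : Real.log ((n + 1 : ℕ) : ℝ) = ll n := by unfold ll; push_cast; rfl
  have h3 := E_reduce2 μ n (U (n + 1)) (hU (n + 1)) rfl h2 p hp
  rw [e] at h3
  simp only [Function.comp]
  refine le_trans ?_ (ENNReal.toReal_mono (h1.trans ENNReal.one_lt_top).ne h3)
  rw [e]
  by_cases hm : AEStronglyMeasurable (fun ω => |((n + 1 : ℕ) : ℝ) / ll n * dK (n + 1) (U (n + 1) ω) - 1 / π| ^ p) volume
  · rw [integral_eq_lintegral_of_nonneg_ae (Eventually.of_forall fun ω => by
      simp only [Pi.zero_apply]; positivity) hm]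
  · rw [integral_non_aestronglyMeasurable hm]
    exact ENNReal.toReal_nonneg
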